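/- Let 2/3 < γ < 2 and let x = (Ω, Σ₊, Σ₋, N₁, N₂, N₃) be a generic Bianchi type IX solution of the Wainwright–Hsu system. Then x(τ) converges to the Bianchi attractor 𝒜 as τ → −∞: lim_{τ→−∞} (Ω(τ) + (N₁N₂)(τ) + (N₂N₃)(τ) + (N₃N₁)(τ)) = 0; equivalently, lim_{τ→−∞} inf_{y ∈ 𝒜} ‖x(τ) − y‖ = 0 in the Euclidean norm on ℝ⁶. -/

import Mathlib

open Real Filter Topology Set

noncomputable section

namespace WainwrightHsu

/-- The deceleration parameter `q` of the Wainwright–Hsu system. -/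
def qf (γ O Sp Sm : ℝ) : ℝ := (1/2) * (3*γ - 2) * O + 2 * (Sp^2 + Sm^2)

/-- The curvature term `S₊`. -/
def SPf (n1 n2 n3 : ℝ) : ℝ := (1/2) * ((n2 - n3)^2 - n1 * (2*n1 - n2 - n3))

/-- The curvature term `S₋`. -/
def SMf (n1 n2 n3 : ℝ) : ℝ := (Real.sqrt 3 / 2) * (n3 - n2) * (n1 - n2 - n3)

/-- The Hamiltonian constraint. -/
def Constraint (O Sp Sm n1 n2 n3 : ℝ) : Prop :=
  O + Sp^2 + Sm^2 + (3/4) * (n1^2 + n2^2 + n3^2 - 2*(n1*n2 + n2*n3 + n3*n1)) = 1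

/-- `(O, Sp, Sm, n1, n2, n3)` is a solution of the Wainwright–Hsu system (with
parameter `γ`) on the set `s ⊆ ℝ`, satisfying `Ω ≥ 0` and the constraint. -/
structure SolOn (γ : ℝ) (s : Set ℝ) (O Sp Sm n1 n2 n3 : ℝ → ℝ) : Prop where
  hn1 : ∀ τ ∈ s, HasDerivAt n1 ((qf γ (O τ) (Sp τ) (Sm τ) - 4 * Sp τ) * n1 τ) τ
  hn2 : ∀ τ ∈ s, HasDerivAt n2
    ((qf γ (O τ) (Sp τ) (Sm τ) + 2 * Sp τ + 2 * Real.sqrt 3 * Sm τ) * n2 τ) τ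
  hn3 : ∀ τ ∈ s, HasDerivAt n3
    ((qf γ (O τ) (Sp τ) (Sm τ) + 2 * Sp τ - 2 * Real.sqrt 3 * Sm τ) * n3 τ) τ
  hSp : ∀ τ ∈ s, HasDerivAt Sp
    (-(2 - qf γ (O τ) (Sp τ) (Sm τ)) * Sp τ - 3 * SPf (n1 τ) (n2 τ) (n3 τ)) τ
  hSm : ∀ τ ∈ s, HasDerivAt Sm
    (-(2 - qf γ (O τ) (Sp τ) (Sm τ)) * Sm τ - 3 * SMf (n1 τ) (n2 τ) (n3 τ)) τ
  hO : ∀ τ ∈ s, HasDerivAt O ((2 * qf γ (O τ) (Sp τ) (Sm τ) - (3*γ - 2)) * O τ) τ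
  hOnn : ∀ τ ∈ s, 0 ≤ O τ
  hcon : ∀ τ ∈ s, Constraint (O τ) (Sp τ) (Sm τ) (n1 τ) (n2 τ) (n3 τ)

/-- The solution is of Taub type. -/
def TaubType (s : Set ℝ) (Sp Sm n1 n2 n3 : ℝ → ℝ) : Prop :=
  (∀ τ ∈ s, Sm τ = 0 ∧ n2 τ = n3 τ) ∨
  (∀ τ ∈ s, Sm τ = -(Real.sqrt 3) * Sp τ ∧ n1 τ = n2 τ) ∨
  (∀ τ ∈ s, Sm τ = Real.sqrt 3 * Sp τ ∧ n3 τ = n1 τ)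

/-- The solution converges to the fixed point `F` as `τ → -∞`. -/
def TendstoF (O Sp Sm n1 n2 n3 : ℝ → ℝ) : Prop :=
  Tendsto O atBot (𝓝 1) ∧ Tendsto Sp atBot (𝓝 0) ∧ Tendsto Sm atBot (𝓝 0) ∧
  Tendsto n1 atBot (𝓝 0) ∧ Tendsto n2 atBot (𝓝 0) ∧ Tendsto n3 atBot (𝓝 0)

/-- The solution converges to the fixed point `P₁⁺(II)` as `τ → -∞`. -/
def TendstoP1 (γ : ℝ) (O Sp Sm n1 n2 n3 : ℝ → ℝ) : Prop :=
  Tendsto O atBot (𝓝 (1 - (3*γ - 2)/16)) ∧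
  Tendsto Sp atBot (𝓝 ((3*γ - 2)/8)) ∧ Tendsto Sm atBot (𝓝 0) ∧
  (∃ c : ℝ, 0 < c ∧ Tendsto n1 atBot (𝓝 c)) ∧
  Tendsto n2 atBot (𝓝 0) ∧ Tendsto n3 atBot (𝓝 0)

/-- The solution converges to the fixed point `P₂⁺(II)` as `τ → -∞`. -/
def TendstoP2 (γ : ℝ) (O Sp Sm n1 n2 n3 : ℝ → ℝ) : Prop :=
  Tendsto O atBot (𝓝 (1 - (3*γ - 2)/16)) ∧
  Tendsto Sp atBot (𝓝 (-((3*γ - 2)/16))) ∧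
  Tendsto Sm atBot (𝓝 (-(Real.sqrt 3 * (3*γ - 2)/16))) ∧
  Tendsto n1 atBot (𝓝 0) ∧
  (∃ c : ℝ, 0 < c ∧ Tendsto n2 atBot (𝓝 c)) ∧ Tendsto n3 atBot (𝓝 0)

/-- The solution converges to the fixed point `P₃⁺(II)` as `τ → -∞`. -/
def TendstoP3 (γ : ℝ) (O Sp Sm n1 n2 n3 : ℝ → ℝ) : Prop :=
  Tendsto O atBot (𝓝 (1 - (3*γ - 2)/16)) ∧
  Tendsto Sp atBot (𝓝 (-((3*γ - 2)/16))) ∧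
  Tendsto Sm atBot (𝓝 (Real.sqrt 3 * (3*γ - 2)/16)) ∧
  Tendsto n1 atBot (𝓝 0) ∧ Tendsto n2 atBot (𝓝 0) ∧
  (∃ c : ℝ, 0 < c ∧ Tendsto n3 atBot (𝓝 c))

/-- A Bianchi IX solution is generic if it is not of Taub type and does not
converge to `F` nor to any of the `Pᵢ⁺(II)` as `τ → -∞`. -/
def Generic (γ : ℝ) (s : Set ℝ) (O Sp Sm n1 n2 n3 : ℝ → ℝ) : Prop :=
  ¬ TaubType s Sp Sm n1 n2 n3 ∧ ¬ TendstoF O Sp Sm n1 n2 n3 ∧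
  ¬ TendstoP1 γ O Sp Sm n1 n2 n3 ∧ ¬ TendstoP2 γ O Sp Sm n1 n2 n3 ∧
  ¬ TendstoP3 γ O Sp Sm n1 n2 n3

/-- `(a, b, c, d, e, f)` is an α-limit point of the solution:
some sequence of times tending to `-∞` along which the solution converges to it. -/
def AlphaLim (O Sp Sm n1 n2 n3 : ℝ → ℝ) (a b c d e f : ℝ) : Prop :=
  ∃ τs : ℕ → ℝ, Tendsto τs atTop atBot ∧
    Tendsto (fun k => O (τs k)) atTop (𝓝 a) ∧
    Tendsto (fun k => Sp (τs k)) atTop (𝓝 b) ∧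
    Tendsto (fun k => Sm (τs k)) atTop (𝓝 c) ∧
    Tendsto (fun k => n1 (τs k)) atTop (𝓝 d) ∧
    Tendsto (fun k => n2 (τs k)) atTop (𝓝 e) ∧
    Tendsto (fun k => n3 (τs k)) atTop (𝓝 f)

/-- ω-limit point (times tending to `+∞`). -/
def OmegaLim (O Sp Sm n1 n2 n3 : ℝ → ℝ) (a b c d e f : ℝ) : Prop :=
  ∃ τs : ℕ → ℝ, Tendsto τs atTop atTop ∧
    Tendsto (fun k => O (τs k)) atTop (𝓝 a) ∧
    Tendsto (fun k => Sp (τs k)) atTop (𝓝 b) ∧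
    Tendsto (fun k => Sm (τs k)) atTop (𝓝 c) ∧
    Tendsto (fun k => n1 (τs k)) atTop (𝓝 d) ∧
    Tendsto (fun k => n2 (τs k)) atTop (𝓝 e) ∧
    Tendsto (fun k => n3 (τs k)) atTop (𝓝 f)

/-- α-limit point, phrased for a point of `ℝ⁶` (in coordinates `Ω, Σ₊, Σ₋, N₁, N₂, N₃`). -/
def AlphaLimPt (O Sp Sm n1 n2 n3 : ℝ → ℝ) (p : Fin 6 → ℝ) : Prop :=
  ∃ τs : ℕ → ℝ, Tendsto τs atTop atBot ∧
    Tendsto (fun k =>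
      (![O (τs k), Sp (τs k), Sm (τs k), n1 (τs k), n2 (τs k), n3 (τs k)] : Fin 6 → ℝ))
      atTop (𝓝 p)

/-- A non-special point of the Kasner circle, given by its `(Σ₊, Σ₋)` coordinates. -/
def NonSpecialKasner (a b : ℝ) : Prop :=
  a^2 + b^2 = 1 ∧ (a, b) ≠ (-1, 0) ∧
  (a, b) ≠ (1/2, Real.sqrt 3 / 2) ∧ (a, b) ≠ (1/2, -(Real.sqrt 3) / 2)

/-- The state vector of a solution, as a point of Euclidean `ℝ⁶`. -/
def stateVec (O Sp Sm n1 n2 n3 : ℝ → ℝ) (τ : ℝ) : EuclideanSpace ℝ (Fin 6) :=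
  (WithLp.equiv 2 (Fin 6 → ℝ)).symm ![O τ, Sp τ, Sm τ, n1 τ, n2 τ, n3 τ]

/-- The Bianchi attractor `𝒜`: the closure of the vacuum type I and II points, i.e. the
points of `ℝ⁶` satisfying the constraint with `Ω = 0` and `N₁N₂ = N₂N₃ = N₃N₁ = 0`. -/
def attractor : Set (EuclideanSpace ℝ (Fin 6)) :=
  {y | Constraint (y 0) (y 1) (y 2) (y 3) (y 4) (y 5) ∧
    y 0 = 0 ∧ y 3 * y 4 = 0 ∧ y 4 * y 5 = 0 ∧ y 5 * y 3 = 0}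


set_option linter.all false

section Proof

variable {v T : ℝ} {O s x a b c : ℝ → ℝ}

/-! ### Analysis tools on left half-lines -/

lemma mono_Iic {T : ℝ} {f f' : ℝ → ℝ} (hf : ∀ τ ≤ T, HasDerivAt f (f' τ) τ)
    (h0 : ∀ τ ≤ T, 0 ≤ f' τ) : MonotoneOn f (Iic T) := by
  apply monotoneOn_of_deriv_nonneg (convex_Iic T)
  · intro τ hτ; exact (hf τ hτ).continuousAt.continuousWithinAt
  · intro τ hτ
    rw [interior_Iic] at hτ
    exact (hf τ (le_of_lt hτ)).differentiableAt.differentiableWithinAt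
  · intro τ hτ
    rw [interior_Iic] at hτ
    rw [(hf τ (le_of_lt hτ)).deriv]
    exact h0 τ (le_of_lt hτ)

lemma anti_Iic {T : ℝ} {f f' : ℝ → ℝ} (hf : ∀ τ ≤ T, HasDerivAt f (f' τ) τ)
    (h0 : ∀ τ ≤ T, f' τ ≤ 0) : AntitoneOn f (Iic T) := by
  have := mono_Iic (f := fun τ => - f τ) (f' := fun τ => - f' τ)
    (fun τ hτ => (hf τ hτ).neg) (fun τ hτ => by have := h0 τ hτ; linarith)
  intro x hx y hy hxy
  have := this hx hy hxy
  simp only [neg_le_neg_iff] at this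
  exact this

lemma mono_lim {T m : ℝ} {f : ℝ → ℝ} (hf : MonotoneOn f (Iic T))
    (hm : ∀ τ ≤ T, m ≤ f τ) :
    ∃ L, m ≤ L ∧ Tendsto f atBot (𝓝 L) ∧ ∀ τ ≤ T, L ≤ f τ := by
  have hbd : BddBelow (f '' Iic T) := ⟨m, by rintro _ ⟨τ, hτ, rfl⟩; exact hm τ hτ⟩
  have hne : (f '' Iic T).Nonempty := ⟨f T, T, le_refl T, rfl⟩
  have hlow : ∀ τ ≤ T, sInf (f '' Iic T) ≤ f τ := fun τ hτ => csInf_le hbd ⟨τ, hτ, rfl⟩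
  refine ⟨sInf (f '' Iic T), ?_, ?_, hlow⟩
  · apply le_csInf hne; rintro _ ⟨τ, hτ, rfl⟩; exact hm τ hτ
  · rw [Metric.tendsto_nhds]
    intro ε hε
    rw [eventually_atBot]
    obtain ⟨_, ⟨t, ht, rfl⟩, h⟩ := exists_lt_of_csInf_lt hne
      (lt_add_of_pos_right (sInf (f '' Iic T)) hε)
    refine ⟨t, fun τ hτ => ?_⟩
    have h1 := hf (mem_Iic.2 (hτ.trans ht)) ht hτ
    have h2 := hlow τ (hτ.trans ht)
    rw [Real.dist_eq, abs_lt]; constructor <;> linarith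

lemma barbalat {T C L : ℝ} {F F' h h' : ℝ → ℝ} (hL : Tendsto F atBot (𝓝 L))
    (hF : ∀ τ ≤ T, HasDerivAt F (F' τ) τ) (hFh : ∀ τ ≤ T, h τ ≤ F' τ)
    (hh : ∀ τ ≤ T, HasDerivAt h (h' τ) τ) (hC : ∀ τ ≤ T, h' τ ≤ C) :
    ∀ ε > 0, ∀ᶠ τ in atBot, h τ < ε := by
  intro ε hε
  set C1 := max C 1 with hC1
  have hC1p : 0 < C1 := lt_of_lt_of_le one_pos (le_max_right _ _)
  set δ := ε / (2 * C1) with hδ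
  have hδp : 0 < δ := by positivity
  rw [Metric.tendsto_nhds] at hL
  obtain ⟨t, ht⟩ := eventually_atBot.1 (hL (δ * ε / 8) (by positivity))
  filter_upwards [eventually_le_atBot (min t T)] with τ hτ
  have hτt := hτ.trans (min_le_left _ _)
  have hτT := hτ.trans (min_le_right _ _)
  by_contra hcon
  push Not at hcon
  -- h σ ≥ ε/2 on [τ-δ, τ]
  have hlow : ∀ σ, τ - δ ≤ σ → σ ≤ τ → ε / 2 ≤ h σ := by
    intro σ h1 h2
    have hm := anti_Iic (T := T) (f := fun y => h y - C1 * y) (f' := fun y => h' y - C1)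
      (fun y hy => ((hh y hy).sub ((hasDerivAt_id y).const_mul C1)).congr_deriv (by ring))
      (fun y hy => by have := hC y hy; have := le_max_left C 1; linarith)
    have := hm (mem_Iic.2 (h2.trans hτT)) (mem_Iic.2 hτT) h2
    simp only at this
    have e : C1 * δ = ε / 2 := by rw [hδ]; field_simp
    nlinarith
  have hm : F τ - F (τ - δ) ≥ δ * ε / 2 := by
    have : MonotoneOn (fun y => F y - ε / 2 * y) (Icc (τ - δ) τ) := by
      apply monotoneOn_of_deriv_nonneg (convex_Icc _ _)
      · intro y hy
        exact (((hF y (hy.2.trans hτT)).sub ((hasDerivAt_id y).const_mul _))).continuousAt.continuousWithinAt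
      · intro y hy
        rw [interior_Icc] at hy
        exact (((hF y (hy.2.le.trans hτT)).sub ((hasDerivAt_id y).const_mul _))).differentiableAt.differentiableWithinAt
      · intro y hy
        rw [interior_Icc] at hy
        have := ((hF y (hy.2.le.trans hτT)).sub ((hasDerivAt_id y).const_mul (ε/2))).deriv
        simp only [id] at this
        have e : (fun y => F y - ε / 2 * y) = F - fun y => ε / 2 * y := rfl
        rw [e, this]
        have := hlow y hy.1.le hy.2.le
        have := hFh y (hy.2.le.trans hτT)
        linarith
    have := this (left_mem_Icc.2 (by linarith)) (right_mem_Icc.2 (by linarith)) (by linarith : τ - δ ≤ τ)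
    simp only at this
    nlinarith
  have h1 := ht τ hτt
  have h2 := ht (τ - δ) (by linarith)
  rw [Real.dist_eq, abs_lt] at h1 h2
  nlinarith [mul_pos hδp hε]

lemma dichotomy {T a b : ℝ} {f : ℝ → ℝ} (hc : ∀ τ ≤ T, ContinuousAt f τ)
    (h : ∀ τ ≤ T, f τ ≤ a ∨ b ≤ f τ) (hab : a < b) :
    (∀ τ ≤ T, f τ ≤ a) ∨ (∀ τ ≤ T, b ≤ f τ) := by
  by_contra hcon
  push Not at hcon
  obtain ⟨⟨t1, h1, h1'⟩, t2, h2, h2'⟩ := hcon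
  have hb1 : b ≤ f t1 := (h t1 h1).resolve_left (by linarith)
  have ha2 : f t2 ≤ a := (h t2 h2).resolve_right (by linarith)
  have hpc : IsPreconnected (Iic T) := isPreconnected_Iic
  have := hpc.intermediate_value (mem_Iic.2 h2) (mem_Iic.2 h1)
    (fun τ hτ => (hc τ hτ).continuousWithinAt)
  obtain ⟨t, ht, hft⟩ := this (show (a + b) / 2 ∈ Icc (f t2) (f t1) from ⟨by linarith, by linarith⟩)
  rcases h t ht with h | h <;> linarith

/-- bounded with bounded derivative near `-∞` -/
def BD (f : ℝ → ℝ) : Prop :=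
  ∃ T C, ∀ τ ≤ T, |f τ| ≤ C ∧ ∃ d, HasDerivAt f d τ ∧ |d| ≤ C

lemma BD.const (c : ℝ) : BD (fun _ => c) :=
  ⟨0, |c|, fun τ _ => ⟨le_rfl, 0, hasDerivAt_const τ c, by simp⟩⟩

lemma BD.add {f g : ℝ → ℝ} (hf : BD f) (hg : BD g) : BD (fun τ => f τ + g τ) := by
  obtain ⟨T, C, hf⟩ := hf
  obtain ⟨T', C', hg⟩ := hg
  refine ⟨min T T', C + C', fun τ hτ => ?_⟩
  obtain ⟨h1, d, h2, h3⟩ := hf τ (hτ.trans (min_le_left _ _))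
  obtain ⟨k1, e, k2, k3⟩ := hg τ (hτ.trans (min_le_right _ _))
  exact ⟨(abs_add_le _ _).trans (by linarith), d + e, h2.add k2, (abs_add_le _ _).trans (by linarith)⟩

lemma BD.mul {f g : ℝ → ℝ} (hf : BD f) (hg : BD g) : BD (fun τ => f τ * g τ) := by
  obtain ⟨T, C, hf⟩ := hf
  obtain ⟨T', C', hg⟩ := hg
  refine ⟨min T T', 2 * C * C', fun τ hτ => ?_⟩
  obtain ⟨h1, d, h2, h3⟩ := hf τ (hτ.trans (min_le_left _ _))
  obtain ⟨k1, e, k2, k3⟩ := hg τ (hτ.trans (min_le_right _ _))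
  have hC : 0 ≤ C := (abs_nonneg _).trans h1
  have hC' : 0 ≤ C' := (abs_nonneg _).trans k1
  refine ⟨?_, d * g τ + f τ * e, h2.mul k2, (abs_add_le _ _).trans ?_⟩
  · rw [abs_mul]
    have := mul_le_mul h1 k1 (abs_nonneg _) hC
    nlinarith
  · rw [abs_mul, abs_mul]
    have := mul_le_mul h3 k1 (abs_nonneg _) hC
    have := mul_le_mul h1 k3 (abs_nonneg _) hC
    linarith

lemma BD.neg {f : ℝ → ℝ} (hf : BD f) : BD (fun τ => - f τ) := by
  have := (BD.const (-1)).mul hf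
  simpa using this

lemma BD.sub {f g : ℝ → ℝ} (hf : BD f) (hg : BD g) : BD (fun τ => f τ - g τ) := by
  simpa [sub_eq_add_neg] using hf.add hg.neg

lemma BD.pow {f : ℝ → ℝ} (hf : BD f) (n : ℕ) : BD (fun τ => f τ ^ n) := by
  induction n with
  | zero => simpa using BD.const 1
  | succ n ih => simpa [pow_succ] using ih.mul hf

lemma barbalatBD {T L : ℝ} {F F' h : ℝ → ℝ} (hL : Tendsto F atBot (𝓝 L))
    (hF : ∀ τ ≤ T, HasDerivAt F (F' τ) τ) (hFh : ∀ τ ≤ T, h τ ≤ F' τ)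
    (hh : BD h) : ∀ ε > 0, ∀ᶠ τ in atBot, h τ < ε := by
  obtain ⟨T', C, hh⟩ := hh
  refine barbalat (T := min T T') (C := C) (h' := deriv h) hL
    (fun τ hτ => hF τ (hτ.trans (min_le_left _ _)))
    (fun τ hτ => hFh τ (hτ.trans (min_le_left _ _))) (fun τ hτ => ?_) (fun τ hτ => ?_)
  · obtain ⟨_, d, hd, _⟩ := hh τ (hτ.trans (min_le_right _ _))
    exact hd.differentiableAt.hasDerivAt
  · obtain ⟨_, d, hd, hd'⟩ := hh τ (hτ.trans (min_le_right _ _))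
    rw [hd.deriv]; exact (le_abs_self d).trans hd'

/-- If `f → L` and `f'` has bounded derivative then `f' → 0`. -/
lemma barbalat_deriv {T L : ℝ} {f f' : ℝ → ℝ} (hL : Tendsto f atBot (𝓝 L))
    (hf : ∀ τ ≤ T, HasDerivAt f (f' τ) τ) (hh : BD f') : Tendsto f' atBot (𝓝 0) := by
  rw [Metric.tendsto_nhds]
  intro ε hε
  have h1 := barbalatBD hL hf (fun τ _ => le_rfl) hh ε hε
  have h2 := barbalatBD (F := fun τ => - f τ) (F' := fun τ => - f' τ) (h := fun τ => - f' τ)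
    hL.neg (fun τ hτ => (hf τ hτ).neg) (fun τ _ => le_rfl) hh.neg ε hε
  filter_upwards [h1, h2] with τ h1 h2
  rw [Real.dist_eq, sub_zero, abs_lt]
  constructor <;> linarith

/-- eventual statements as half-line statements -/
lemma ev_Iic {p : ℝ → Prop} (h : ∀ᶠ τ in atBot, p τ) : ∃ T, ∀ τ ≤ T, p τ :=
  eventually_atBot.1 h

/-- `q` in terms of `v = (3γ-2)/8` -/
def qv (v O s x : ℝ) : ℝ := 4 * v * O + 2 * (s^2 + x^2)

/-- A Bianchi IX solution on `(-∞, T]`, with `v = (3γ-2)/8`. -/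
structure BS (v T : ℝ) (O s x a b c : ℝ → ℝ) : Prop where
  v0 : 0 < v
  v1 : v < 1/2
  dO : ∀ τ ≤ T, HasDerivAt O ((2 * qv v (O τ) (s τ) (x τ) - 8 * v) * O τ) τ
  ds : ∀ τ ≤ T, HasDerivAt s (-(2 - qv v (O τ) (s τ) (x τ)) * s τ
    - 3/2 * ((b τ - c τ)^2 - a τ * (2 * a τ - b τ - c τ))) τ
  dx : ∀ τ ≤ T, HasDerivAt x (-(2 - qv v (O τ) (s τ) (x τ)) * x τ
    - 3 * √3 / 2 * (c τ - b τ) * (a τ - b τ - c τ)) τ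
  da : ∀ τ ≤ T, HasDerivAt a ((qv v (O τ) (s τ) (x τ) - 4 * s τ) * a τ) τ
  db : ∀ τ ≤ T, HasDerivAt b ((qv v (O τ) (s τ) (x τ) + 2 * s τ + 2 * √3 * x τ) * b τ) τ
  dc : ∀ τ ≤ T, HasDerivAt c ((qv v (O τ) (s τ) (x τ) + 2 * s τ - 2 * √3 * x τ) * c τ) τ
  O0 : ∀ τ ≤ T, 0 ≤ O τ
  a0 : ∀ τ ≤ T, 0 < a τ
  b0 : ∀ τ ≤ T, 0 < b τ
  c0 : ∀ τ ≤ T, 0 < c τ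
  con : ∀ τ ≤ T, O τ + (s τ)^2 + (x τ)^2
    + 3/4 * ((a τ)^2 + (b τ)^2 + (c τ)^2 - 2 * (a τ * b τ + b τ * c τ + c τ * a τ)) = 1

lemma r3 : (√3 : ℝ)^2 = 3 := by norm_num


lemma BS.mono (h : BS v T O s x a b c) {T' : ℝ} (hT : T' ≤ T) : BS v T' O s x a b c where
  v0 := h.v0
  v1 := h.v1
  dO := fun τ hτ => h.dO τ (hτ.trans hT)
  ds := fun τ hτ => h.ds τ (hτ.trans hT)
  dx := fun τ hτ => h.dx τ (hτ.trans hT)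
  da := fun τ hτ => h.da τ (hτ.trans hT)
  db := fun τ hτ => h.db τ (hτ.trans hT)
  dc := fun τ hτ => h.dc τ (hτ.trans hT)
  O0 := fun τ hτ => h.O0 τ (hτ.trans hT)
  a0 := fun τ hτ => h.a0 τ (hτ.trans hT)
  b0 := fun τ hτ => h.b0 τ (hτ.trans hT)
  c0 := fun τ hτ => h.c0 τ (hτ.trans hT)
  con := fun τ hτ => h.con τ (hτ.trans hT)

lemma qv_rot (v O s x : ℝ) : qv v O (-s/2 - √3/2*x) (√3/2*s - x/2) = qv v O s x := by
  unfold qv; linear_combination (1/2) * (s^2 + x^2) * r3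

lemma BS.rot (h : BS v T O s x a b c) :
    BS v T O (fun τ => -s τ/2 - √3/2 * x τ) (fun τ => √3/2 * s τ - x τ/2) b c a where
  v0 := h.v0
  v1 := h.v1
  dO := fun τ hτ => by rw [qv_rot]; exact h.dO τ hτ
  ds := fun τ hτ => by
    rw [qv_rot]
    refine (((h.ds τ hτ).neg.div_const 2).sub ((h.dx τ hτ).const_mul (√3/2))).congr_deriv ?_
    linear_combination (3/4) * (c τ - b τ) * (a τ - b τ - c τ) * r3
  dx := fun τ hτ => by
    rw [qv_rot]
    refine (((h.ds τ hτ).const_mul (√3/2)).sub ((h.dx τ hτ).div_const 2)).congr_deriv ?_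
    ring
  da := fun τ hτ => by
    rw [qv_rot]
    refine (h.db τ hτ).congr_deriv ?_
    ring
  db := fun τ hτ => by
    rw [qv_rot]
    refine (h.dc τ hτ).congr_deriv ?_
    linear_combination (-s τ) * c τ * r3
  dc := fun τ hτ => by
    rw [qv_rot]
    refine (h.da τ hτ).congr_deriv ?_
    linear_combination (s τ) * a τ * r3
  O0 := h.O0
  a0 := h.b0
  b0 := h.c0
  c0 := h.a0
  con := fun τ hτ => by
    linear_combination h.con τ hτ + (1/4) * ((s τ)^2 + (x τ)^2) * r3

lemma BS.rot2 (h : BS v T O s x a b c) :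
    BS v T O (fun τ => -s τ/2 + √3/2 * x τ) (fun τ => -(√3/2) * s τ - x τ/2) c a b := by
  have := h.rot.rot
  convert this using 1
  · funext τ; linear_combination (1/4) * s τ * r3
  · funext τ; linear_combination (1/4) * x τ * r3

/-! ### Step 1: the product `abc` tends to zero -/

lemma ord_wlog {p : ℝ → ℝ → ℝ → Prop} (hr : ∀ a b c, p a b c → p b c a)
    (hs : ∀ a b c, p a b c → p b a c)
    (h : ∀ a b c, a ≥ b → b ≥ c → p a b c) : ∀ a b c, p a b c := by
  intro a b c
  rcases le_total a b with h1 | h1 <;> rcases le_total b c with h2 | h2 <;>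
    rcases le_total a c with h3 | h3
  · exact hr _ _ _ (hs _ _ _ (hr _ _ _ (hr _ _ _ (h c b a h2 h1))))|> fun t => by
      first | exact t | exact hr _ _ _ t | exact hr _ _ _ (hr _ _ _ t)
  all_goals first
    | exact h _ _ _ (by assumption) (by assumption)
    | exact hr _ _ _ (h _ _ _ (by assumption) (by assumption))
    | exact hr _ _ _ (hr _ _ _ (h _ _ _ (by assumption) (by assumption)))
    | exact hs _ _ _ (h _ _ _ (by assumption) (by assumption))
    | exact hr _ _ _ (hs _ _ _ (h _ _ _ (by assumption) (by assumption)))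
    | exact hr _ _ _ (hr _ _ _ (hs _ _ _ (h _ _ _ (by assumption) (by assumption))))
    | (have e1 : a = b := by linarith
       have e2 : b = c := by linarith
       subst e1; subst e2; exact h _ _ _ le_rfl le_rfl)

lemma ord_t {a b c : ℝ} (hab : a ≥ b) (hbc : b ≥ c) (hc : 0 < c)
    (hk : 3/4 * (a^2 + b^2 + c^2 - 2 * (a*b + b*c + c*a)) ≤ 1) :
    (a*c)^3 ≤ 10 * (a*b*c)^2 ∨ (a*c)^2 ≤ 2 * (a*b*c) := by
  have hb : 0 < b := by linarith
  have ha : 0 < a := by linarith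
  rcases le_total a (10*b) with h | h
  · left
    have h1 : a * c ≤ 10 * b^2 := by nlinarith
    have : (a*c)^2 * (a*c) ≤ (a*c)^2 * (10*b^2) := mul_le_mul_of_nonneg_left h1 (sq_nonneg _)
    nlinarith
  · right
    have h1 : a * c ≤ a^2/10 := by nlinarith
    have h2 : c * b ≤ a^2/100 := by nlinarith
    have h3 : a * b ≤ a^2/10 := by nlinarith
    have h4 : a ≤ 2 := by nlinarith
    have : a * c^2 ≤ a*b*c := by nlinarith [mul_pos ha hc]
    nlinarith [mul_pos ha hc]

lemma ord_k {a b c : ℝ} (hab : a ≥ b) (hbc : b ≥ c) (hc : 0 < c) :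
    -(3 * (a*c)) ≤ 3/4 * (a^2 + b^2 + c^2 - 2 * (a*b + b*c + c*a)) := by
  nlinarith [sq_nonneg (a-b), mul_le_mul_of_nonneg_right hab hc.le, sq_nonneg c]

lemma t_small {a b c ε : ℝ} (hab : a ≥ b) (hbc : b ≥ c) (hc : 0 < c)
    (hk : 3/4 * (a^2 + b^2 + c^2 - 2 * (a*b + b*c + c*a)) ≤ 1) (hε : 0 < ε) (hε1 : ε ≤ 1)
    (hP : a*b*c ≤ ε^2/4) : a * c ≤ ε := by
  have hb : 0 < b := by linarith
  have ha : 0 < a := by linarith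
  by_contra hcon
  push Not at hcon
  rcases ord_t hab hbc hc hk with h | h
  · have h1 : ε^3 < (a*c)^3 := by gcongr
    have hPp : 0 < a*b*c := by positivity
    have h2 : (a*b*c)^2 ≤ (ε^2/4)^2 := by gcongr
    have : ε^4 ≤ ε^3 := by nlinarith [pow_pos hε 3]
    nlinarith
  · nlinarith [pow_pos hε 2]

lemma k_bdd {P0 : ℝ} : ∀ a b c : ℝ, 0 < a → 0 < b → 0 < c →
    3/4 * (a^2 + b^2 + c^2 - 2 * (a*b + b*c + c*a)) ≤ 1 → a*b*c ≤ P0 →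
    -(3 * (1 + 10 * P0^2 + 2 * P0)) ≤ 3/4 * (a^2 + b^2 + c^2 - 2 * (a*b + b*c + c*a)) := by
  apply ord_wlog
  · intro a b c h ha hb hc hk hP
    have := h hc ha hb (by linarith) (by linarith)
    linarith
  · intro a b c h ha hb hc hk hP
    have := h hb ha hc (by linarith) (by linarith)
    linarith
  · intro a b c hab hbc ha hb hc hk hP
    have h1 := ord_k hab hbc hc
    have hPp : 0 < a*b*c := by positivity
    have ht : 0 < a * c := by positivity
    have : a * c ≤ 1 + 10 * P0^2 + 2 * P0 := by
      by_contra hcon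
      push Not at hcon
      rcases ord_t hab hbc hc hk with h | h
      · have h2 : (a*b*c)^2 ≤ P0^2 := by gcongr
        have h3 : 1 < a * c := by nlinarith [sq_nonneg P0]
        have h4 : (a*c) ≤ (a*c)^3 := by
          have : 1 ≤ (a*c)^2 := by nlinarith
          nlinarith
        nlinarith
      · nlinarith [sq_nonneg P0]
    linarith

/-- consequences of smallness of `abc` -/
lemma small_pack {ε : ℝ} (hε : 0 < ε) (hε1 : ε ≤ 1) : ∀ a b c : ℝ, 0 < a → 0 < b → 0 < c →
    3/4 * (a^2 + b^2 + c^2 - 2 * (a*b + b*c + c*a)) ≤ 1 → a*b*c ≤ ε^4/4 →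
    -(3 * ε) ≤ 3/4 * (a^2 + b^2 + c^2 - 2 * (a*b + b*c + c*a)) ∧
    a*b*c*(a+b+c) ≤ 3 * ε * (a*b + b*c + c*a) ∧ a*b*c ≤ ε * (a*b + b*c + c*a) := by
  apply ord_wlog
  · intro a b c h ha hb hc hk hP
    have := h hc ha hb (by linarith) (by linarith)
    refine ⟨?_, ?_, ?_⟩ <;> linarith
  · intro a b c h ha hb hc hk hP
    have := h hb ha hc (by linarith) (by linarith)
    refine ⟨?_, ?_, ?_⟩ <;> linarith
  · intro a b c hab hbc ha hb hc hk hP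
    have h1 := ord_k hab hbc hc
    have ht : 0 < a * c := by positivity
    have h2 : a * c ≤ ε^2 := t_small hab hbc hc hk (by positivity) (by nlinarith) (by nlinarith)
    have h3 : ε^2 ≤ ε := by nlinarith
    have hce : c ≤ ε := by
      by_contra hcon
      push Not at hcon
      nlinarith
    refine ⟨by linarith, ?_, ?_⟩
    · have e1 : a*b*c*(a+b+c) ≤ 3 * (a*c) * (a*b) := by
        have : 0 < a*b*c := by positivity
        nlinarith
      have e2 : 3 * (a*c) * (a*b) ≤ 3 * ε * (a*b) := by
        have : 0 < a*b := by positivity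
        nlinarith
      have : 0 < b*c + c*a := by positivity
      nlinarith
    · have : 0 < a*b := by positivity
      have : 0 < b*c + c*a := by positivity
      nlinarith

lemma BS.dP (h : BS v T O s x a b c) (τ : ℝ) (hτ : τ ≤ T) :
    HasDerivAt (fun τ => a τ * b τ * c τ) (3 * qv v (O τ) (s τ) (x τ) * (a τ * b τ * c τ)) τ := by
  refine (((h.da τ hτ).mul (h.db τ hτ)).mul (h.dc τ hτ)).congr_deriv ?_
  simp only [Pi.mul_apply]; ring

lemma qv_nonneg {v O s x : ℝ} (hv : 0 < v) (hO : 0 ≤ O) : 0 ≤ qv v O s x := by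
  unfold qv; positivity

lemma BS.q0 (h : BS v T O s x a b c) (τ : ℝ) (hτ : τ ≤ T) : 0 ≤ qv v (O τ) (s τ) (x τ) :=
  qv_nonneg h.v0 (h.O0 τ hτ)

lemma BS.P0 (h : BS v T O s x a b c) (τ : ℝ) (hτ : τ ≤ T) : 0 < a τ * b τ * c τ :=
  mul_pos (mul_pos (h.a0 τ hτ) (h.b0 τ hτ)) (h.c0 τ hτ)

lemma BS.Pmono (h : BS v T O s x a b c) : MonotoneOn (fun τ => a τ * b τ * c τ) (Iic T) :=
  mono_Iic (fun τ hτ => h.dP τ hτ) (fun τ hτ => by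
    have := h.q0 τ hτ; have := h.P0 τ hτ; positivity)

lemma BS.k_le (h : BS v T O s x a b c) (τ : ℝ) (hτ : τ ≤ T) :
    3/4 * ((a τ)^2 + (b τ)^2 + (c τ)^2 - 2 * (a τ * b τ + b τ * c τ + c τ * a τ)) ≤ 1 := by
  have := h.con τ hτ
  have := h.O0 τ hτ
  nlinarith [sq_nonneg (s τ), sq_nonneg (x τ)]

/-- a bound for `Ω + Σ²` -/
lemma BS.bdd (h : BS v T O s x a b c) : ∃ B, 1 ≤ B ∧ ∀ τ ≤ T, O τ + (s τ)^2 + (x τ)^2 ≤ B := by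
  set P0 := a T * b T * c T with hP0
  have hP : 0 < P0 := h.P0 T le_rfl
  refine ⟨1 + 3 * (1 + 10 * P0^2 + 2 * P0), by nlinarith, fun τ hτ => ?_⟩
  have h1 := k_bdd (P0 := P0) _ _ _ (h.a0 τ hτ) (h.b0 τ hτ) (h.c0 τ hτ) (h.k_le τ hτ)
    (h.Pmono hτ (mem_Iic.2 le_rfl) hτ)
  have := h.con τ hτ
  linarith

lemma Q_ineq {q s1 s2 s3 a b c w k : ℝ} (ha : 0 < a) (hb : 0 < b) (hc : 0 < c)
    (h1 : s1^2 ≤ w) (h2 : s2^2 ≤ w) (h3 : s3^2 ≤ w)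
    (hk : k = 3/4 * (a^2 + b^2 + c^2 - 2 * (a*b + b*c + c*a))) :
    4 * k - (2 - q) * ((s1*a + s2*b + s3*c)/(a+b+c)) - 4 * w ≤
    ((((-(2 - q) * s1 - 3/2 * ((b - c)^2 - a * (2*a - b - c))) * a + s1 * ((q - 4 * s1) * a) +
      ((-(2 - q) * s2 - 3/2 * ((c - a)^2 - b * (2*b - c - a))) * b + s2 * ((q - 4 * s2) * b)) +
      ((-(2 - q) * s3 - 3/2 * ((a - b)^2 - c * (2*c - a - b))) * c + s3 * ((q - 4 * s3) * c)))
        * (a+b+c)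
      - (s1*a + s2*b + s3*c) * ((q - 4*s1)*a + (q - 4*s2)*b + (q - 4*s3)*c)) / (a+b+c)^2) := by
  have hd : 0 < a + b + c := by positivity
  rw [le_div_iff₀ (by positivity)]
  have e : (4 * k - (2 - q) * ((s1*a + s2*b + s3*c)/(a+b+c)) - 4 * w) * (a+b+c)^2 =
     4 * k * (a+b+c)^2 - (2 - q) * (s1*a + s2*b + s3*c) * (a+b+c) - 4 * w * (a+b+c)^2 := by
    field_simp
  rw [e, ← sub_nonneg]
  have e2 : (((-(2 - q) * s1 - 3/2 * ((b - c)^2 - a * (2*a - b - c))) * a + s1 * ((q - 4 * s1) * a) +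
      ((-(2 - q) * s2 - 3/2 * ((c - a)^2 - b * (2*b - c - a))) * b + s2 * ((q - 4 * s2) * b)) +
      ((-(2 - q) * s3 - 3/2 * ((a - b)^2 - c * (2*c - a - b))) * c + s3 * ((q - 4 * s3) * c)))
        * (a+b+c)
      - (s1*a + s2*b + s3*c) * ((q - 4*s1)*a + (q - 4*s2)*b + (q - 4*s3)*c)) -
      (4 * k * (a+b+c)^2 - (2 - q) * (s1*a + s2*b + s3*c) * (a+b+c) - 4 * w * (a+b+c)^2) =
      27 * (a*b*c) * (a+b+c) + 4 * (a+b+c) * ((w - s1^2)*a + (w - s2^2)*b + (w - s3^2)*c)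
      + 4 * (s1*a + s2*b + s3*c)^2 := by
    rw [hk]; ring
  rw [e2]
  have := mul_nonneg (sub_nonneg.2 h1) ha.le
  have := mul_nonneg (sub_nonneg.2 h2) hb.le
  have := mul_nonneg (sub_nonneg.2 h3) hc.le
  positivity

lemma s2_sq (s x : ℝ) : (-s/2 - √3/2*x)^2 ≤ s^2 + x^2 := by
  have : s^2 + x^2 - (-s/2 - √3/2*x)^2 = (√3/2*s - x/2)^2 := by
    linear_combination (-1/4) * (s^2 + x^2) * r3
  nlinarith [sq_nonneg (√3/2*s - x/2)]

lemma s3_sq (s x : ℝ) : (-s/2 + √3/2*x)^2 ≤ s^2 + x^2 := by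
  have : s^2 + x^2 - (-s/2 + √3/2*x)^2 = (√3/2*s + x/2)^2 := by
    linear_combination (-1/4) * (s^2 + x^2) * r3
  nlinarith [sq_nonneg (√3/2*s + x/2)]

lemma avg_sq {s1 s2 s3 a b c w : ℝ} (ha : 0 < a) (hb : 0 < b) (hc : 0 < c)
    (h1 : s1^2 ≤ w) (h2 : s2^2 ≤ w) (h3 : s3^2 ≤ w) :
    ((s1*a + s2*b + s3*c)/(a+b+c))^2 ≤ w := by
  rw [div_pow, div_le_iff₀ (by positivity)]
  have e : w * (a+b+c)^2 - (s1*a + s2*b + s3*c)^2 =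
    (a+b+c) * ((w - s1^2)*a + (w - s2^2)*b + (w - s3^2)*c)
    + (a*b*(s1-s2)^2 + b*c*(s2-s3)^2 + a*c*(s1-s3)^2) := by ring
  have := mul_nonneg (sub_nonneg.2 h1) ha.le
  have := mul_nonneg (sub_nonneg.2 h2) hb.le
  have := mul_nonneg (sub_nonneg.2 h3) hc.le
  have : 0 ≤ w * (a+b+c)^2 - (s1*a + s2*b + s3*c)^2 := by rw [e]; positivity
  linarith

theorem BS.P_tendsto (h : BS v T O s x a b c) :
    Tendsto (fun τ => a τ * b τ * c τ) atBot (𝓝 0) := by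
  obtain ⟨B, hB1, hB⟩ := h.bdd
  have hv := h.v0
  set C : ℝ := 1/v + 9/2 + B with hC
  have hCp : 0 < C := by positivity
  set Q : ℝ → ℝ := fun τ => (s τ * a τ + (-s τ/2 - √3/2 * x τ) * b τ + (-s τ/2 + √3/2 * x τ) * c τ)
    / (a τ + b τ + c τ) with hQ
  have hQ2 : ∀ τ ≤ T, (Q τ)^2 ≤ (s τ)^2 + (x τ)^2 := fun τ hτ =>
    avg_sq (h.a0 τ hτ) (h.b0 τ hτ) (h.c0 τ hτ) (by nlinarith [sq_nonneg (x τ)])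
      (s2_sq _ _) (s3_sq _ _)
  have hQB : ∀ τ ≤ T, |Q τ| ≤ B := fun τ hτ => by
    apply abs_le_of_sq_le_sq _ (by linarith)
    have := hQ2 τ hτ
    have := hB τ hτ
    have := h.O0 τ hτ
    nlinarith
  have hdQ : ∀ τ ≤ T, ∃ d, HasDerivAt Q d τ ∧ 3 - C * qv v (O τ) (s τ) (x τ) ≤ d := by
    intro τ hτ
    have h2 := h.rot
    have h3 := h.rot2
    have ha := h.a0 τ hτ
    have hb := h.b0 τ hτ
    have hc := h.c0 τ hτ
    have hs1 := h.ds τ hτ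
    have hs2 := h.rot.ds τ hτ
    have hs3 := h.rot2.ds τ hτ
    have ha1 := h.da τ hτ
    have ha2 := h.rot.da τ hτ
    have ha3 := h.rot2.da τ hτ
    have e3 : qv v (O τ) (-s τ/2 + √3/2 * x τ) (-(√3/2) * s τ - x τ/2) = qv v (O τ) (s τ) (x τ) := by
      unfold qv; linear_combination (1/2) * ((s τ)^2 + (x τ)^2) * r3
    rw [e3] at hs3 ha3
    rw [qv_rot] at hs2 ha2
    refine ⟨_, (((hs1.mul ha1).add (hs2.mul ha2)).add (hs3.mul ha3)).div
      ((ha1.add ha2).add ha3) (show a τ + b τ + c τ ≠ 0 by positivity), ?_⟩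
    have key := Q_ineq (q := qv v (O τ) (s τ) (x τ)) (s1 := s τ) (s2 := -s τ/2 - √3/2 * x τ)
      (s3 := -s τ/2 + √3/2 * x τ) (w := (s τ)^2 + (x τ)^2) ha hb hc
      (by nlinarith [sq_nonneg (x τ)]) (s2_sq _ _) (s3_sq _ _) rfl
    refine le_trans ?_ key
    have hk := h.con τ hτ
    have hq2 := hQ2 τ hτ
    have hqb := hQB τ hτ
    have hq0 := h.q0 τ hτ
    have hO := h.O0 τ hτ
    change _ ≤ _ - _ * Q τ - _
    set q := qv v (O τ) (s τ) (x τ) with hq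
    have hO4 : 4 * O τ ≤ 1/v * q := by
      rw [hq]; unfold qv
      rw [one_div, ← div_eq_inv_mul, le_div_iff₀ hv]
      nlinarith [sq_nonneg (s τ), sq_nonneg (x τ)]
    have hw : (s τ)^2 + (x τ)^2 ≤ q/2 := by
      rw [hq]; unfold qv
      have := mul_nonneg hv.le hO
      linarith
    rw [abs_le] at hqb
    have e1 : q * Q τ ≥ - (q * B) := by nlinarith
    rw [hC]
    nlinarith [sq_nonneg (Q τ - 1)]
  choose! d hd hd2 using hdQ
  have hmono : MonotoneOn (fun τ => Q τ + C/3 * Real.log (a τ * b τ * c τ) - 3 * τ) (Iic T) := by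
    refine mono_Iic (f' := fun τ => d τ + C/3 * ((3 * qv v (O τ) (s τ) (x τ) * (a τ * b τ * c τ)) /
      (a τ * b τ * c τ)) - 3 * 1) (fun τ hτ => ?_) (fun τ hτ => ?_)
    · exact ((hd τ hτ).add (((h.dP τ hτ).log (h.P0 τ hτ).ne').const_mul _)).sub
        ((hasDerivAt_id τ).const_mul 3)
    · have := hd2 τ hτ
      have hp := h.P0 τ hτ
      rw [mul_div_assoc, div_self hp.ne']
      linarith
  set f0 := Q T + C/3 * Real.log (a T * b T * c T) - 3 * T with hf0
  have hlog : ∀ τ ≤ T, a τ * b τ * c τ ≤ Real.exp (3/C * (f0 + B) + 9/C * τ) := by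
    intro τ hτ
    rw [← Real.log_le_iff_le_exp (h.P0 τ hτ)]
    have h1 := hmono hτ (mem_Iic.2 le_rfl) hτ
    simp only at h1
    have h2 := (abs_le.1 (hQB τ hτ)).1
    have : C/3 * Real.log (a τ * b τ * c τ) ≤ f0 + B + 3 * τ := by linarith
    have e : 3/C * (f0 + B) + 9/C * τ = 3/C * (f0 + B + 3 * τ) := by ring
    rw [e]
    calc Real.log (a τ * b τ * c τ) = 3/C * (C/3 * Real.log (a τ * b τ * c τ)) := by field_simp
      _ ≤ _ := by gcongr
  have hlim : Tendsto (fun τ => Real.exp (3/C * (f0 + B) + 9/C * τ)) atBot (𝓝 0) := by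
    apply Real.tendsto_exp_atBot.comp
    apply tendsto_atBot_add_const_left
    exact tendsto_id.const_mul_atBot (by positivity)
  refine tendsto_of_tendsto_of_tendsto_of_le_of_le' tendsto_const_nhds hlim ?_ ?_
  · filter_upwards [eventually_le_atBot T] with τ hτ
    exact (h.P0 τ hτ).le
  · filter_upwards [eventually_le_atBot T] with τ hτ
    exact hlog τ hτ

/-- the `ε`-package, valid on a half line -/
structure Pk (ε O s x a b c : ℝ) : Prop where
  kl : -(3 * ε) ≤ 3/4 * (a^2 + b^2 + c^2 - 2 * (a*b + b*c + c*a))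
  PS : a*b*c*(a+b+c) ≤ 3 * ε * (a*b + b*c + c*a)
  PV : a*b*c ≤ ε * (a*b + b*c + c*a)
  P4 : a*b*c ≤ ε^4/4
  sb : O + s^2 + x^2 ≤ 1 + 3 * ε

theorem BS.pack (h : BS v T O s x a b c) {ε : ℝ} (hε : 0 < ε) (hε1 : ε ≤ 1) :
    ∃ T' ≤ T, ∀ τ ≤ T', Pk ε (O τ) (s τ) (x τ) (a τ) (b τ) (c τ) := by
  have h1 := h.P_tendsto.eventually (ge_mem_nhds (show (0:ℝ) < ε^4/4 by positivity))
  obtain ⟨T', hT'⟩ := ev_Iic h1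
  refine ⟨min T T', min_le_left _ _, fun τ hτ => ?_⟩
  have hτ1 := hτ.trans (min_le_left _ _)
  have hP := hT' τ (hτ.trans (min_le_right _ _))
  obtain ⟨k1, k2, k3⟩ := small_pack hε hε1 _ _ _ (h.a0 τ hτ1) (h.b0 τ hτ1) (h.c0 τ hτ1)
    (h.k_le τ hτ1) hP
  refine ⟨k1, k2, k3, hP, ?_⟩
  have := h.con τ hτ1
  linarith

/-! ### Step 2 : scalar estimates -/

lemma rho_sq {b c : ℝ} (hb : 0 < b) (hc : 0 < c) : ((b - c)/(b + c))^2 ≤ 1 := by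
  rw [div_pow, div_le_one (by positivity)]
  nlinarith [mul_pos hb hc]

lemma BS.drho (h : BS v T O s x a b c) (τ : ℝ) (hτ : τ ≤ T) :
    HasDerivAt (fun τ => (b τ - c τ)/(b τ + c τ))
      (2 * √3 * x τ * (1 - ((b τ - c τ)/(b τ + c τ))^2)) τ := by
  have hb := h.b0 τ hτ
  have hc := h.c0 τ hτ
  have hS : b τ + c τ ≠ 0 := by positivity
  refine (((h.db τ hτ).sub (h.dc τ hτ)).div ((h.db τ hτ).add (h.dc τ hτ)) hS).congr_deriv ?_
  simp only [Pi.add_apply, Pi.sub_apply]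
  field_simp
  ring

lemma BS.dz (h : BS v T O s x a b c) (τ : ℝ) (hτ : τ ≤ T) :
    HasDerivAt (fun τ => (b τ - c τ)/(b τ + c τ) * x τ)
      (2 * √3 * (x τ)^2 * (1 - ((b τ - c τ)/(b τ + c τ))^2)
        - (2 - qv v (O τ) (s τ) (x τ)) * ((b τ - c τ)/(b τ + c τ) * x τ)
        - 3 * √3 / 2 * (b τ - c τ)^2
        + 3 * √3 / 2 * ((b τ - c τ)/(b τ + c τ))^2 * (b τ + c τ) * a τ) τ := by
  have hb := h.b0 τ hτ
  have hc := h.c0 τ hτ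
  have hS : b τ + c τ ≠ 0 := by positivity
  refine ((h.drho τ hτ).mul (h.dx τ hτ)).congr_deriv ?_
  field_simp
  ring

lemma sqrt3_bd : 1.7 < √3 ∧ √3 < 1.8 := by
  constructor
  · rw [Real.lt_sqrt (by norm_num)]; norm_num
  · rw [Real.sqrt_lt' (by norm_num)]; norm_num

lemma base_ineq {v O s x a S D2 : ℝ} (hv0 : 0 < v) (hv1 : v < 1/2)
    (hU0 : (1 - 2*v)/2 ≤ 1 + 2*v*s) (hU1 : 1 + 2*v*s ≤ 3) (ha : 0 < a) (hS : 0 < S)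
    (hcon : O + s^2 + x^2 + 3/4 * (D2 + a^2 - 2*a*S) = 1) :
    (4 - 8*v)/3 * ((s + 2*v)^2 + x^2) - 36/(1 - 2*v) * a^2 ≤
    2 * (qv v O s x + 2*s) + 1/(2*v) * (2 * qv v O s x - 8*v)
      - (1 + 2*v)/v * (2*v*(-(2 - qv v O s x) * s - 3/2 * (D2 - a*(2*a - S))) / (1 + 2*v*s)) := by
  have hp : 0 < 1 - 2*v := by linarith
  set U := 1 + 2*v*s with hU
  have hUp : 0 < U := by linarith
  have e : 2 * (qv v O s x + 2*s) + 1/(2*v) * (2 * qv v O s x - 8*v)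
      - (1 + 2*v)/v * (2*v*(-(2 - qv v O s x) * s - 3/2 * (D2 - a*(2*a - S))) / U)
      = (4 * (s + 2*v)^2 + (1 + 2*v) * ((4 - 8*v) * x^2 + 18*v*a*(S - a))) / (2*v*U) := by
    rw [eq_div_iff (by positivity)]
    have : (2 * (qv v O s x + 2*s) + 1/(2*v) * (2 * qv v O s x - 8*v)
      - (1 + 2*v)/v * (2*v*(-(2 - qv v O s x) * s - 3/2 * (D2 - a*(2*a - S))) / U)) * (2*v*U)
      = 2*v*U*(2 * (qv v O s x + 2*s)) + U * (2 * qv v O s x - 8*v)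
      - 4*v*(1 + 2*v) * (-(2 - qv v O s x) * s - 3/2 * (D2 - a*(2*a - S))) := by
      field_simp
      ring
    rw [this, hU]
    unfold qv
    linear_combination 8*v*(1 + 2*v) * hcon
  rw [e, le_div_iff₀ (by positivity)]
  -- bounds
  have h1 : 2*v*U ≤ 3 := by nlinarith
  have hA : 0 < (4 - 8*v)/3 := by linarith
  have h2 : (4 - 8*v)/3 * (s + 2*v)^2 * (2*v*U) ≤ 4 * (s + 2*v)^2 := by
    have : (4 - 8*v)/3 * (2*v*U) ≤ 4 := by nlinarith
    nlinarith [sq_nonneg (s + 2*v)]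
  have h3 : (4 - 8*v)/3 * x^2 * (2*v*U) ≤ (1 + 2*v) * ((4 - 8*v) * x^2) := by
    have : (4 - 8*v)/3 * (2*v*U) ≤ (1+2*v) * (4 - 8*v) := by nlinarith
    nlinarith [sq_nonneg x]
  have h4 : (1 + 2*v) * (18*v*a*(a - S)) ≤ 36/(1 - 2*v) * a^2 * (2*v*U) := by
    have h5 : 36/(1 - 2*v) * a^2 * (2*v*U) ≥ 36 * v * a^2 := by
      have : U/(1 - 2*v) ≥ 1/2 := by
        rw [ge_iff_le, le_div_iff₀ hp]; linarith
      have e : 36/(1 - 2*v) * a^2 * (2*v*U) = 72 * v * a^2 * (U/(1-2*v)) := by ring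
      rw [e]
      have : 0 < 72 * v * a^2 := by positivity
      nlinarith
    have h6 : 18*v*a*(a - S) ≤ 18 * v * a^2 := by
      have : 0 < v * a * S := by positivity
      nlinarith
    have t0 : 0 < v * a^2 := by positivity
    have t1 := mul_nonneg (by linarith : 0 ≤ 1 + 2*v) (sub_nonneg.2 h6)
    have t2 := mul_nonneg (by linarith : 0 ≤ 1 - 2*v) t0.le
    linarith
  linarith

lemma q_abs {v O s x ε : ℝ} (hv0 : 0 < v) (hv1 : v < 1/2) (hO : 0 ≤ O) (hε1 : ε ≤ 1/6)
    (hb : O + s^2 + x^2 ≤ 1 + 3*ε) : |2 - qv v O s x| ≤ 2 := by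
  unfold qv; rw [abs_le]
  have := mul_nonneg hv0.le hO
  constructor
  · nlinarith
  · nlinarith [sq_nonneg s, sq_nonneg x]

lemma zp_ineq {v O s x a S D2 ρ ε r : ℝ} (hv0 : 0 < v) (hv1 : v < 1/2) (hr1 : 1.7 < r) (hr2 : r < 1.8)
    (ha : 0 < a) (hS : 0 < S) (hO : 0 ≤ O) (hρ : ρ^2 ≤ 1) (hε1 : ε ≤ 1/6)
    (hb : O + s^2 + x^2 ≤ 1 + 3*ε)
    (hcon : O + s^2 + x^2 + 3/4 * (D2 + a^2 - 2*a*S) = 1) :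
    2*r*(1 - O - s^2 - x^2) - 4*x^2 - 2*|x| - 5*(a*(a + S)) ≤
    -(2 * r * x^2 * (1 - ρ^2) - (2 - qv v O s x) * (ρ * x) - 3 * r / 2 * D2
        + 3 * r / 2 * ρ^2 * S * a) := by
  have hq := q_abs hv0 hv1 hO hε1 hb
  have h1 : |(2 - qv v O s x) * (ρ * x)| ≤ 2 * |x| := by
    rw [abs_mul, abs_mul]
    have : |ρ| ≤ 1 := by rw [← sq_le_one_iff_abs_le_one]; exact hρ
    calc |2 - qv v O s x| * (|ρ| * |x|) ≤ 2 * (1 * |x|) := by gcongr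
      _ = 2 * |x| := by ring
  have h1' := (abs_le.1 h1).1
  have haS : 0 < a * S := by positivity
  have h2 : r * ρ^2 * (S * a) ≤ 1.8 * (S * a) := by
    have : r * ρ^2 ≤ 1.8 := by nlinarith [sq_nonneg ρ]
    nlinarith
  have h3 : r * x^2 * (1 - ρ^2) ≤ 1.8 * x^2 := by
    have : r * (1 - ρ^2) ≤ 1.8 := by nlinarith [sq_nonneg ρ]
    nlinarith [sq_nonneg x]
  have h4 : 3 * r / 2 * D2 = 2 * r * (1 - O - s^2 - x^2) - 3*r/2*a^2 + 3*r*(a*S) := by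
    linear_combination 2 * r * hcon
  have h5 : r * a^2 ≤ 1.8 * a^2 := by nlinarith [sq_nonneg a]
  have h6 : 0 ≤ r * (a*S) := by positivity
  linarith [sq_nonneg x, sq_nonneg a]

set_option maxHeartbeats 1000000 in
lemma rate2 {v O s x a S D2 ρ ε r η A m : ℝ} (hv0 : 0 < v) (hv1 : v < 1/2) (hr1 : 1.7 < r) (hr2 : r < 1.8)
    (ha : 0 < a) (hS : 0 < S) (hO : 0 ≤ O) (hρ : ρ^2 ≤ 1) (hε0 : 0 < ε) (hε1 : ε ≤ 1/6)
    (hε2 : ε ≤ (1 - 2*v)/4)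
    (hb : O + s^2 + x^2 ≤ 1 + 3*ε)
    (hcon : O + s^2 + x^2 + 3/4 * (D2 + a^2 - 2*a*S) = 1)
    (hA : A = (4 - 8*v)/3) (hm : m = 4*v*(1 - 2*v)) (hη0 : 0 < η) (hη1 : η ≤ A/20)
    (hη2 : η ≤ A * (m * (1 - 4*v^2)) / 48) (hε3 : 60 * ε ≤ m * (1 - 4*v^2)) :
    η * m * (1 - 4*v^2)/2 - (36/(1 - 2*v) + 10) * (a*(a + S)) ≤
    2 * (qv v O s x + 2*s) + 1/(2*v) * (2 * qv v O s x - 8*v)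
      - (1 + 2*v)/v * (2*v*(-(2 - qv v O s x) * s - 3/2 * (D2 - a*(2*a - S))) / (1 + 2*v*s))
      - η * (2 * r * x^2 * (1 - ρ^2) - (2 - qv v O s x) * (ρ * x) - 3 * r / 2 * D2
        + 3 * r / 2 * ρ^2 * S * a)
      + η * (-(2 - qv v O s x) * s - 3/2 * (D2 - a*(2*a - S))) := by
  have hp : 0 < 1 - 2*v := by linarith
  have hs2 : s^2 ≤ (1 + 2*ε)^2 := by linarith [sq_nonneg x, sq_nonneg ε]
  have hsa := abs_le.1 (abs_le_of_sq_le_sq hs2 (by linarith))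
  have hU0 : (1 - 2*v)/2 ≤ 1 + 2*v*s := by
    have t1 := mul_nonneg hv0.le (by linarith [hsa.1] : 0 ≤ s + (1 + 2*ε))
    have t2 := mul_nonneg hp.le hε0.le
    linarith
  have hU1 : 1 + 2*v*s ≤ 3 := by
    have t1 := mul_nonneg hv0.le (by linarith [hsa.2] : 0 ≤ (1 + 2*ε) - s)
    have t2 := mul_nonneg hp.le hε0.le
    linarith
  have H1 := base_ineq hv0 hv1 hU0 hU1 ha hS hcon
  have H2 := zp_ineq hv0 hv1 hr1 hr2 ha hS hO hρ hε1 hb hcon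
  set k := 1 - O - s^2 - x^2 with hk
  have hkl : -(3*ε) ≤ k := by linarith
  set e := s + 2*v with he
  have hApos : 0 < A := by rw [hA]; linarith
  have hmpos : 0 < m := by rw [hm]; positivity
  have hm1 : m ≤ 1/2 := by rw [hm]; nlinarith [sq_nonneg (4*v - 1)]
  have hA2 : A ≤ 4/3 := by rw [hA]; linarith
  have hη3 : η ≤ 1/10 := by linarith
  have haS : 0 < a * S := by positivity
  -- s' bound
  have h2q : 2 - qv v O s x = 2*k + (2 - 4*v)*O := by unfold qv; rw [hk]; ring
  have h2qa := q_abs hv0 hv1 hO hε1 hb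
  have hsp : -(2 - qv v O s x) * s - 3/2 * (D2 - a*(2*a - S)) =
      (2 - qv v O s x) * (2*v) - (2 - qv v O s x) * e - 2 * k + 9/2 * a^2 - 9/2 * (a*S) := by
    rw [he, hk]; linear_combination (-2) * hcon
  have hqe : (2 - qv v O s x) * e ≤ 2 * |e| := by
    calc (2 - qv v O s x) * e ≤ |(2 - qv v O s x) * e| := le_abs_self _
      _ = |2 - qv v O s x| * |e| := abs_mul _ _
      _ ≤ 2 * |e| := by gcongr
  have H3 : -(2 - qv v O s x) * s - 3/2 * (D2 - a*(2*a - S)) ≥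
      m * O - 2*(1 - 2*v)*k - 2 * |e| - 9/2 * (a*(a+S)) := by
    rw [hsp]
    have : (2 - qv v O s x) * (2*v) - 2*k = m * O - 2*(1 - 2*v)*k := by
      rw [h2q, hm]; ring
    linarith [sq_nonneg a]
  -- combine
  have H2' := mul_le_mul_of_nonneg_left H2 hη0.le
  have H3' := mul_le_mul_of_nonneg_left H3.le hη0.le
  rw [← hA] at H1
  set aS := a * (a + S) with haSdef
  have haSp : 0 < aS := by positivity
  have ha2 : a^2 ≤ aS := by rw [haSdef]; linarith
  have h36 : 36/(1 - 2*v) * a^2 ≤ 36/(1 - 2*v) * aS := by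
    have : 0 < 36/(1 - 2*v) := by positivity
    gcongr
  -- k + O lower bound
  have hkO : k + O ≥ 1 - 4*v^2 - 2*|e| - (e^2 + x^2) := by
    have : k + O = 1 - 4*v^2 + 4*v*e - e^2 - x^2 := by rw [hk, he]; ring
    have h4 : 4*v*e ≥ -(2*|e|) := by
      have t1 := mul_nonneg hv0.le (by linarith [neg_abs_le e] : 0 ≤ e + |e|)
      have t2 := mul_nonneg (by linarith : 0 ≤ 1 - 2*v) (abs_nonneg e)
      linarith
    linarith
  have hcomb : 2*r*k + (m*O - 2*(1 - 2*v)*k) ≥ m * (k + O) - 12*ε := by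
    have hc : 0 ≤ 2*r - 2*(1-2*v) - m := by linarith
    have hc' : 2*r - 2*(1-2*v) - m ≤ 4 := by linarith
    have t1 := mul_nonneg hc (by linarith : 0 ≤ k + 3*ε)
    have t2 := mul_nonneg (by linarith : 0 ≤ 4 - (2*r - 2*(1-2*v) - m)) hε0.le
    linarith
  have hcomb' := mul_le_mul_of_nonneg_left hcomb.le hη0.le
  have hmkO := mul_le_mul_of_nonneg_left hkO.le (mul_pos hη0 hmpos).le
  -- quadratic absorptions
  have q1 : η * (2*|x|) ≤ A/4 * x^2 + 4*η^2/A := by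
    have : 0 ≤ (A/2*|x| - 2*η)^2 / A := by positivity
    have e : (A/2*|x| - 2*η)^2 / A = A/4 * x^2 - η*(2*|x|) + 4*η^2/A := by
      rw [← sq_abs x]; field_simp; ring
    linarith
  have q2 : η * (3*|e|) ≤ A/4 * e^2 + 9*η^2/A := by
    have : 0 ≤ (A/2*|e| - 3*η)^2 / A := by positivity
    have e : (A/2*|e| - 3*η)^2 / A = A/4 * e^2 - η*(3*|e|) + 9*η^2/A := by
      rw [← sq_abs e]; field_simp; ring
    linarith
  have q3 : 12*η^2/A ≤ η * m*(1 - 4*v^2)/4 := by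
    rw [div_le_iff₀ hApos]
    have t1 := mul_le_mul_of_nonneg_left hη2 hη0.le
    linarith
  have q3' : 13*η^2/A ≤ η * m*(1 - 4*v^2)*13/48 := by
    have : 13*η^2/A = 13/12 * (12*η^2/A) := by ring
    rw [this]; linarith
  have hM : 0 < m * (1 - 4*v^2) := by linarith
  have q4 : 12 * ε * η ≤ η * m*(1 - 4*v^2) * (1/5) := by
    have t1 := mul_le_mul_of_nonneg_left hε3 hη0.le
    linarith
  have q5 : η * 4 * x^2 + η * m * (e^2 + x^2) ≤ A * (1/4) * (e^2 + x^2) := by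
    have t0 : η * m ≤ η * (1/2) := mul_le_mul_of_nonneg_left hm1 hη0.le
    have t1 := mul_nonneg (by linarith : 0 ≤ A/4 - 4*η - η*m) (sq_nonneg x)
    have t2 := mul_nonneg (by linarith : 0 ≤ A/4 - η*m) (sq_nonneg e)
    linarith
  have q6 : η * m * (2 * |e|) ≤ η * |e| := by
    have t0 : η * m ≤ η * (1/2) := mul_le_mul_of_nonneg_left hm1 hη0.le
    have t1 := mul_nonneg (by linarith : 0 ≤ η*(1/2) - η*m) (abs_nonneg e)
    linarith
  have hfrac : 4*η^2/A + 9*η^2/A = 13*η^2/A := by ring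
  have haSη : η * (5*aS) + η*(9/2*aS) ≤ 10 * aS := by
    have t1 := mul_nonneg (by linarith : 0 ≤ 1 - η) haSp.le
    linarith
  have hM' : 0 < η * m*(1 - 4*v^2) := by have := mul_pos hη0 hM; linarith
  have hw : 0 ≤ A * (e^2 + x^2) := by positivity
  linarith

lemma Pk.rot {ε O s x a b c : ℝ} (h : Pk ε O s x a b c) :
    Pk ε O (-s/2 - √3/2 * x) (√3/2 * s - x/2) b c a := by
  obtain ⟨h1, h2, h3, h4, h5⟩ := h
  refine ⟨by linarith, by linarith, by linarith, by linarith, ?_⟩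
  have : (-s/2 - √3/2 * x)^2 + (√3/2 * s - x/2)^2 = s^2 + x^2 := by
    linear_combination (1/4) * (s^2 + x^2) * r3
  linarith

lemma Pk.rot2 {ε O s x a b c : ℝ} (h : Pk ε O s x a b c) :
    Pk ε O (-s/2 + √3/2 * x) (-(√3/2) * s - x/2) c a b := by
  obtain ⟨h1, h2, h3, h4, h5⟩ := h
  refine ⟨by linarith, by linarith, by linarith, by linarith, ?_⟩
  have : (-s/2 + √3/2 * x)^2 + (-(√3/2) * s - x/2)^2 = s^2 + x^2 := by
    linear_combination (1/4) * (s^2 + x^2) * r3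
  linarith

/-- parameters for step 2 -/
structure Prm (v ε η : ℝ) : Prop where
  e0 : 0 < ε
  e1 : ε ≤ 1/6
  e2 : ε ≤ (1 - 2*v)/4
  n0 : 0 < η
  n1 : η ≤ (4 - 8*v)/3/20
  n2 : η ≤ (4 - 8*v)/3 * (4*v*(1 - 2*v) * (1 - 4*v^2)) / 48
  e3 : 60 * ε ≤ 4*v*(1 - 2*v) * (1 - 4*v^2)

def WW (v η O s x b c : ℝ) : ℝ :=
  Real.exp (1/(2*v) * Real.log O - (1 + 2*v)/v * Real.log (1 + 2*v*s)
    - η * ((b - c)/(b + c) * x) + η * s) * (b*c)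

lemma U_low {v O s x ε : ℝ} (hv0 : 0 < v) (hv1 : v < 1/2) (hO : 0 ≤ O) (h0 : 0 < ε)
    (h1 : ε ≤ 1/6) (h2 : ε ≤ (1 - 2*v)/4) (hb : O + s^2 + x^2 ≤ 1 + 3*ε) :
    (1 - 2*v)/2 ≤ 1 + 2*v*s ∧ 1 + 2*v*s ≤ 3 ∧ |s| ≤ 2 ∧ |x| ≤ 2 := by
  have hs2 : s^2 ≤ (1 + 2*ε)^2 := by nlinarith [sq_nonneg x]
  have hx2 : x^2 ≤ (1 + 2*ε)^2 := by nlinarith [sq_nonneg s]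
  have hsa := abs_le_of_sq_le_sq hs2 (by linarith)
  have hxa := abs_le_of_sq_le_sq hx2 (by linarith)
  have hsa' := abs_le.1 hsa
  refine ⟨by nlinarith, by nlinarith, by linarith, by linarith⟩

lemma BS.dW (h : BS v T O s x a b c) {τ ε η : ℝ} (hτ : τ ≤ T) (hO : 0 < O τ)
    (pk : Pk ε (O τ) (s τ) (x τ) (a τ) (b τ) (c τ)) (pm : Prm v ε η) :
    ∃ L, HasDerivAt (fun τ => WW v η (O τ) (s τ) (x τ) (b τ) (c τ))
      (L * WW v η (O τ) (s τ) (x τ) (b τ) (c τ)) τ ∧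
      η * (4*v*(1 - 2*v)) * (1 - 4*v^2)/2 - (36/(1 - 2*v) + 10) * (a τ * (a τ + (b τ + c τ))) ≤ L := by
  have hv := h.v0
  have ha := h.a0 τ hτ
  have hb := h.b0 τ hτ
  have hc := h.c0 τ hτ
  obtain ⟨hU, -, -, -⟩ := U_low h.v0 h.v1 hO.le pm.e0 pm.e1 pm.e2 pk.sb
  have hU' : 1 + 2*v*s τ ≠ 0 := by have := h.v1; linarith
  have hcon := h.con τ hτ
  have key := rate2 (ρ := (b τ - c τ)/(b τ + c τ)) (D2 := (b τ - c τ)^2) (S := b τ + c τ) h.v0 h.v1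
    sqrt3_bd.1 sqrt3_bd.2 ha (by positivity) hO.le (rho_sq hb hc) pm.e0 pm.e1 pm.e2 pk.sb
    (by linear_combination hcon) rfl rfl pm.n0 pm.n1 pm.n2 pm.e3
  refine ⟨_, ?_, key⟩
  have d1 := ((h.dO τ hτ).log hO.ne').const_mul (1/(2*v))
  have d2 := ((((h.ds τ hτ).const_mul (2*v)).const_add 1).log hU').const_mul ((1+2*v)/v)
  have d3 := (h.dz τ hτ).const_mul η
  have d4 := (h.ds τ hτ).const_mul η
  refine (((((d1.sub d2).sub d3).add d4).exp).mul ((h.db τ hτ).mul (h.dc τ hτ))).congr_deriv ?_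
  simp only [WW, Pi.mul_apply, Pi.add_apply, Pi.sub_apply]
  rw [mul_div_assoc, div_self hO.ne']
  ring

lemma WW_bd {v O s x b c ε η : ℝ} (hv0 : 0 < v) (hv1 : v < 1/2) (hO : 0 ≤ O)
    (hb : 0 < b) (hc : 0 < c) (pm : Prm v ε η)
    (hbd : O + s^2 + x^2 ≤ 1 + 3*ε) {M : ℝ}
    (hM : M = (1 + 2*v)/v * (2 + |Real.log ((1 - 2*v)/2)|) + 4) :
    Real.exp (1/(2*v) * Real.log O) * Real.exp (-M) * (b*c) ≤ WW v η O s x b c ∧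
    WW v η O s x b c ≤ Real.exp (1/(2*v) * Real.log O) * Real.exp M * (b*c) := by
  obtain ⟨hU0, hU1, hs, hx⟩ := U_low hv0 hv1 hO pm.e0 pm.e1 pm.e2 hbd
  have hp : 0 < (1 - 2*v)/2 := by linarith
  have l1 : Real.log ((1 - 2*v)/2) ≤ Real.log (1 + 2*v*s) := Real.log_le_log hp hU0
  have l2 : Real.log (1 + 2*v*s) ≤ 2 := by
    have := Real.log_le_sub_one_of_pos (lt_of_lt_of_le hp hU0)
    linarith
  have l3 : |Real.log (1 + 2*v*s)| ≤ 2 + |Real.log ((1 - 2*v)/2)| := by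
    rw [abs_le]
    have := neg_abs_le (Real.log ((1 - 2*v)/2))
    have := abs_nonneg (Real.log ((1 - 2*v)/2))
    constructor <;> linarith
  have l4 : |(1 + 2*v)/v * Real.log (1 + 2*v*s)| ≤ (1 + 2*v)/v * (2 + |Real.log ((1 - 2*v)/2)|) := by
    rw [abs_mul, abs_of_pos (by positivity : 0 < (1 + 2*v)/v)]
    gcongr
  have n0 := pm.n0
  have hη : η ≤ 1 := by have := pm.n1; linarith
  have l5 : |η * ((b - c)/(b + c) * x)| ≤ 2 := by
    rw [abs_mul, abs_mul, abs_of_pos n0]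
    have hρ := rho_sq hb hc
    rw [sq_le_one_iff_abs_le_one] at hρ
    calc η * (|(b - c)/(b + c)| * |x|) ≤ 1 * (1 * 2) := by gcongr
      _ = 2 := by ring
  have l6 : |η * s| ≤ 2 := by
    rw [abs_mul, abs_of_pos n0]
    calc η * |s| ≤ 1 * 2 := by gcongr
      _ = 2 := by ring
  rw [abs_le] at l4 l5 l6
  unfold WW
  have hbc : 0 < b * c := by positivity
  rw [← Real.exp_add, ← Real.exp_add]
  constructor
  · apply mul_le_mul_of_nonneg_right _ hbc.le
    rw [Real.exp_le_exp, hM]; linarith [l4.2, l5.2, l6.1]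
  · apply mul_le_mul_of_nonneg_right _ hbc.le
    rw [Real.exp_le_exp, hM]; linarith [l4.1, l5.1, l6.2]

lemma sum_ineq {L1 L2 L3 W1 W2 W3 a b c cc C1 e M X ε : ℝ} (ha : 0 < a) (hb : 0 < b) (hc : 0 < c)
    (hX : 0 < X) (hM : 0 < M) (he : 0 < e) (hC1 : 0 < C1) (hε : 0 < ε)
    (heM : e * M = 1)
    (h1 : cc - C1 * (a*(a + (b + c))) ≤ L1)
    (h2 : cc - C1 * (b*(b + (c + a))) ≤ L2)
    (h3 : cc - C1 * (c*(c + (a + b))) ≤ L3)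
    (w1 : X * e * (b*c) ≤ W1) (w1' : W1 ≤ X * M * (b*c))
    (w2 : X * e * (c*a) ≤ W2) (w2' : W2 ≤ X * M * (c*a))
    (w3 : X * e * (a*b) ≤ W3) (w3' : W3 ≤ X * M * (a*b))
    (hPS : a*b*c*(a+b+c) ≤ 3*ε*(a*b+b*c+c*a)) (hsm : 9*C1*ε*M^2 ≤ cc/2) :
    cc/2 * (W1 + W2 + W3) ≤ L1*W1 + L2*W2 + L3*W3 := by
  have p1 : 0 < W1 := lt_of_lt_of_le (by positivity) w1
  have p2 : 0 < W2 := lt_of_lt_of_le (by positivity) w2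
  have p3 : 0 < W3 := lt_of_lt_of_le (by positivity) w3
  have k1 := mul_le_mul_of_nonneg_right h1 p1.le
  have k2 := mul_le_mul_of_nonneg_right h2 p2.le
  have k3 := mul_le_mul_of_nonneg_right h3 p3.le
  have m1 := mul_le_mul_of_nonneg_left w1' (by positivity : 0 ≤ C1 * (a*(a + (b + c))))
  have m2 := mul_le_mul_of_nonneg_left w2' (by positivity : 0 ≤ C1 * (b*(b + (c + a))))
  have m3 := mul_le_mul_of_nonneg_left w3' (by positivity : 0 ≤ C1 * (c*(c + (a + b))))
  have hV : X * (a*b+b*c+c*a) ≤ M * (W1 + W2 + W3) := by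
    have t := mul_le_mul_of_nonneg_left (add_le_add (add_le_add w1 w2) w3) hM.le
    have e1 : M * (X * e * (b*c) + X * e * (c*a) + X * e * (a*b)) = X * (a*b+b*c+c*a) := by
      linear_combination X * (a*b+b*c+c*a) * heM
    linarith
  have hE : C1 * X * M * 3 * (a*b*c*(a+b+c)) ≤ cc/2 * (W1 + W2 + W3) := by
    calc C1 * X * M * 3 * (a*b*c*(a+b+c)) ≤ C1 * X * M * 3 * (3*ε*(a*b+b*c+c*a)) := by gcongr
      _ = 9*C1*ε*M * (X * (a*b+b*c+c*a)) := by ring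
      _ ≤ 9*C1*ε*M * (M * (W1 + W2 + W3)) := by gcongr
      _ = 9*C1*ε*M^2 * (W1 + W2 + W3) := by ring
      _ ≤ _ := by gcongr
  linarith

/-- exponential decay from a differential inequality -/
lemma exp_decay {T cc : ℝ} {H H' : ℝ → ℝ} (hH : ∀ τ ≤ T, HasDerivAt H (H' τ) τ)
    (h : ∀ τ ≤ T, cc * H τ ≤ H' τ) : ∀ τ ≤ T, H τ ≤ H T * Real.exp (-cc*T) * Real.exp (cc * τ) := by
  intro τ hτ
  have hm : MonotoneOn (fun τ => H τ * Real.exp (-cc * τ)) (Iic T) := by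
    refine mono_Iic (f' := fun τ => H' τ * Real.exp (-cc*τ) + H τ * (Real.exp (-cc*τ) * (-cc*1)))
      (fun τ hτ => (hH τ hτ).mul (((hasDerivAt_id τ).const_mul (-cc)).exp)) (fun τ hτ => ?_)
    have := h τ hτ
    have e := Real.exp_pos (-cc*τ)
    nlinarith
  have h1 := hm hτ (mem_Iic.2 le_rfl) hτ
  simp only at h1
  have e : Real.exp (-cc*τ) * Real.exp (cc*τ) = 1 := by
    rw [← Real.exp_add]; simp
  have := mul_le_mul_of_nonneg_right h1 (Real.exp_pos (cc*τ)).le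
  rw [mul_assoc, e, mul_one] at this
  exact this

theorem BS.step2 (h : BS v T O s x a b c) (hO : ∀ τ ≤ T, 0 < O τ) :
    ∃ T' ≤ T, ∃ cc > 0, ∃ K > 0, ∀ τ ≤ T',
      Real.exp (1/(2*v) * Real.log (O τ)) * (a τ * b τ + b τ * c τ + c τ * a τ)
        ≤ K * Real.exp (cc * τ) := by
  have hv0 := h.v0
  have hv1 := h.v1
  have hp : 0 < 1 - 2*v := by linarith
  have hp4 : 0 < 1 - 4*v^2 := by nlinarith
  set η := min ((4 - 8*v)/3/20) ((4 - 8*v)/3 * (4*v*(1 - 2*v) * (1 - 4*v^2)) / 48) with hη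
  have hA : 0 < (4 - 8*v)/3 := by linarith
  have hη0 : 0 < η := by rw [hη]; exact lt_min (by positivity) (by positivity)
  set cc := η * (4*v*(1 - 2*v)) * (1 - 4*v^2)/2 with hcc
  have hcc0 : 0 < cc := by positivity
  set C1 := 36/(1 - 2*v) + 10 with hC1
  have hC10 : 0 < C1 := by positivity
  set M := (1 + 2*v)/v * (2 + |Real.log ((1 - 2*v)/2)|) + 4 with hM
  set E := Real.exp M with hE
  have hE0 : 0 < E := Real.exp_pos _
  set ε := min (min (1/6) ((1 - 2*v)/4)) (min (4*v*(1 - 2*v) * (1 - 4*v^2)/60) (cc/(18*C1*E^2))) with hε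
  have hε0 : 0 < ε := by
    rw [hε]; exact lt_min (lt_min (by norm_num) (by positivity)) (lt_min (by positivity) (by positivity))
  have ee1 : ε ≤ 1/6 := (min_le_left _ _).trans (min_le_left _ _)
  have ee2 : ε ≤ (1 - 2*v)/4 := (min_le_left _ _).trans (min_le_right _ _)
  have ee3 : ε ≤ 4*v*(1 - 2*v) * (1 - 4*v^2)/60 := (min_le_right _ _).trans (min_le_left _ _)
  have ee4 : ε ≤ cc/(18*C1*E^2) := (min_le_right _ _).trans (min_le_right _ _)
  have pm : Prm v ε η := ⟨hε0, ee1, ee2, hη0, min_le_left _ _, min_le_right _ _, by linarith⟩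
  have hsm : 9*C1*ε*E^2 ≤ cc/2 := by
    rw [le_div_iff₀ (by positivity)] at ee4
    linarith
  obtain ⟨T', hT', pk⟩ := h.pack hε0 (by linarith)
  have h1 : ∀ τ ≤ T', _ := fun τ hτ => h.dW (hτ.trans hT') (hO τ (hτ.trans hT')) (pk τ hτ) pm
  have h2 : ∀ τ ≤ T', _ := fun τ hτ => h.rot.dW (hτ.trans hT') (hO τ (hτ.trans hT')) (pk τ hτ).rot pm
  have h3 : ∀ τ ≤ T', _ := fun τ hτ => h.rot2.dW (hτ.trans hT') (hO τ (hτ.trans hT')) (pk τ hτ).rot2 pm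
  choose! L1 d1 l1 using h1
  choose! L2 d2 l2 using h2
  choose! L3 d3 l3 using h3
  have b1 : ∀ τ ≤ T', _ := fun τ hτ => WW_bd hv0 hv1 (hO τ (hτ.trans hT')).le
    (h.b0 τ (hτ.trans hT')) (h.c0 τ (hτ.trans hT')) pm (pk τ hτ).sb hM
  have b2 : ∀ τ ≤ T', _ := fun τ hτ => WW_bd hv0 hv1 (hO τ (hτ.trans hT')).le
    (h.c0 τ (hτ.trans hT')) (h.a0 τ (hτ.trans hT')) pm (pk τ hτ).rot.sb hM
  have b3 : ∀ τ ≤ T', _ := fun τ hτ => WW_bd hv0 hv1 (hO τ (hτ.trans hT')).le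
    (h.a0 τ (hτ.trans hT')) (h.b0 τ (hτ.trans hT')) pm (pk τ hτ).rot2.sb hM
  have heM : Real.exp (-M) * E = 1 := by rw [hE, ← Real.exp_add]; simp
  have hdec := exp_decay (fun τ hτ => ((d1 τ hτ).add (d2 τ hτ)).add (d3 τ hτ)) (cc := cc/2)
    (fun τ hτ => by
      have hτ' := hτ.trans hT'
      exact sum_ineq (h.a0 τ hτ') (h.b0 τ hτ') (h.c0 τ hτ') (Real.exp_pos (1/(2*v) * Real.log (O τ)))
        hE0 (Real.exp_pos (-M)) hC10 hε0 heM (l1 τ hτ) (l2 τ hτ) (l3 τ hτ) (b1 τ hτ).1 (b1 τ hτ).2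
        (b2 τ hτ).1 (b2 τ hτ).2 (b3 τ hτ).1 (b3 τ hτ).2 (pk τ hτ).PS hsm)
  simp only [Pi.add_apply] at hdec
  set K := _ * Real.exp (-(cc/2)*T') with hK
  refine ⟨T', hT', cc/2, by positivity, E * |K| + 1, by positivity, fun τ hτ => ?_⟩
  have e0 := Real.exp_pos (cc/2*τ)
  have hd := hdec τ hτ
  have hsum := add_le_add (add_le_add (b1 τ hτ).1 (b2 τ hτ).1) (b3 τ hτ).1
  have h5 := mul_le_mul_of_nonneg_left (hsum.trans hd) hE0.le
  set X := Real.exp (1/(2*v) * Real.log (O τ)) with hX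
  have e1 : E * (X * Real.exp (-M) * (b τ * c τ) + X * Real.exp (-M) * (c τ * a τ)
      + X * Real.exp (-M) * (a τ * b τ)) = X * (a τ * b τ + b τ * c τ + c τ * a τ) := by
    linear_combination X * (a τ * b τ + b τ * c τ + c τ * a τ) * heM
  rw [e1] at h5
  have h6 : K * Real.exp (cc/2*τ) ≤ |K| * Real.exp (cc/2*τ) := by
    gcongr; exact le_abs_self K
  have h7 := mul_le_mul_of_nonneg_left h6 hE0.le
  linarith

/-! ### Step 3 -/

def mm (v : ℝ) : ℝ := v * ((1 - 2*v)/(2*(1 - v^2)))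

def bet (v : ℝ) : ℝ := 1/mm v - 1

lemma mm_pos {v : ℝ} (h0 : 0 < v) (h1 : v < 1/2) : 0 < mm v := by
  unfold mm
  have : 0 < 1 - 2*v := by linarith
  have : 0 < 1 - v^2 := by nlinarith
  positivity

lemma bet_ge {v : ℝ} (h0 : 0 < v) (h1 : v < 1/2) : 2*(1/(2*v)) ≤ bet v := by
  have e1 : 0 < 1 - 2*v := by linarith
  have e2 : 0 < 1 - v^2 := by nlinarith
  have : bet v - 2*(1/(2*v)) = (1 + v)/(v*(1 - 2*v)) := by
    have e3 : 1/mm v = 2*(1 - v^2)/(v*(1 - 2*v)) := by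
      unfold mm
      rw [div_eq_div_iff (by positivity) (by positivity)]
      have : v * ((1 - 2*v)/(2*(1 - v^2))) * (2*(1 - v^2)) = v*(1 - 2*v) := by
        rw [mul_assoc, div_mul_cancel₀ _ (by positivity)]
      linarith
    have e4 : 2*(1/(2*v)) = 2*(1 - 2*v)/(2*(v*(1 - 2*v))) := by
      rw [mul_one_div, div_eq_div_iff (by positivity) (by positivity)]; ring
    unfold bet; rw [e3, e4, sub_sub, eq_div_iff (by positivity), sub_mul, add_mul,
      div_mul_cancel₀ _ (by positivity), mul_comm 2 (v*(1 - 2*v)), ← div_div, div_mul_eq_mul_div,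
      div_mul_cancel₀ _ (by positivity)]
    ring
  have h3 : 0 ≤ (1 + v)/(v*(1 - 2*v)) := by positivity
  linarith

lemma rate3 {v O s x a S D2 : ℝ} (hv0 : 0 < v) (hv1 : v < 1/2)
    (hU0 : 1/3 ≤ 1 - v*s) (hU1 : 1 - v*s ≤ 2) (ha : 0 < a) (hS : 0 < S) (hD : 0 ≤ D2)
    (hcon : O + s^2 + x^2 + 3/4 * (D2 + a^2 - 2*a*S) = 1) :
    (4 - 8*v)/(2*mm v) * ((s - v)^2 + x^2) - 27*v/mm v * D2 ≤
    bet v * (2 * qv v O s x - 8*v) + 2 * (qv v O s x - 4*s)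
      - 2/mm v * (-(v * (-(2 - qv v O s x) * s - 3/2 * (D2 - a*(2*a - S)))) / (1 - v*s)) := by
  have hm := mm_pos hv0 hv1
  have e1 : 0 < 1 - 2*v := by linarith
  have e2 : 0 < 1 - v^2 := by nlinarith
  have hmm : mm v = v * ((1 - 2*v)/(2*(1 - v^2))) := rfl
  set n := (1 - 2*v)/(2*(1 - v^2)) with hn
  have hn' : n * (2*(1 - v^2)) = 1 - 2*v := by rw [hn]; field_simp
  have hnge : 4 - 8*v ≤ 8 * n := by
    have : 0 < n := by rw [hn]; positivity
    nlinarith [mul_pos this (pow_pos hv0 2)]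
  set m := mm v with hmdef
  set U := 1 - v*s with hU
  have hUp : 0 < U := by linarith
  have e : bet v * (2 * qv v O s x - 8*v) + 2 * (qv v O s x - 4*s)
      - 2/m * (-(v * (-(2 - qv v O s x) * s - 3/2 * (D2 - a*(2*a - S)))) / U)
      = (8*n*(s - v)^2 + (4 - 8*v)*x^2 - 9*v*(D2 - a*S)) / (m*U) := by
    rw [eq_div_iff (by positivity)]
    have : (bet v * (2 * qv v O s x - 8*v) + 2 * (qv v O s x - 4*s)
      - 2/m * (-(v * (-(2 - qv v O s x) * s - 3/2 * (D2 - a*(2*a - S)))) / U)) * (m * U)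
      = U * ((1 - m) * (2 * qv v O s x - 8*v) + 2*m*(qv v O s x - 4*s))
      + 2*v*(-(2 - qv v O s x) * s - 3/2 * (D2 - a*(2*a - S))) := by
      unfold bet; rw [← hmdef]; field_simp; ring
    rw [this, hU, hmm]
    unfold qv
    linear_combination 8*v*hcon - 4*(s - v)*s*hn'
  rw [e, le_div_iff₀ (by positivity)]
  have e3 : ((4 - 8*v)/(2*m) * ((s - v)^2 + x^2) - 27*v/m * D2) * (m*U)
      = (4 - 8*v)/2 * ((s - v)^2 + x^2) * U - 27*v*D2*U := by field_simp
  rw [e3]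
  have t1 := mul_nonneg (mul_nonneg (by linarith : 0 ≤ (4 - 8*v)/2) (by positivity : 0 ≤ (s - v)^2 + x^2))
    (by linarith : 0 ≤ 2 - U)
  have t2 := mul_nonneg (mul_nonneg hv0.le hD) (by linarith : 0 ≤ U - 1/3)
  have t3 := mul_nonneg (sub_nonneg.2 hnge) (sq_nonneg (s - v))
  have t4 : 0 < v * (a * S) := by positivity
  linarith

def MM (v O s a : ℝ) : ℝ :=
  Real.exp (bet v * Real.log O - 2/mm v * Real.log (1 - v*s)) * a^2

lemma U3_bd {v O s x ε : ℝ} (hv0 : 0 < v) (hv1 : v < 1/2) (hO : 0 ≤ O) (h0 : 0 < ε)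
    (h1 : ε ≤ 1/6) (hb : O + s^2 + x^2 ≤ 1 + 3*ε) : 1/3 ≤ 1 - v*s ∧ 1 - v*s ≤ 2 := by
  have hs2 : s^2 ≤ (1 + 2*ε)^2 := by nlinarith [sq_nonneg x]
  have hsa' := abs_le.1 (abs_le_of_sq_le_sq hs2 (by linarith))
  constructor <;> nlinarith

lemma BS.dM (h : BS v T O s x a b c) {τ ε : ℝ} (hτ : τ ≤ T) (hO : 0 < O τ) (h0 : 0 < ε)
    (h1 : ε ≤ 1/6) (pk : Pk ε (O τ) (s τ) (x τ) (a τ) (b τ) (c τ)) :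
    ∃ L, HasDerivAt (fun τ => MM v (O τ) (s τ) (a τ)) (L * MM v (O τ) (s τ) (a τ)) τ ∧
      (4 - 8*v)/(2*mm v) * ((s τ - v)^2 + (x τ)^2) - 27*v/mm v * (b τ - c τ)^2 ≤ L := by
  have hb := h.b0 τ hτ
  have hc := h.c0 τ hτ
  obtain ⟨hU0, hU1⟩ := U3_bd h.v0 h.v1 hO.le h0 h1 pk.sb
  have hcon := h.con τ hτ
  have key := rate3 (O := O τ) (s := s τ) (x := x τ) (a := a τ) (D2 := (b τ - c τ)^2) (S := b τ + c τ) h.v0 h.v1 hU0 hU1 (h.a0 τ hτ)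
    (by positivity) (sq_nonneg _) (by linear_combination hcon)
  refine ⟨_, ?_, key⟩
  have d1 := ((h.dO τ hτ).log hO.ne').const_mul (bet v)
  have d2 := ((((h.ds τ hτ).const_mul v).const_sub 1).log (by linarith)).const_mul (2/mm v)
  refine (((d1.sub d2).exp).mul ((h.da τ hτ).pow 2)).congr_deriv ?_
  simp only [MM, Pi.mul_apply, Pi.add_apply, Pi.sub_apply, Pi.pow_apply]
  rw [mul_div_assoc, div_self hO.ne']
  norm_num
  ring

lemma MM_bd {v O s x a ε : ℝ} (hv0 : 0 < v) (hv1 : v < 1/2) (hO : 0 ≤ O) (h0 : 0 < ε)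
    (h1 : ε ≤ 1/6) (hbd : O + s^2 + x^2 ≤ 1 + 3*ε) :
    Real.exp (bet v * Real.log O) * Real.exp (-(4/mm v)) * a^2 ≤ MM v O s a ∧
    MM v O s a ≤ Real.exp (bet v * Real.log O) * Real.exp (4/mm v) * a^2 := by
  obtain ⟨hU0, hU1⟩ := U3_bd hv0 hv1 hO h0 h1 hbd
  have hm := mm_pos hv0 hv1
  have l2 : Real.log (1 - v*s) ≤ 2 := by
    have := Real.log_le_sub_one_of_pos (by linarith : 0 < 1 - v*s)
    linarith
  have l1 : -2 ≤ Real.log (1 - v*s) := by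
    have := Real.one_sub_inv_le_log_of_pos (by linarith : 0 < 1 - v*s)
    have h3 : (1 - v*s)⁻¹ ≤ 3 := by
      rw [inv_le_comm₀ (by linarith) (by norm_num)]; linarith
    linarith
  unfold MM
  rw [← Real.exp_add, ← Real.exp_add]
  have hm2 : 0 < 2/mm v := by positivity
  have e4 : 4/mm v = 2/mm v * 2 := by ring
  constructor
  · apply mul_le_mul_of_nonneg_right _ (sq_nonneg a)
    rw [Real.exp_le_exp, e4]
    have := mul_le_mul_of_nonneg_left l2 hm2.le
    linarith
  · apply mul_le_mul_of_nonneg_right _ (sq_nonneg a)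
    rw [Real.exp_le_exp, e4]
    have := mul_le_mul_of_nonneg_left l1 hm2.le
    linarith

/-- the dissipation -/
def hdis (v s x a b c : ℝ) : ℝ :=
  a^2 * ((s - v)^2 + x^2) + b^2 * ((-s/2 - √3/2*x - v)^2 + (√3/2*s - x/2)^2)
    + c^2 * ((-s/2 + √3/2*x - v)^2 + (-(√3/2)*s - x/2)^2)

lemma term3 {A B Y e E g D W a L V : ℝ} (hA : 0 < A) (hB : 0 < B) (hY : 0 < Y) (he : 0 < e) (hE : 0 < E)
    (hg : 0 ≤ g) (hL : A * g - B * D^2 ≤ L) (h1 : Y * e * a^2 ≤ W) (h2 : W ≤ Y * E * a^2)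
    (hV : (a * D)^2 ≤ V^2) :
    A * e * Y * (a^2 * g) - B * E * (Y * V^2) ≤ L * W := by
  have hW : 0 ≤ W := le_trans (by positivity) h1
  have k1 := mul_le_mul_of_nonneg_right hL hW
  have k2 := mul_le_mul_of_nonneg_left h1 (by positivity : 0 ≤ A * g)
  have k3 := mul_le_mul_of_nonneg_left h2 (by positivity : 0 ≤ B * D^2)
  have k4 := mul_le_mul_of_nonneg_left hV (by positivity : 0 ≤ B * E * Y)
  linarith

lemma aDV {a b c : ℝ} (ha : 0 < a) (hb : 0 < b) (hc : 0 < c) :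
    (a * (b - c))^2 ≤ (a*b + b*c + c*a)^2 := by
  have := mul_pos ha hb
  have := mul_pos hb hc
  have := mul_pos hc ha
  apply sq_le_sq'
  · nlinarith
  · nlinarith

set_option maxHeartbeats 1000000 in
theorem BS.step3 (h : BS v T O s x a b c) (hO : ∀ τ ≤ T, 0 < O τ) :
    ∃ T' ≤ T, ∃ F F' : ℝ → ℝ, ∃ c0 > 0, ∃ Φ > 0, ∃ φ > 0, ∃ C > 0, ∃ cc > 0, ∀ τ ≤ T',
      HasDerivAt F (F' τ) τ ∧
      c0 * Real.exp (bet v * Real.log (O τ)) * hdis v (s τ) (x τ) (a τ) (b τ) (c τ)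
        - C * Real.exp (cc * τ) ≤ F' τ ∧
      φ * Real.exp (bet v * Real.log (O τ)) * ((a τ)^2 + (b τ)^2 + (c τ)^2) ≤ F τ ∧
      F τ ≤ Φ * Real.exp (bet v * Real.log (O τ)) * ((a τ)^2 + (b τ)^2 + (c τ)^2) ∧
      Real.exp (bet v * Real.log (O τ)) * (a τ * b τ + b τ * c τ + c τ * a τ)^2
        ≤ C * Real.exp (cc * τ) := by
  have hv0 := h.v0
  have hv1 := h.v1
  have hm := mm_pos hv0 hv1
  obtain ⟨T1, hT1, cc, hcc, K, hK, hV⟩ := h.step2 hO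
  obtain ⟨T2, hT2, pk⟩ := h.pack (ε := 1/6) (by norm_num) (by norm_num)
  have hε0 : (0:ℝ) < 1/6 := by norm_num
  have h1 : ∀ τ ≤ T2, _ := fun τ hτ =>
    h.dM (hτ.trans hT2) (hO τ (hτ.trans hT2)) hε0 le_rfl (pk τ hτ)
  have h2 : ∀ τ ≤ T2, _ := fun τ hτ =>
    h.rot.dM (hτ.trans hT2) (hO τ (hτ.trans hT2)) hε0 le_rfl (pk τ hτ).rot
  have h3 : ∀ τ ≤ T2, _ := fun τ hτ =>
    h.rot2.dM (hτ.trans hT2) (hO τ (hτ.trans hT2)) hε0 le_rfl (pk τ hτ).rot2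
  choose! L1 d1 l1 using h1
  choose! L2 d2 l2 using h2
  choose! L3 d3 l3 using h3
  set e := Real.exp (-(4/mm v)) with he
  set E := Real.exp (4/mm v) with hE
  have he0 : 0 < e := Real.exp_pos _
  have hE0 : 0 < E := Real.exp_pos _
  set A := (4 - 8*v)/(2*mm v) with hA
  set B := 27*v/mm v with hB
  have hA0 : 0 < A := by rw [hA]; apply div_pos <;> linarith
  have hB0 : 0 < B := by positivity
  set δ := bet v - 2*(1/(2*v)) with hδ
  have hδ0 : 0 ≤ δ := by have := bet_ge hv0 hv1; linarith
  set C' := Real.exp δ * K^2 with hC'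
  have hC'0 : 0 < C' := by positivity
  -- bound on Y V^2
  have hYV : ∀ τ ≤ min T1 T2, Real.exp (bet v * Real.log (O τ)) *
      (a τ * b τ + b τ * c τ + c τ * a τ)^2 ≤ C' * Real.exp (2*cc*τ) := by
    intro τ hτ
    have hτ1 := hτ.trans (min_le_left _ _)
    have hτ2 := hτ.trans (min_le_right _ _)
    have hτT := hτ2.trans hT2
    have := h.a0 τ hτT
    have := h.b0 τ hτT
    have := h.c0 τ hτT
    have hVt := hV τ hτ1
    have hO2 : O τ ≤ 2 := by
      have := (pk τ hτ2).sb
      nlinarith [sq_nonneg (s τ), sq_nonneg (x τ)]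
    have hlog : Real.log (O τ) ≤ 1 := by
      have := Real.log_le_sub_one_of_pos (hO τ hτT)
      linarith
    have e1 : Real.exp (bet v * Real.log (O τ)) =
        Real.exp (δ * Real.log (O τ)) * (Real.exp (1/(2*v) * Real.log (O τ)))^2 := by
      rw [← Real.exp_nat_mul, ← Real.exp_add]
      congr 1
      rw [hδ]; push_cast; ring
    have e2 : Real.exp (2*cc*τ) = (Real.exp (cc*τ))^2 := by
      rw [← Real.exp_nat_mul]; congr 1; push_cast; ring
    have e3 : Real.exp (δ * Real.log (O τ)) ≤ Real.exp δ := by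
      rw [Real.exp_le_exp]; nlinarith
    rw [e1, e2]
    calc Real.exp (δ * Real.log (O τ)) * (Real.exp (1/(2*v) * Real.log (O τ)))^2 *
        (a τ * b τ + b τ * c τ + c τ * a τ)^2
        = Real.exp (δ * Real.log (O τ)) * (Real.exp (1/(2*v) * Real.log (O τ)) *
        (a τ * b τ + b τ * c τ + c τ * a τ))^2 := by ring
      _ ≤ Real.exp δ * (K * Real.exp (cc*τ))^2 := by gcongr
      _ = _ := by rw [hC']; ring
  refine ⟨min T1 T2, (min_le_right _ _).trans hT2,
    fun τ => MM v (O τ) (s τ) (a τ) + MM v (O τ) (-(s τ)/2 - √3/2*(x τ)) (b τ)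
      + MM v (O τ) (-(s τ)/2 + √3/2*(x τ)) (c τ),
    fun τ => L1 τ * MM v (O τ) (s τ) (a τ) + L2 τ * MM v (O τ) (-(s τ)/2 - √3/2*(x τ)) (b τ)
      + L3 τ * MM v (O τ) (-(s τ)/2 + √3/2*(x τ)) (c τ), A * e, by positivity, E, hE0, e, he0,
    (3 * B * E + 1) * C', by positivity, 2*cc, by positivity, fun τ hτ =>
    ⟨((d1 τ (hτ.trans (min_le_right _ _))).add (d2 τ (hτ.trans (min_le_right _ _)))).add
      (d3 τ (hτ.trans (min_le_right _ _))), ?_⟩⟩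
  have hτ2 := hτ.trans (min_le_right _ _)
  have hτT := hτ2.trans hT2
  have a0 := h.a0 τ hτT
  have b0 := h.b0 τ hτT
  have c0 := h.c0 τ hτT
  have hyv := hYV τ hτ
  have b1 := MM_bd (a := a τ) hv0 hv1 (hO τ hτT).le hε0 le_rfl (pk τ hτ2).sb
  have b2 := MM_bd (a := b τ) hv0 hv1 (hO τ hτT).le hε0 le_rfl (pk τ hτ2).rot.sb
  have b3 := MM_bd (a := c τ) hv0 hv1 (hO τ hτT).le hε0 le_rfl (pk τ hτ2).rot2.sb
  simp only [Pi.add_apply]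
  set Y := Real.exp (bet v * Real.log (O τ)) with hY
  have hY0 : 0 < Y := Real.exp_pos _
  have t1 := term3 (V := a τ * b τ + b τ * c τ + c τ * a τ) hA0 hB0 hY0 he0 hE0 (by positivity)
    (l1 τ hτ2) b1.1 b1.2 (aDV a0 b0 c0)
  have t2 := term3 (V := a τ * b τ + b τ * c τ + c τ * a τ) hA0 hB0 hY0 he0 hE0 (by positivity)
    (l2 τ hτ2) b2.1 b2.2 (by have := aDV b0 c0 a0; nlinarith)
  have t3 := term3 (V := a τ * b τ + b τ * c τ + c τ * a τ) hA0 hB0 hY0 he0 hE0 (by positivity)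
    (l3 τ hτ2) b3.1 b3.2 (by have := aDV c0 a0 b0; nlinarith)
  have hBE := mul_le_mul_of_nonneg_left hyv (by positivity : 0 ≤ 3 * B * E)
  have hpos : 0 < C' * Real.exp (2*cc*τ) := by positivity
  have hpos2 : 0 < B * E * (C' * Real.exp (2*cc*τ)) := by positivity
  refine ⟨?_, ?_, ?_, ?_⟩
  · unfold hdis
    linarith
  · linarith [b1.1, b2.1, b3.1]
  · linarith [b1.2, b2.2, b3.2]
  · linarith

/-! ### Boundedness bookkeeping -/

/-- bounded near `-∞` -/
def Bd (f : ℝ → ℝ) : Prop := ∃ T C, ∀ τ ≤ T, |f τ| ≤ C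

lemma Bd.const (c : ℝ) : Bd (fun _ => c) := ⟨0, |c|, fun τ _ => le_rfl⟩

lemma Bd.add {f g : ℝ → ℝ} (hf : Bd f) (hg : Bd g) : Bd (fun τ => f τ + g τ) := by
  obtain ⟨T, C, hf⟩ := hf
  obtain ⟨T', C', hg⟩ := hg
  refine ⟨min T T', C + C', fun τ hτ => ?_⟩
  have h1 := hf τ (hτ.trans (min_le_left _ _))
  have h2 := hg τ (hτ.trans (min_le_right _ _))
  exact (abs_add_le _ _).trans (by linarith)

lemma Bd.mul {f g : ℝ → ℝ} (hf : Bd f) (hg : Bd g) : Bd (fun τ => f τ * g τ) := by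
  obtain ⟨T, C, hf⟩ := hf
  obtain ⟨T', C', hg⟩ := hg
  refine ⟨min T T', C * C', fun τ hτ => ?_⟩
  have h1 := hf τ (hτ.trans (min_le_left _ _))
  have h2 := hg τ (hτ.trans (min_le_right _ _))
  rw [abs_mul]
  exact mul_le_mul h1 h2 (abs_nonneg _) ((abs_nonneg _).trans h1)

lemma Bd.neg {f : ℝ → ℝ} (hf : Bd f) : Bd (fun τ => - f τ) := by
  simpa using (Bd.const (-1)).mul hf

lemma Bd.sub {f g : ℝ → ℝ} (hf : Bd f) (hg : Bd g) : Bd (fun τ => f τ - g τ) := by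
  simpa [sub_eq_add_neg] using hf.add hg.neg

lemma Bd.pow {f : ℝ → ℝ} (hf : Bd f) (n : ℕ) : Bd (fun τ => f τ ^ n) := by
  induction n with
  | zero => simpa using Bd.const 1
  | succ n ih => simpa [pow_succ] using ih.mul hf

lemma BD.of {f f' : ℝ → ℝ} (h1 : Bd f) (hd : ∀ τ ≤ T, HasDerivAt f (f' τ) τ) (h2 : Bd f') :
    BD f := by
  obtain ⟨T1, C, hf⟩ := h1
  obtain ⟨T2, C', hg⟩ := h2
  refine ⟨min T (min T1 T2), max C C', fun τ hτ => ?_⟩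
  have i0 := hτ.trans (min_le_left _ _)
  have i1 := hτ.trans ((min_le_right _ _).trans (min_le_left _ _))
  have i2 := hτ.trans ((min_le_right _ _).trans (min_le_right _ _))
  exact ⟨(hf τ i1).trans (le_max_left _ _), _, hd τ i0, (hg τ i2).trans (le_max_right _ _)⟩

structure AllBD (O s x a b c : ℝ → ℝ) : Prop where
  O : BD O
  s : BD s
  x : BD x
  a : BD a
  b : BD b
  c : BD c

lemma abs_le_of_sq {y B : ℝ} (hB : 1 ≤ B) (h : y^2 ≤ B) : |y| ≤ B :=
  abs_le_of_sq_le_sq (by nlinarith) (by linarith)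

lemma BS.allBD (h : BS v T O s x a b c) {T' B : ℝ}
    (hV : ∀ τ ≤ T', a τ * b τ + b τ * c τ + c τ * a τ ≤ B) : AllBD O s x a b c := by
  obtain ⟨C, hC1, hC⟩ := h.bdd
  have kO : Bd O := ⟨T, C, fun τ hτ => by
    rw [abs_of_nonneg (h.O0 τ hτ)]
    have := hC τ hτ
    nlinarith [sq_nonneg (s τ), sq_nonneg (x τ)]⟩
  have ks : Bd s := ⟨T, C, fun τ hτ => abs_le_of_sq hC1 (by
    have := hC τ hτ
    have := h.O0 τ hτ
    nlinarith [sq_nonneg (s τ), sq_nonneg (x τ)])⟩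
  have kx : Bd x := ⟨T, C, fun τ hτ => abs_le_of_sq hC1 (by
    have := hC τ hτ
    have := h.O0 τ hτ
    nlinarith [sq_nonneg (s τ), sq_nonneg (x τ)])⟩
  have hN : ∀ τ ≤ min T T', (a τ)^2 + (b τ)^2 + (c τ)^2 ≤ 2 + 2*|B| := fun τ hτ => by
    have i0 := hτ.trans (min_le_left _ _)
    have i1 := hτ.trans (min_le_right _ _)
    have := h.k_le τ i0
    have := hV τ i1
    have := le_abs_self B
    linarith
  have hB1 : 1 ≤ 2 + 2*|B| := by have := abs_nonneg B; linarith
  have ka : Bd a := ⟨min T T', 2 + 2*|B|, fun τ hτ => abs_le_of_sq hB1 (by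
    nlinarith [hN τ hτ, sq_nonneg (b τ), sq_nonneg (c τ)])⟩
  have kb : Bd b := ⟨min T T', 2 + 2*|B|, fun τ hτ => abs_le_of_sq hB1 (by
    nlinarith [hN τ hτ, sq_nonneg (a τ), sq_nonneg (c τ)])⟩
  have kc : Bd c := ⟨min T T', 2 + 2*|B|, fun τ hτ => abs_le_of_sq hB1 (by
    nlinarith [hN τ hτ, sq_nonneg (b τ), sq_nonneg (a τ)])⟩
  have kq : Bd (fun τ => qv v (O τ) (s τ) (x τ)) := by
    unfold qv
    exact ((Bd.const (4*v)).mul kO).add ((Bd.const 2).mul ((ks.pow 2).add (kx.pow 2)))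
  refine ⟨BD.of kO h.dO ?_, BD.of ks h.ds ?_, BD.of kx h.dx ?_, BD.of ka h.da ?_, BD.of kb h.db ?_,
    BD.of kc h.dc ?_⟩
  · exact (((Bd.const 2).mul kq).sub (Bd.const _)).mul kO
  · exact (((Bd.const 2).sub kq).neg.mul ks).sub ((Bd.const _).mul (((kb.sub kc).pow 2).sub
      (ka.mul ((((Bd.const 2).mul ka).sub kb).sub kc))))
  · exact (((Bd.const 2).sub kq).neg.mul kx).sub (((Bd.const _).mul (kc.sub kb)).mul
      ((ka.sub kb).sub kc))
  · exact (kq.sub ((Bd.const 4).mul ks)).mul ka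
  · exact ((kq.add ((Bd.const 2).mul ks)).add ((Bd.const _).mul kx)).mul kb
  · exact ((kq.add ((Bd.const 2).mul ks)).sub ((Bd.const _).mul kx)).mul kc

/-! ### Convergence to P -/

def TP (v : ℝ) (O s x a b c : ℝ → ℝ) : Prop :=
  Tendsto O atBot (𝓝 (1 - v/2)) ∧ Tendsto s atBot (𝓝 v) ∧ Tendsto x atBot (𝓝 0) ∧
  (∃ n : ℝ, 0 < n ∧ Tendsto a atBot (𝓝 n)) ∧ Tendsto b atBot (𝓝 0) ∧ Tendsto c atBot (𝓝 0)

/-- squeeze helper -/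
lemma tend_zero_of_sq {f g : ℝ → ℝ} (hg : Tendsto g atBot (𝓝 0)) {T' : ℝ}
    (h : ∀ τ ≤ T', (f τ)^2 ≤ g τ) : Tendsto f atBot (𝓝 0) := by
  have h1 : Tendsto (fun τ => (f τ)^2) atBot (𝓝 0) := by
    refine tendsto_of_tendsto_of_tendsto_of_le_of_le' tendsto_const_nhds hg
      (Eventually.of_forall fun τ => sq_nonneg _) ?_
    filter_upwards [eventually_le_atBot T'] with τ hτ using h τ hτ
  have h2 := h1.sqrt
  simp only [Real.sqrt_zero, Real.sqrt_sq_eq_abs] at h2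
  exact (tendsto_zero_iff_abs_tendsto_zero _).2 h2

lemma tend_zero_of_le {f g : ℝ → ℝ} (hg : Tendsto g atBot (𝓝 0)) {T' : ℝ}
    (h0 : ∀ τ ≤ T', 0 ≤ f τ) (h : ∀ τ ≤ T', f τ ≤ g τ) : Tendsto f atBot (𝓝 0) := by
  refine tendsto_of_tendsto_of_tendsto_of_le_of_le' tendsto_const_nhds hg ?_ ?_
  · filter_upwards [eventually_le_atBot T'] with τ hτ using h0 τ hτ
  · filter_upwards [eventually_le_atBot T'] with τ hτ using h τ hτ

lemma BS.toTP (h : BS v T O s x a b c) {T' d : ℝ} (hT' : T' ≤ T) (hd : 0 < d)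
    (ha : ∀ τ ≤ T', d ≤ (a τ)^2)
    (hV : Tendsto (fun τ => a τ * b τ + b τ * c τ + c τ * a τ) atBot (𝓝 0))
    (hh : Tendsto (fun τ => hdis v (s τ) (x τ) (a τ) (b τ) (c τ)) atBot (𝓝 0))
    (hbd : AllBD O s x a b c) : TP v O s x a b c := by
  have hv0 := h.v0
  have hv1 := h.v1
  have hV2 : Tendsto (fun τ => 1/d * (a τ * b τ + b τ * c τ + c τ * a τ)^2) atBot (𝓝 0) := by
    have := (hV.pow 2).const_mul (1/d); simpa using this
  have hh2 : Tendsto (fun τ => 1/d * hdis v (s τ) (x τ) (a τ) (b τ) (c τ)) atBot (𝓝 0) := by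
    have := hh.const_mul (1/d); simpa using this
  have tb : Tendsto b atBot (𝓝 0) := tend_zero_of_sq (T' := T') hV2 fun τ hτ => by
    have i0 := hτ.trans hT'
    have h1 := h.a0 τ i0
    have h2 := h.b0 τ i0
    have h3 := h.c0 τ i0
    have h4 := ha τ hτ
    rw [one_div, ← div_eq_inv_mul, le_div_iff₀ hd]
    calc (b τ)^2 * d ≤ (b τ)^2 * (a τ)^2 := by gcongr
      _ = (a τ * b τ)^2 := by ring
      _ ≤ _ := by
        gcongr
        have := mul_pos h2 h3
        have := mul_pos h3 h1
        linarith
  have tc : Tendsto c atBot (𝓝 0) := tend_zero_of_sq (T' := T') hV2 fun τ hτ => by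
    have i0 := hτ.trans hT'
    have h1 := h.a0 τ i0
    have h2 := h.b0 τ i0
    have h3 := h.c0 τ i0
    have h4 := ha τ hτ
    rw [one_div, ← div_eq_inv_mul, le_div_iff₀ hd]
    calc (c τ)^2 * d ≤ (c τ)^2 * (a τ)^2 := by gcongr
      _ = (c τ * a τ)^2 := by ring
      _ ≤ _ := by
        gcongr
        have := mul_pos h1 h2
        have := mul_pos h2 h3
        linarith
  have hlow : ∀ τ ≤ T', ((s τ - v)^2 + (x τ)^2) ≤ 1/d * hdis v (s τ) (x τ) (a τ) (b τ) (c τ) := by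
    intro τ hτ
    rw [one_div, ← div_eq_inv_mul, le_div_iff₀ hd]
    have h4 := ha τ hτ
    calc ((s τ - v)^2 + (x τ)^2) * d ≤ ((s τ - v)^2 + (x τ)^2) * (a τ)^2 := by gcongr
      _ ≤ _ := by
        unfold hdis
        have : 0 ≤ (b τ)^2 * ((-s τ/2 - √3/2*x τ - v)^2 + (√3/2*s τ - x τ/2)^2)
          + (c τ)^2 * ((-s τ/2 + √3/2*x τ - v)^2 + (-(√3/2)*s τ - x τ/2)^2) := by positivity
        linarith
  have tx : Tendsto x atBot (𝓝 0) := tend_zero_of_sq (T' := T') hh2 fun τ hτ => by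
    have := hlow τ hτ; nlinarith [sq_nonneg (s τ - v)]
  have ts0 : Tendsto (fun τ => s τ - v) atBot (𝓝 0) := tend_zero_of_sq (T' := T') hh2 fun τ hτ => by
    have := hlow τ hτ; nlinarith [sq_nonneg (x τ)]
  have ts : Tendsto s atBot (𝓝 v) := by
    have := ts0.add_const v; simpa using this
  have kq : BD (fun τ => qv v (O τ) (s τ) (x τ)) := by
    unfold qv
    exact ((BD.const (4*v)).mul hbd.O).add ((BD.const 2).mul ((hbd.s.pow 2).add (hbd.x.pow 2)))
  have td := barbalat_deriv ts h.ds ((((BD.const 2).sub kq).neg.mul hbd.s).sub ((BD.const _).mul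
    (((hbd.b.sub hbd.c).pow 2).sub
      (hbd.a.mul ((((BD.const 2).mul hbd.a).sub hbd.b).sub hbd.c)))))
  have tA : Tendsto (fun τ => (a τ)^2) atBot (𝓝 (v*(2 - 4*v)/3)) := by
    have e1 : 1 - v^2 ≠ 0 := by nlinarith
    -- a^2 (3 - 3 v s) = s' + (2-q) s + ...
    have hden : Tendsto (fun τ => 3 - 3*v*s τ) atBot (𝓝 (3 - 3*v*v)) :=
      (ts.const_mul (3*v)).const_sub 3
    have hden0 : 3 - 3*v*v ≠ 0 := by nlinarith
    have tO1 : Tendsto (fun τ => 1 - (s τ)^2 - (x τ)^2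
          - 3/4 * ((b τ)^2 + (c τ)^2 - 2 * (a τ * b τ + b τ * c τ + c τ * a τ))) atBot
        (𝓝 (1 - v^2 - 0^2 - 3/4 * (0^2 + 0^2 - 2*0))) :=
      (((ts.pow 2).const_sub 1).sub (tx.pow 2)).sub
        ((((tb.pow 2).add (tc.pow 2)).sub (hV.const_mul 2)).const_mul (3/4))
    have hnum := ((td.add ((((((ts.pow 2).add (tx.pow 2)).const_mul 2).const_sub 2).sub
      (tO1.const_mul (4*v))).mul ts)).add (((tb.sub tc).pow 2).const_mul (3/2))).add
      ((hV.sub (tb.mul tc)).const_mul (3/2))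
    have hlim := hnum.div hden hden0
    have e2 : v*(2 - 4*v)/3 = (0 + (2 - 2*(v^2 + 0^2) - 4*v*(1 - v^2 - 0^2 - 3/4 * (0^2 + 0^2 - 2*0))) * v
      + 3/2 * (0 - 0)^2 + 3/2*(0 - 0*0)) / (3 - 3*v*v) := by
      rw [div_eq_div_iff (by norm_num) hden0]; ring
    rw [e2]
    refine hlim.congr' ?_
    filter_upwards [eventually_le_atBot T', hden.eventually_ne hden0] with τ hτ hne
    have hcon := h.con τ (hτ.trans hT')
    simp only [Pi.div_apply]
    rw [div_eq_iff hne]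
    unfold qv
    linear_combination (4*v*s τ) * hcon
  have tO : Tendsto O atBot (𝓝 (1 - v/2)) := by
    have := ((((ts.pow 2).const_sub 1).sub (tx.pow 2)).sub
        ((((tb.pow 2).add (tc.pow 2)).sub (hV.const_mul 2)).const_mul (3/4))).sub (tA.const_mul (3/4))
    have e2 : 1 - v/2 = 1 - v^2 - 0^2 - 3/4 * (0^2 + 0^2 - 2*0) - 3/4*(v*(2 - 4*v)/3) := by ring
    rw [e2]
    refine this.congr' ?_
    filter_upwards [eventually_le_atBot T'] with τ hτ
    have hcon := h.con τ (hτ.trans hT')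
    linear_combination -hcon
  have hp : 0 < v*(2 - 4*v)/3 := by
    have : 0 < 2 - 4*v := by linarith
    positivity
  refine ⟨tO, ts, tx, ⟨√(v*(2 - 4*v)/3), Real.sqrt_pos.2 hp, ?_⟩, tb, tc⟩
  refine tA.sqrt.congr' ?_
  filter_upwards [eventually_le_atBot T'] with τ hτ
  exact Real.sqrt_sq (h.a0 τ (hτ.trans hT')).le

/-! ### selection of the index -/

lemma hdis_rot (v s x a b c : ℝ) :
    hdis v (-s/2 - √3/2*x) (√3/2*s - x/2) b c a = hdis v s x a b c := by
  unfold hdis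
  have e1 : -(-s/2 - √3/2*x)/2 - √3/2*(√3/2*s - x/2) = -s/2 + √3/2*x := by
    linear_combination (-(1/4)) * s * r3
  have e2 : √3/2*(-s/2 - √3/2*x) - (√3/2*s - x/2)/2 = -(√3/2)*s - x/2 := by
    linear_combination (-(1/4)) * x * r3
  have e3 : -(-s/2 - √3/2*x)/2 + √3/2*(√3/2*s - x/2) = s := by
    linear_combination (1/4) * s * r3
  have e4 : -(√3/2)*(-s/2 - √3/2*x) - (√3/2*s - x/2)/2 = x := by
    linear_combination (1/4) * x * r3
  rw [e1, e2, e3, e4]; ring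

lemma hdis_rot2 (v s x a b c : ℝ) :
    hdis v (-s/2 + √3/2*x) (-(√3/2)*s - x/2) c a b = hdis v s x a b c := by
  rw [← hdis_rot v s x a b c, ← hdis_rot v (-s/2 - √3/2*x) (√3/2*s - x/2) b c a]
  congr 1
  · linear_combination (1/4) * s * r3
  · linear_combination (1/4) * x * r3

lemma sel_pt {A B C c0 V : ℝ} (hA : 0 ≤ A) (hB : 0 ≤ B) (hC : 0 ≤ C) (hc : 0 < c0)
    (hs : c0 ≤ A + B + C) (h1 : A*B ≤ c0^2/20) (h2 : C*A ≤ c0^2/20) : A ≤ c0/6 ∨ c0/3 ≤ A := by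
  by_contra hcon
  push Not at hcon
  obtain ⟨p, q⟩ := hcon
  rcases le_total B C with hbc | hbc
  · nlinarith
  · nlinarith

lemma BS.selP (h : BS v T O s x a b c) {T' c0 : ℝ} (hT' : T' ≤ T) (hc0 : 0 < c0)
    (hs : ∀ τ ≤ T', c0 ≤ (a τ)^2 + (b τ)^2 + (c τ)^2)
    (hV : Tendsto (fun τ => a τ * b τ + b τ * c τ + c τ * a τ) atBot (𝓝 0))
    (hh : Tendsto (fun τ => hdis v (s τ) (x τ) (a τ) (b τ) (c τ)) atBot (𝓝 0)) :
    TP v O s x a b c ∨ TP v O (fun τ => -s τ/2 - √3/2 * x τ) (fun τ => √3/2 * s τ - x τ/2) b c a ∨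
    TP v O (fun τ => -s τ/2 + √3/2 * x τ) (fun τ => -(√3/2) * s τ - x τ/2) c a b := by
  obtain ⟨T1, hT1⟩ := ev_Iic (hV.eventually (gt_mem_nhds (show (0:ℝ) < c0/5 by positivity)))
  set T2 := min T' T1 with hT2
  have hV2 : ∀ τ ≤ T2, a τ * b τ + b τ * c τ + c τ * a τ < c0/5 := fun τ hτ =>
    hT1 τ (hτ.trans (min_le_right _ _))
  have hs2 : ∀ τ ≤ T2, c0 ≤ (a τ)^2 + (b τ)^2 + (c τ)^2 := fun τ hτ => hs τ (hτ.trans (min_le_left _ _))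
  have hT2T : T2 ≤ T := (min_le_left _ _).trans hT'
  have prod : ∀ τ ≤ T2, (a τ)^2 * (b τ)^2 ≤ c0^2/20 ∧ (b τ)^2 * (c τ)^2 ≤ c0^2/20 ∧
      (c τ)^2 * (a τ)^2 ≤ c0^2/20 := by
    intro τ hτ
    have h1 := h.a0 τ (hτ.trans hT2T)
    have h2 := h.b0 τ (hτ.trans hT2T)
    have h3 := h.c0 τ (hτ.trans hT2T)
    have p1 := mul_pos h1 h2
    have p2 := mul_pos h2 h3
    have p3 := mul_pos h3 h1
    have hv := hV2 τ hτ
    have q1 : (a τ * b τ)^2 ≤ (c0/5)^2 := by gcongr; linarith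
    have q2 : (b τ * c τ)^2 ≤ (c0/5)^2 := by gcongr; linarith
    have q3 : (c τ * a τ)^2 ≤ (c0/5)^2 := by gcongr; linarith
    have : 0 < c0^2 := by positivity
    rw [← mul_pow, ← mul_pow, ← mul_pow]
    refine ⟨by linarith, by linarith, by linarith⟩
  have da := dichotomy (T := T2) (a := c0/6) (b := c0/3) (f := fun τ => (a τ)^2)
    (fun τ hτ => ((h.da τ (hτ.trans hT2T)).continuousAt).pow 2)
    (fun τ hτ => sel_pt (V := 0) (sq_nonneg _) (sq_nonneg _) (sq_nonneg _) hc0 (hs2 τ hτ) (prod τ hτ).1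
      (prod τ hτ).2.2) (by linarith)
  have db := dichotomy (T := T2) (a := c0/6) (b := c0/3) (f := fun τ => (b τ)^2)
    (fun τ hτ => ((h.db τ (hτ.trans hT2T)).continuousAt).pow 2)
    (fun τ hτ => sel_pt (V := 0) (sq_nonneg _) (sq_nonneg (c τ)) (sq_nonneg (a τ)) hc0 (by linarith [hs2 τ hτ]) (prod τ hτ).2.1
      (prod τ hτ).1) (by linarith)
  have dc := dichotomy (T := T2) (a := c0/6) (b := c0/3) (f := fun τ => (c τ)^2)
    (fun τ hτ => ((h.dc τ (hτ.trans hT2T)).continuousAt).pow 2)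
    (fun τ hτ => sel_pt (V := 0) (sq_nonneg _) (sq_nonneg (a τ)) (sq_nonneg (b τ)) hc0 (by linarith [hs2 τ hτ]) (prod τ hτ).2.2
      (prod τ hτ).2.1) (by linarith)
  have hbd := h.allBD (T' := T2) (fun τ hτ => (hV2 τ hτ).le)
  rcases da with da | da
  · rcases db with db | db
    · rcases dc with dc | dc
      · exfalso
        have := hs2 T2 le_rfl
        have := da T2 le_rfl
        have := db T2 le_rfl
        have := dc T2 le_rfl
        linarith
      · right; right
        refine h.rot2.toTP hT2T (by positivity : 0 < c0/3) dc ?_ ?_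
          (h.rot2.allBD (T' := T2) (B := c0/5) (fun τ hτ => by have := hV2 τ hτ; linarith))
        · refine hV.congr fun τ => by ring
        · refine hh.congr fun τ => (hdis_rot2 _ _ _ _ _ _).symm
    · right; left
      refine h.rot.toTP hT2T (by positivity : 0 < c0/3) db ?_ ?_
          (h.rot.allBD (T' := T2) (B := c0/5) (fun τ hτ => by have := hV2 τ hτ; linarith))
      · refine hV.congr fun τ => by ring
      · refine hh.congr fun τ => (hdis_rot _ _ _ _ _ _).symm
  · left
    exact h.toTP hT2T (by positivity : 0 < c0/3) da hV hh hbd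

/-! ### Step 4 -/

def TF (O s x a b c : ℝ → ℝ) : Prop :=
  Tendsto O atBot (𝓝 1) ∧ Tendsto s atBot (𝓝 0) ∧ Tendsto x atBot (𝓝 0) ∧
  Tendsto a atBot (𝓝 0) ∧ Tendsto b atBot (𝓝 0) ∧ Tendsto c atBot (𝓝 0)

lemma barrier {f f' : ℝ → ℝ} {δ : ℝ} (hf : ∀ τ ≤ T, HasDerivAt f (f' τ) τ)
    (h : ∀ τ ≤ T, f τ = δ → 0 < f' τ) :
    (∀ τ ≤ T, δ ≤ f τ) ∨ ∃ T' ≤ T, ∀ τ ≤ T', f τ < δ := by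
  by_cases hc : ∀ τ ≤ T, δ ≤ f τ
  · exact Or.inl hc
  right
  push Not at hc
  obtain ⟨t0, ht0, hft0⟩ := hc
  refine ⟨t0, ht0, fun t1 ht1 => ?_⟩
  by_contra hcon
  push Not at hcon
  have := image_le_of_deriv_right_lt_deriv_boundary' (f := fun τ => - f τ) (f' := fun τ => - f' τ)
    (a := t1) (b := t0) (B := fun _ => -δ) (B' := fun _ => 0)
    (fun τ hτ => ((hf τ (hτ.2.trans ht0)).neg.continuousAt).continuousWithinAt)
    (fun τ hτ => (hf τ (hτ.2.le.trans ht0)).neg.hasDerivWithinAt)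
    (by simpa using hcon) continuousOn_const
    (fun τ hτ => hasDerivWithinAt_const _ _ _)
    (fun τ hτ he => by have := h τ (hτ.2.le.trans ht0) (by linarith); linarith)
    (right_mem_Icc.2 ht1)
  linarith

/-- the backward dynamics of `Ω` -/
lemma BS.dOmega (h : BS v T O s x a b c) (hN : ∀ δ > 0, ∀ η > 0, ∀ᶠ τ in atBot, δ ≤ O τ →
    (a τ)^2 + (b τ)^2 + (c τ)^2 ≤ η) {δ1 δ2 : ℝ} (h0 : 0 < δ1) (h2 : δ2 < 1) :
    ∃ T' ≤ T, ∃ m > 0, ∀ τ ≤ T', δ1 ≤ O τ → O τ ≤ δ2 →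
      m ≤ (2 * qv v (O τ) (s τ) (x τ) - 8 * v) * O τ := by
  have hv1 := h.v1
  set κ := (4 - 8*v)*(1 - δ2) with hκ
  have hκ0 : 0 < κ := by
    have : 0 < 4 - 8*v := by linarith
    have : 0 < 1 - δ2 := by linarith
    positivity
  obtain ⟨T1, hT1⟩ := ev_Iic (hN δ1 h0 (κ/6) (by positivity))
  refine ⟨min T T1, min_le_left _ _, κ/2*δ1, by positivity, fun τ hτ hd1 hd2 => ?_⟩
  have i0 := hτ.trans (min_le_left _ _)
  have hn := hT1 τ (hτ.trans (min_le_right _ _)) hd1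
  have hcon := h.con τ i0
  have p1 := mul_pos (h.a0 τ i0) (h.b0 τ i0)
  have p2 := mul_pos (h.b0 τ i0) (h.c0 τ i0)
  have p3 := mul_pos (h.c0 τ i0) (h.a0 τ i0)
  have e : 2 * qv v (O τ) (s τ) (x τ) - 8*v = (4 - 8*v)*(1 - O τ) -
      3 * ((a τ)^2 + (b τ)^2 + (c τ)^2 - 2 * (a τ * b τ + b τ * c τ + c τ * a τ)) := by
    unfold qv; linear_combination 4*hcon
  have e2 : κ ≤ (4 - 8*v)*(1 - O τ) := by
    rw [hκ]; apply mul_le_mul_of_nonneg_left <;> linarith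
  have e3 : κ/2 ≤ 2 * qv v (O τ) (s τ) (x τ) - 8*v := by rw [e]; linarith
  exact mul_le_mul e3 hd1 h0.le (by linarith)

lemma no_stay {f f' : ℝ → ℝ} {m d : ℝ} (hm : 0 < m) (hf : ∀ τ ≤ T, HasDerivAt f (f' τ) τ)
    (h : ∀ τ ≤ T, m ≤ f' τ) (hd : ∀ τ ≤ T, d ≤ f τ) : False := by
  have := mono_Iic (f := fun τ => f τ - m * τ) (f' := fun τ => f' τ - m)
    (fun τ hτ => ((hf τ hτ).sub ((hasDerivAt_id τ).const_mul m)).congr_deriv (by ring)) (fun τ hτ => by linarith [h τ hτ])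
  set t := T - (|f T - d| + 1)/m with ht
  have htT : t ≤ T := by
    have : 0 ≤ (|f T - d| + 1)/m := by positivity
    linarith
  have h1 := this (mem_Iic.2 htT) (mem_Iic.2 le_rfl) htT
  have h2 := hd t htT
  simp only at h1
  have e : m * t = m*T - (|f T - d| + 1) := by rw [ht]; field_simp
  have := le_abs_self (f T - d)
  linarith

theorem BS.step4b (h : BS v T O s x a b c) (hN : ∀ δ > 0, ∀ η > 0, ∀ᶠ τ in atBot, δ ≤ O τ →
    (a τ)^2 + (b τ)^2 + (c τ)^2 ≤ η) : TF O s x a b c ∨ Tendsto O atBot (𝓝 0) := by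
  have bar : ∀ δ, 0 < δ → δ < 1 → (∃ T' ≤ T, ∀ τ ≤ T', δ ≤ O τ) ∨ (∃ T' ≤ T, ∀ τ ≤ T', O τ < δ) := by
    intro δ h0 h1
    obtain ⟨T1, hT1, m, hm, hd⟩ := h.dOmega hN h0 h1
    rcases barrier (T := T1) (δ := δ) (fun τ hτ => h.dO τ (hτ.trans hT1))
      (fun τ hτ he => lt_of_lt_of_le hm (hd τ hτ he.ge he.le)) with h | ⟨T', hT', h⟩
    · exact Or.inl ⟨T1, hT1, h⟩
    · exact Or.inr ⟨T', hT'.trans hT1, h⟩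
  by_cases hall : ∀ δ, 0 < δ → δ < 1 → ∃ T' ≤ T, ∀ τ ≤ T', δ ≤ O τ
  · left
    have tO : Tendsto O atBot (𝓝 1) := by
      rw [Metric.tendsto_nhds]
      intro ε hε
      set e := min ε (1/2) with he
      have e0 : 0 < e := by positivity
      have e1 : e ≤ 1/2 := min_le_right _ _
      have e2 : e ≤ ε := min_le_left _ _
      obtain ⟨T1, hT1, h1⟩ := hall (1 - e/2) (by linarith) (by linarith)
      obtain ⟨T2, hT2, h2⟩ := h.pack (ε := e/6) (by positivity) (by linarith)
      filter_upwards [eventually_le_atBot T1, eventually_le_atBot T2] with τ i1 i2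
      have k1 := h1 τ i1
      have k2 := (h2 τ i2).sb
      have := sq_nonneg (s τ)
      have := sq_nonneg (x τ)
      rw [Real.dist_eq, abs_lt]
      constructor <;> linarith
    have tN : Tendsto (fun τ => (a τ)^2 + (b τ)^2 + (c τ)^2) atBot (𝓝 0) := by
      rw [Metric.tendsto_nhds]
      intro ε hε
      filter_upwards [hN (1/2) (by norm_num) (ε/2) (by positivity),
        tO.eventually (le_mem_nhds (show (1/2:ℝ) < 1 by norm_num))] with τ h1 h2
      have := h1 h2
      rw [Real.dist_eq, sub_zero, abs_of_nonneg (by positivity)]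
      linarith
    have ta : Tendsto a atBot (𝓝 0) := tend_zero_of_sq (T' := T) tN fun τ hτ => by
      nlinarith [sq_nonneg (b τ), sq_nonneg (c τ)]
    have tb : Tendsto b atBot (𝓝 0) := tend_zero_of_sq (T' := T) tN fun τ hτ => by
      nlinarith [sq_nonneg (a τ), sq_nonneg (c τ)]
    have tc : Tendsto c atBot (𝓝 0) := tend_zero_of_sq (T' := T) tN fun τ hτ => by
      nlinarith [sq_nonneg (b τ), sq_nonneg (a τ)]
    have tS : Tendsto (fun τ => (1 - O τ) - 3/4 * ((a τ)^2 + (b τ)^2 + (c τ)^2 - 2 * (a τ * b τ + b τ * c τ + c τ * a τ)))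
        atBot (𝓝 0) := by
      have := (tO.const_sub 1).sub ((tN.sub ((((ta.mul tb).add (tb.mul tc)).add (tc.mul ta)).const_mul 2)).const_mul (3/4))
      simpa using this
    refine ⟨tO, ?_, ?_, ta, tb, tc⟩
    · exact tend_zero_of_sq (T' := T) tS fun τ hτ => by
        have := h.con τ hτ
        have := sq_nonneg (x τ)
        linarith
    · exact tend_zero_of_sq (T' := T) tS fun τ hτ => by
        have := h.con τ hτ
        have := sq_nonneg (s τ)
        linarith
  · right
    push Not at hall
    obtain ⟨δ2, h0, h1, hn⟩ := hall
    obtain ⟨T2, hT2, h2⟩ := (bar δ2 h0 h1).resolve_left (by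
      rintro ⟨T', hT', h'⟩
      obtain ⟨τ, hτ, h3⟩ := hn T' hT'
      have := h' τ hτ
      linarith)
    rw [Metric.tendsto_nhds]
    intro ε hε
    set δ1 := min ε (1/2) with hδ1
    have e0 : 0 < δ1 := by positivity
    have e1 : δ1 ≤ 1/2 := min_le_right _ _
    have e2 : δ1 ≤ ε := min_le_left _ _
    obtain ⟨T3, hT3, h3⟩ := (bar δ1 e0 (by linarith)).resolve_left (by
      rintro ⟨T', hT', h'⟩
      obtain ⟨T1, hT1, m, hm, hd⟩ := h.dOmega hN e0 h1
      set Tm := min T1 (min T' T2) with hTm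
      have j1 : Tm ≤ T1 := min_le_left _ _
      have j2 : Tm ≤ T' := (min_le_right _ _).trans (min_le_left _ _)
      have j3 : Tm ≤ T2 := (min_le_right _ _).trans (min_le_right _ _)
      exact no_stay (T := Tm) (d := 0) hm (fun τ hτ => h.dO τ (hτ.trans (j1.trans hT1)))
        (fun τ hτ => hd τ (hτ.trans j1) (h' τ (hτ.trans j2)) (h2 τ (hτ.trans j3)).le)
        (fun τ hτ => h.O0 τ (hτ.trans (j1.trans hT1))))
    filter_upwards [eventually_le_atBot T3] with τ i
    rw [Real.dist_eq, sub_zero, abs_of_nonneg (h.O0 τ (i.trans hT3))]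
    have := h3 τ i
    linarith

lemma exp_tend {cc : ℝ} (hcc : 0 < cc) (C : ℝ) : Tendsto (fun τ => C * Real.exp (cc*τ)) atBot (𝓝 0) := by
  have h1 : Tendsto (fun τ : ℝ => cc * τ) atBot atBot := tendsto_id.const_mul_atBot hcc
  have := (Real.tendsto_exp_atBot.comp h1).const_mul C
  simpa using this

lemma hdis_nonneg (v s x a b c : ℝ) : 0 ≤ hdis v s x a b c := by unfold hdis; positivity

theorem BS.step4 (h : BS v T O s x a b c) (hO : ∀ τ ≤ T, 0 < O τ) :
    TP v O s x a b c ∨ TP v O (fun τ => -s τ/2 - √3/2 * x τ) (fun τ => √3/2 * s τ - x τ/2) b c a ∨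
    TP v O (fun τ => -s τ/2 + √3/2 * x τ) (fun τ => -(√3/2) * s τ - x τ/2) c a b ∨
    TF O s x a b c ∨ Tendsto O atBot (𝓝 0) := by
  obtain ⟨T1, hT1, F, F', c0, hc0, Φ, hΦ, φ, hφ, C, hC, cc, hcc, hF⟩ := h.step3 hO
  set Y : ℝ → ℝ := fun τ => Real.exp (bet v * Real.log (O τ)) with hYdef
  have hY0 : ∀ τ, 0 < Y τ := fun τ => Real.exp_pos _
  set V : ℝ → ℝ := fun τ => a τ * b τ + b τ * c τ + c τ * a τ with hVdef
  have hbet : 0 ≤ bet v := by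
    have h1 := bet_ge h.v0 h.v1
    have h2 := h.v0
    have : 0 ≤ 2*(1/(2*v)) := by positivity
    linarith
  set G : ℝ → ℝ := fun τ => F τ + C/cc * Real.exp (cc*τ) with hG
  have dG : ∀ τ ≤ T1, HasDerivAt G (F' τ + C * Real.exp (cc*τ)) τ := fun τ hτ => by
    have h1 := ((((hasDerivAt_id τ).const_mul cc).exp).const_mul (C/cc))
    refine ((hF τ hτ).1.add h1).congr_deriv ?_
    simp only [id]
    field_simp
  have dG' : ∀ τ ≤ T1, c0 * Y τ * hdis v (s τ) (x τ) (a τ) (b τ) (c τ) ≤ F' τ + C * Real.exp (cc*τ) :=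
    fun τ hτ => by have := (hF τ hτ).2.1; simp only [hYdef]; linarith
  have hF0 : ∀ τ ≤ T1, 0 ≤ F τ := fun τ hτ => le_trans (by positivity) (hF τ hτ).2.2.1
  obtain ⟨M, hM0, hM, -⟩ := mono_lim (m := 0) (mono_Iic dG (fun τ hτ => le_trans (by
    have := hdis_nonneg v (s τ) (x τ) (a τ) (b τ) (c τ)
    have := hY0 τ
    positivity) (dG' τ hτ))) (fun τ hτ => by have := hF0 τ hτ; simp only [hG]; positivity)
  have tF : Tendsto F atBot (𝓝 M) := by
    have := hM.sub (exp_tend hcc (C/cc))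
    simpa [hG] using this
  obtain ⟨T2, hT2, pk⟩ := h.pack (ε := 1/6) (by norm_num) (by norm_num)
  have hYm : ∀ τ ≤ T2, Y τ ≤ Real.exp (bet v) := fun τ hτ => by
    have h1 := (pk τ hτ).sb
    have h2 := Real.log_le_sub_one_of_pos (hO τ (hτ.trans hT2))
    have := sq_nonneg (s τ)
    have := sq_nonneg (x τ)
    simp only [hYdef]
    rw [Real.exp_le_exp]
    nlinarith
  have hV0 : ∀ τ ≤ T, 0 < V τ := fun τ hτ => by
    have h1 := h.a0 τ hτ
    have h2 := h.b0 τ hτ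
    have h3 := h.c0 τ hτ
    simp only [hVdef]; positivity
  rcases hM0.eq_or_lt with hM0 | hM0
  · -- M = 0
    have : TF O s x a b c ∨ Tendsto O atBot (𝓝 0) := by
      apply h.step4b
      intro δ hδ η hη
      set y := Real.exp (bet v * Real.log δ) with hy
      have hy0 : 0 < y := Real.exp_pos _
      filter_upwards [eventually_le_atBot T1, tF.eventually (gt_mem_nhds (show M < φ*y*η by
        rw [← hM0]; positivity))] with τ hτ h1 hd
      have h2 := (hF τ hτ).2.2.1
      have h3 : y ≤ Real.exp (bet v * Real.log (O τ)) := by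
        rw [hy, Real.exp_le_exp]
        exact mul_le_mul_of_nonneg_left (Real.log_le_log hδ hd) hbet
      have h4 : φ * y * ((a τ)^2 + (b τ)^2 + (c τ)^2) ≤ φ * y * η := by
        refine le_trans ?_ (h2.trans h1.le)
        gcongr
      exact le_of_mul_le_mul_left h4 (by positivity)
    rcases this with h | h
    · exact Or.inr (Or.inr (Or.inr (Or.inl h)))
    · exact Or.inr (Or.inr (Or.inr (Or.inr h)))
  · -- M > 0
    have hYV : Tendsto (fun τ => Y τ * V τ) atBot (𝓝 0) := by
      refine tend_zero_of_sq (T' := min T1 T2) (exp_tend hcc (Real.exp (bet v) * C)) fun τ hτ => ?_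
      have i1 := hτ.trans (min_le_left _ _)
      have i2 := hτ.trans (min_le_right _ _)
      have h1 := (hF τ i1).2.2.2.2
      calc (Y τ * V τ)^2 = Y τ * (Y τ * (V τ)^2) := by ring
        _ ≤ Real.exp (bet v) * (C * Real.exp (cc*τ)) :=
          mul_le_mul (hYm τ i2) h1 (by have := hY0 τ; positivity) (Real.exp_pos _).le
        _ = _ := by ring
    obtain ⟨T3, hT3⟩ := ev_Iic (tF.eventually (le_mem_nhds (show M/2 < M by linarith)))
    obtain ⟨T4, hT4⟩ := ev_Iic (hYV.eventually (ge_mem_nhds (show 0 < M/(8*Φ) by positivity)))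
    set T5 := min (min T1 T2) (min T3 T4) with hT5
    have j1 : T5 ≤ T1 := (min_le_left _ _).trans (min_le_left _ _)
    have j2 : T5 ≤ T2 := (min_le_left _ _).trans (min_le_right _ _)
    have j3 : T5 ≤ T3 := (min_le_right _ _).trans (min_le_left _ _)
    have j4 : T5 ≤ T4 := (min_le_right _ _).trans (min_le_right _ _)
    have hYlow : ∀ τ ≤ T5, 3*M/(16*Φ) ≤ Y τ := fun τ hτ => by
      have h1 := hT3 τ (hτ.trans j3)
      have h2 := hT4 τ (hτ.trans j4)
      have h3 := (hF τ (hτ.trans j1)).2.2.2.1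
      have h4 := h.k_le τ ((hτ.trans j1).trans hT1)
      rw [le_div_iff₀ (by positivity)] at h2
      rw [div_le_iff₀ (by positivity)]
      have h5 : (a τ)^2 + (b τ)^2 + (c τ)^2 ≤ 4/3 + 2 * V τ := by simp only [hVdef]; linarith
      have h6 := mul_le_mul_of_nonneg_left h5 (mul_pos hΦ (hY0 τ)).le
      simp only [hYdef] at *
      linarith
    set δ := 3*M/(16*Φ) with hδ
    have hδ0 : 0 < δ := by positivity
    have tV : Tendsto V atBot (𝓝 0) := by
      have h1 : Tendsto (fun τ => 1/δ * (Y τ * V τ)) atBot (𝓝 0) := by simpa using hYV.const_mul (1/δ)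
      refine tend_zero_of_le (T' := T5) h1 (fun τ hτ => (hV0 τ ((hτ.trans j1).trans hT1)).le) fun τ hτ => ?_
      rw [one_div, ← div_eq_inv_mul, le_div_iff₀ hδ0, mul_comm]
      exact mul_le_mul_of_nonneg_right (hYlow τ hτ) (hV0 τ ((hτ.trans j1).trans hT1)).le
    obtain ⟨T6, hT6⟩ := ev_Iic (tV.eventually (ge_mem_nhds (show (0:ℝ) < 1 by norm_num)))
    have hbd := h.allBD hT6
    have hdBD : BD (fun τ => c0 * δ * hdis v (s τ) (x τ) (a τ) (b τ) (c τ)) := by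
      refine (BD.const (c0*δ)).mul ?_
      unfold hdis
      refine (((hbd.a.pow 2).mul (((hbd.s.sub (BD.const v)).pow 2).add (hbd.x.pow 2))).add
        ((hbd.b.pow 2).mul ((BD.pow ?_ 2).add (BD.pow ?_ 2)))).add ((hbd.c.pow 2).mul ((BD.pow ?_ 2).add (BD.pow ?_ 2)))
      · have := (((BD.const (-1/2)).mul hbd.s).sub ((BD.const (√3/2)).mul hbd.x)).sub (BD.const v)
        convert this using 2; ring
      · have := (((BD.const (√3/2)).mul hbd.s).sub ((BD.const (1/2)).mul hbd.x))
        convert this using 2; ring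
      · have := (((BD.const (-1/2)).mul hbd.s).add ((BD.const (√3/2)).mul hbd.x)).sub (BD.const v)
        convert this using 2; ring
      · have := (((BD.const (-(√3/2))).mul hbd.s).sub ((BD.const (1/2)).mul hbd.x))
        convert this using 2; ring
    have hbar := barbalatBD (T := T5) hM (fun τ hτ => dG τ (hτ.trans j1))
      (h := fun τ => c0 * δ * hdis v (s τ) (x τ) (a τ) (b τ) (c τ))
      (fun τ hτ => by
        refine le_trans ?_ (dG' τ (hτ.trans j1))
        have := hdis_nonneg v (s τ) (x τ) (a τ) (b τ) (c τ)
        have := hYlow τ hτ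
        gcongr) hdBD
    have th : Tendsto (fun τ => hdis v (s τ) (x τ) (a τ) (b τ) (c τ)) atBot (𝓝 0) := by
      rw [Metric.tendsto_nhds]
      intro ε hε
      filter_upwards [hbar (c0*δ*ε) (by positivity)] with τ hτ
      rw [Real.dist_eq, sub_zero, abs_of_nonneg (hdis_nonneg _ _ _ _ _ _)]
      exact lt_of_mul_lt_mul_left hτ (by positivity)
    have := h.selP (T' := T5) (c0 := M/(2*Φ*Real.exp (bet v))) (j1.trans hT1) (by positivity) (fun τ hτ => by
      have h1 := hT3 τ (hτ.trans j3)
      have h3 := (hF τ (hτ.trans j1)).2.2.2.1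
      have h4 := hYm τ (hτ.trans j2)
      rw [div_le_iff₀ (by positivity)]
      have h6 := mul_le_mul_of_nonneg_right h4 (by positivity : 0 ≤ Φ * ((a τ)^2 + (b τ)^2 + (c τ)^2))
      simp only [hYdef] at *
      linarith) tV th
    rcases this with h | h | h
    · exact Or.inl h
    · exact Or.inr (Or.inl h)
    · exact Or.inr (Or.inr (Or.inl h))

/-! ### Step 5: the vacuum-like regime -/

lemma main5 {v O W k u A : ℝ} (hv0 : 0 < v) (hv1 : v < 1/2) (hO0 : 0 ≤ O) (hO2 : 27*O^2 ≤ 2*v*O)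
    (hWk : W = 2*k + (2 - 4*v)*O) (hku : k ≤ 2*u - u^2) (hk1 : -(3/2*A) ≤ k) (hk : -(1/16) ≤ k)
    (hA : 0 < A) : W^2/24 + O*W ≤ 3/2*u^2 + 2*v*O + 1/16*A := by
  have hW2 : W^2 ≤ 8*k^2 + 8*O^2 := by
    rw [hWk]
    have i1 : (2 - 4*v)^2 * O^2 ≤ 4*O^2 := by
      have : (2 - 4*v)^2 ≤ 4 := by nlinarith
      exact mul_le_mul_of_nonneg_right this (sq_nonneg O)
    have i2 := sq_nonneg (2*k - (2 - 4*v)*O)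
    linarith
  have hOW : O*W ≤ 2*k*O + 2*O^2 := by
    rw [hWk]
    have := mul_nonneg hv0.le (sq_nonneg O)
    linarith
  have hO3 := sq_nonneg O
  have hu2 := sq_nonneg u
  rcases le_total 0 k with h0 | h0
  · have h2u : k ≤ 2*u := by linarith
    have hk2 : k^2 ≤ 4*u^2 := by
      have := pow_le_pow_left₀ h0 h2u 2
      linarith
    have hkO := mul_le_mul_of_nonneg_right h2u hO0
    have := sq_nonneg (u - 12*O)
    linarith
  · have hk2 : k^2 ≤ 1/16*(3/2*A) := by
      have := mul_nonneg (sub_nonneg.2 hk1) (sub_nonneg.2 h0)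
      have := mul_nonneg (sub_nonneg.2 hk) hA.le
      have i3 : (-k)*(-k) ≤ (1/16)*(3/2*A) :=
        mul_le_mul (by linarith) (by linarith) (by linarith) (by norm_num)
      linarith
    have hkO := mul_nonneg (sub_nonneg.2 h0) hO0
    linarith

lemma rate5 {v O s x a S D2 z ρ : ℝ} (hv0 : 0 < v) (hv1 : v < 1/2) (hO0 : 0 ≤ O) (hO1 : O ≤ 2*v/27)
    (ha : 0 < a) (hS : 0 < S) (hD : 0 ≤ D2) (hz : z = ρ * x) (hρ : ρ^2 ≤ 1)
    (hcon : O + s^2 + x^2 + 3/4 * (D2 + a^2 - 2*a*S) = 1)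
    (hk : -(1/16) ≤ 3/4 * (D2 + a^2 - 2*a*S)) :
    1/2 * (1 + s)^2 + 2*v*O + 3/2 * a * (S - a) - 1/16 * (a * S) ≤
    2 * (qv v O s x + 2*s)
      - (2 * √3 * x^2 * (1 - ρ^2) - (2 - qv v O s x) * z - 3 * √3 / 2 * D2
        + 3 * √3 / 2 * ρ^2 * S * a) * √3/3 + (2 * qv v O s x - 8*v) * O/2 := by
  have hr := r3
  set k := 3/4 * (D2 + a^2 - 2*a*S) with hkd
  set W := 2 - qv v O s x with hW
  have hWk : W = 2*k + (2 - 4*v)*O := by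
    rw [hW, hkd]; unfold qv; linear_combination (-2)*hcon
  have haS : 0 < a*S := mul_pos ha hS
  have e : 2 * (qv v O s x + 2*s)
      - (2 * √3 * x^2 * (1 - ρ^2) - W * z - 3 * √3 / 2 * D2
        + 3 * √3 / 2 * ρ^2 * S * a) * √3/3 + (2 * qv v O s x - 8*v) * O/2
      = 2*(1 + s)^2 + 2*z^2 + W*z*√3/3 + O*(4*v - W) + 3/2*a*(2*S - a) - 3/2*ρ^2*(S*a) := by
    rw [hW, hz]; unfold qv
    linear_combination (-(2/3)*x^2*(1 - ρ^2) + 1/2*D2 - 1/2*ρ^2*S*a) * hr + 2*hcon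
  rw [e]
  have t1 : -(W^2/24) ≤ 2*z^2 + W*z*√3/3 := by
    have : 2*z^2 + W*z*√3/3 + W^2/24 = 2*(z + W*√3/12)^2 := by
      linear_combination (-(W^2/72)) * hr
    nlinarith [sq_nonneg (z + W*√3/12)]
  have t2 := mul_le_mul_of_nonneg_right hρ (by linarith : 0 ≤ 3/2*(a*S))
  -- main estimate
  have hO2 : 27*O^2 ≤ 2*v*O := by
    have := mul_le_mul_of_nonneg_right hO1 hO0
    linarith
  have hku : k ≤ 2*(1 + s) - (1 + s)^2 := by linarith [sq_nonneg x]
  have hk1 : -(3/2*(a*S)) ≤ k := by rw [hkd]; linarith [sq_nonneg a]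
  have main := main5 hv0 hv1 hO0 hO2 hWk hku hk1 hk haS
  linarith

def ZZ (O x b c : ℝ) : ℝ := Real.exp (-((b - c)/(b + c) * x) * √3/3 + O/2) * (b*c)

lemma ZZ_bd {O s x b c : ℝ} (hb : 0 < b) (hc : 0 < c) (hO0 : 0 ≤ O) (hO1 : O ≤ 1/27)
    (hx : x^2 ≤ 103/100) : 1/2*(b*c) ≤ ZZ O x b c ∧ ZZ O x b c ≤ 2*(b*c) ∧
    1/2 ≤ Real.exp (-((b - c)/(b + c) * x) * √3/3 + O/2) ∧
    Real.exp (-((b - c)/(b + c) * x) * √3/3 + O/2) ≤ 2 := by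
  have hρ := rho_sq hb hc
  set z := (b - c)/(b + c) * x with hz
  have hz2 : (z*√3/3)^2 ≤ (6/10)^2 := by
    have : (z*√3/3)^2 = ((b - c)/(b + c))^2 * x^2 / 3 := by
      rw [hz]; linear_combination (((b - c)/(b + c))^2 * x^2/9) * r3
    rw [this]
    nlinarith [sq_nonneg x, sq_nonneg ((b - c)/(b + c))]
  have hz3 := abs_le.1 (abs_le_of_sq_le_sq hz2 (by norm_num))
  have l2 := Real.log_two_gt_d9
  have k1 : 1/2 ≤ Real.exp (-z * √3/3 + O/2) := by
    have : (1/2:ℝ) = Real.exp (-Real.log 2) := by rw [Real.exp_neg, Real.exp_log (by norm_num)]; norm_num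
    rw [this, Real.exp_le_exp]
    linarith [hz3.1, hz3.2]
  have k2 : Real.exp (-z * √3/3 + O/2) ≤ 2 := by
    exact (Real.exp_le_exp.2 (by linarith [hz3.1, hz3.2])).trans_eq
      (Real.exp_log (by norm_num : (0:ℝ) < 2))
  have hbc := mul_pos hb hc
  refine ⟨?_, ?_, k1, k2⟩
  · unfold ZZ; gcongr
  · unfold ZZ; gcongr

lemma BS.dZ (h : BS v T O s x a b c) {τ : ℝ} (hτ : τ ≤ T) (hO1 : O τ ≤ 2*v/27)
    (pk : Pk (1/400) (O τ) (s τ) (x τ) (a τ) (b τ) (c τ)) :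
    ∃ L, HasDerivAt (fun τ => ZZ (O τ) (x τ) (b τ) (c τ)) (L * ZZ (O τ) (x τ) (b τ) (c τ)) τ ∧
      1/2 * (1 + s τ)^2 + 2*v*O τ + 3/2 * a τ * ((b τ + c τ) - a τ) - 1/16 * (a τ * (b τ + c τ)) ≤ L := by
  have hb := h.b0 τ hτ
  have hc := h.c0 τ hτ
  have hcon := h.con τ hτ
  have hkl := pk.kl
  have key := rate5 (O := O τ) (s := s τ) (x := x τ) (a := a τ) (S := b τ + c τ)
    (D2 := (b τ - c τ)^2) (ρ := (b τ - c τ)/(b τ + c τ)) (z := (b τ - c τ)/(b τ + c τ) * x τ)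
    h.v0 h.v1 (h.O0 τ hτ) hO1 (h.a0 τ hτ) (by positivity) (sq_nonneg _) rfl (rho_sq hb hc)
    (by linear_combination hcon) (by linarith)
  refine ⟨_, ?_, key⟩
  have d1 := ((((h.dz τ hτ).neg.mul_const (√3)).div_const 3).add ((h.dO τ hτ).div_const 2)).exp
  refine (d1.mul ((h.db τ hτ).mul (h.dc τ hτ))).congr_deriv ?_
  simp only [ZZ, Pi.mul_apply, Pi.add_apply, Pi.sub_apply, Pi.neg_apply]
  ring

lemma sum5 {P : ℝ} : ∀ a b c : ℝ, 0 < a → 0 < b → 0 < c →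
    3/4 * (a^2 + b^2 + c^2 - 2 * (a*b + b*c + c*a)) ≤ 1 → a*b*c ≤ (1/400)^4/4 →
    ∀ E1 E2 E3 : ℝ, 1/2 ≤ E1 → E1 ≤ 2 → 1/2 ≤ E2 → E2 ≤ 2 → 1/2 ≤ E3 → E3 ≤ 2 →
    -4 ≤ E1*(3/2*((b + c) - a) - 1/16*(b + c)) + E2*(3/2*((c + a) - b) - 1/16*(c + a))
      + E3*(3/2*((a + b) - c) - 1/16*(a + b)) := by
  apply ord_wlog
  · intro a b c h ha hb hc hk hP E1 E2 E3 h1 h2 h3 h4 h5 h6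
    have := h hc ha hb (by linarith) (by linarith) E3 E1 E2 h5 h6 h1 h2 h3 h4
    linarith
  · intro a b c h ha hb hc hk hP E1 E2 E3 h1 h2 h3 h4 h5 h6
    have := h hb ha hc (by linarith) (by linarith) E2 E1 E3 h3 h4 h1 h2 h5 h6
    linarith
  · intro a b c hab hbc ha hb hc hk hP E1 E2 E3 h1 h2 h3 h4 h5 h6
    have hac : a*c ≤ 1/400 := t_small (ε := 1/400) hab hbc hc hk (by norm_num) (by norm_num) (by norm_num at hP ⊢; linarith)
    have hd : (a - b)^2 ≤ (12/10)^2 := by nlinarith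
    have hd2 := abs_le_of_sq_le_sq' hd (by norm_num)
    have p3 := mul_le_mul_of_nonneg_right h5 (by linarith : 0 ≤ 23/16*(a + b) - 3/2*c)
    have p2 := mul_le_mul_of_nonneg_right h3 (by linarith : 0 ≤ (c + a) - b)
    have p2' := mul_le_mul_of_nonneg_right h4 (by linarith : 0 ≤ c + a)
    have p1 := mul_nonneg (by linarith : 0 ≤ E1) (by linarith : 0 ≤ b + c - a + (a - b))
    have p1a := mul_le_mul_of_nonneg_right h2 (by linarith : 0 ≤ a - b)
    have p1' := mul_le_mul_of_nonneg_right h2 (by linarith : 0 ≤ b + c)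
    linarith

lemma wf_sum {a b c P w q L1 L2 L3 E1 E2 E3 u1 u2 u3 X1 X2 X3 : ℝ}
    (ha : 0 < a) (hb : 0 < b) (hc : 0 < c) (hP : P = a*b*c) (hw : 0 ≤ w) (hq : 0 ≤ q)
    (e1 : 1/2 ≤ E1) (e2 : 1/2 ≤ E2) (e3 : 1/2 ≤ E3)
    (l1 : 1/2*u1^2 + w + a*X1 ≤ L1) (l2 : 1/2*u2^2 + w + b*X2 ≤ L2) (l3 : 1/2*u3^2 + w + c*X3 ≤ L3)
    (hX : -4 ≤ E1*X1 + E2*X2 + E3*X3)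
    (hPV : P ≤ 1/400*(a*b + b*c + c*a))
    (hu : q < 1 → 8/100 ≤ u1^2 ∧ 8/100 ≤ u2^2 ∧ 8/100 ≤ u3^2) :
    1/2*(b*c*(1/4*u1^2 + w) + c*a*(1/4*u2^2 + w) + a*b*(1/4*u3^2 + w)) ≤
      L1*(E1*(b*c)) + L2*(E2*(c*a)) + L3*(E3*(a*b)) + 6*q*P := by
  have hbc := mul_pos hb hc
  have hca := mul_pos hc ha
  have hab := mul_pos ha hb
  have hP0 : 0 < P := by rw [hP]; positivity
  have m1 := mul_le_mul_of_nonneg_right l1 (by positivity : 0 ≤ E1*(b*c))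
  have m2 := mul_le_mul_of_nonneg_right l2 (by positivity : 0 ≤ E2*(c*a))
  have m3 := mul_le_mul_of_nonneg_right l3 (by positivity : 0 ≤ E3*(a*b))
  have n1 := mul_le_mul_of_nonneg_right e1 (by positivity : 0 ≤ b*c*(1/2*u1^2 + w))
  have n2 := mul_le_mul_of_nonneg_right e2 (by positivity : 0 ≤ c*a*(1/2*u2^2 + w))
  have n3 := mul_le_mul_of_nonneg_right e3 (by positivity : 0 ≤ a*b*(1/2*u3^2 + w))
  have hX' := mul_le_mul_of_nonneg_right hX hP0.le
  have k : 4*P ≤ 1/8*(b*c*u1^2 + c*a*u2^2 + a*b*u3^2) + 6*q*P := by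
    rcases lt_or_ge q 1 with h | h
    · obtain ⟨h1, h2, h3⟩ := hu h
      have i1 := mul_le_mul_of_nonneg_left h1 hbc.le
      have i2 := mul_le_mul_of_nonneg_left h2 hca.le
      have i3 := mul_le_mul_of_nonneg_left h3 hab.le
      have := mul_nonneg hq hP0.le
      linarith
    · have := mul_le_mul_of_nonneg_right h hP0.le
      have : 0 ≤ b*c*u1^2 + c*a*u2^2 + a*b*u3^2 := by positivity
      linarith
  have hX'' : (E1*X1 + E2*X2 + E3*X3)*P = E1*(b*c)*(a*X1) + E2*(c*a)*(b*X2) + E3*(a*b)*(c*X3) := by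
    rw [hP]; ring
  linarith

lemma u_low {s : ℝ} (h : s^2 ≤ 1/2) : 8/100 ≤ (1 + s)^2 := by
  have : -(708/1000) ≤ s := by
    by_contra hh
    push Not at hh
    nlinarith
  nlinarith

/-- the monotone function of step 5 -/
def Wf (O s x a b c : ℝ) : ℝ :=
  ZZ O x b c + ZZ O (√3/2 * s - x/2) c a + ZZ O (-(√3/2) * s - x/2) a b + 2*(a*b*c)

def h5 (v O s x a b c : ℝ) : ℝ :=
  1/2*(b*c*(1/4*(1 + s)^2 + 2*v*O) + c*a*(1/4*(1 + (-s/2 - √3/2 * x))^2 + 2*v*O)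
    + a*b*(1/4*(1 + (-s/2 + √3/2 * x))^2 + 2*v*O))

lemma x_le {v T : ℝ} {O s x a b c : ℝ → ℝ} (h : BS v T O s x a b c) {τ : ℝ} (hτ : τ ≤ T)
    (pk : Pk (1/400) (O τ) (s τ) (x τ) (a τ) (b τ) (c τ)) : (x τ)^2 ≤ 103/100 := by
  have := pk.sb
  linarith [h.O0 τ hτ, sq_nonneg (s τ)]

lemma BS.dWf (h : BS v T O s x a b c) {τ : ℝ} (hτ : τ ≤ T) (hO1 : O τ ≤ 2*v/27)
    (pk : Pk (1/400) (O τ) (s τ) (x τ) (a τ) (b τ) (c τ)) :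
    ∃ W', HasDerivAt (fun τ => Wf (O τ) (s τ) (x τ) (a τ) (b τ) (c τ)) W' τ ∧
      h5 v (O τ) (s τ) (x τ) (a τ) (b τ) (c τ) ≤ W' := by
  have hv := h.v1
  have hO0 := h.O0 τ hτ
  have ha := h.a0 τ hτ
  have hb := h.b0 τ hτ
  have hc := h.c0 τ hτ
  obtain ⟨L1, d1, l1⟩ := h.dZ hτ hO1 pk
  obtain ⟨L2, d2, l2⟩ := h.rot.dZ hτ hO1 pk.rot
  obtain ⟨L3, d3, l3⟩ := h.rot2.dZ hτ hO1 pk.rot2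
  obtain ⟨_, _, E1, F1⟩ := ZZ_bd (s := s τ) hb hc hO0 (by linarith) (x_le h hτ pk)
  obtain ⟨_, _, E2, F2⟩ := ZZ_bd (s := s τ) hc ha hO0 (by linarith) (x_le h.rot hτ pk.rot)
  obtain ⟨_, _, E3, F3⟩ := ZZ_bd (s := s τ) ha hb hO0 (by linarith) (x_le h.rot2 hτ pk.rot2)
  have dP := (h.dP τ hτ).const_mul 2
  refine ⟨_, ((d1.add d2).add d3).add dP, ?_⟩
  have hX := sum5 (P := 0) (a τ) (b τ) (c τ) ha hb hc
    (by have := h.con τ hτ; linarith [sq_nonneg (s τ), sq_nonneg (x τ)]) pk.P4 _ _ _ E1 F1 E2 F2 E3 F3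
  have key := wf_sum (q := qv v (O τ) (s τ) (x τ)) (w := 2*v*O τ) (P := a τ * b τ * c τ)
    (L1 := L1) (L2 := L2) (L3 := L3)
    (u1 := 1 + s τ) (u2 := 1 + (-s τ/2 - √3/2 * x τ)) (u3 := 1 + (-s τ/2 + √3/2 * x τ))
    ha hb hc rfl (by have := h.v0; positivity) (h.q0 τ hτ) E1 E2 E3 (by linarith) (by linarith)
    (by linarith) hX pk.PV (by
      intro hq
      have : (s τ)^2 + (x τ)^2 ≤ 1/2 := by
        have := mul_nonneg h.v0.le hO0
        unfold qv at hq; linarith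
      exact ⟨u_low (by linarith [sq_nonneg (x τ)]), u_low ((s2_sq _ _).trans this),
        u_low ((s3_sq _ _).trans this)⟩)
  refine (show h5 v (O τ) (s τ) (x τ) (a τ) (b τ) (c τ) ≤ _ from key).trans (le_of_eq ?_)
  simp only [ZZ]
  ring

lemma h5_nonneg {v O s x a b c : ℝ} (hv : 0 < v) (hO : 0 ≤ O) (ha : 0 < a) (hb : 0 < b) (hc : 0 < c) :
    0 ≤ h5 v O s x a b c := by unfold h5; positivity

lemma BS.Wf_bd (h : BS v T O s x a b c) {τ : ℝ} (hτ : τ ≤ T) (hO1 : O τ ≤ 2*v/27)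
    (pk : Pk (1/400) (O τ) (s τ) (x τ) (a τ) (b τ) (c τ)) :
    1/2*(a τ * b τ + b τ * c τ + c τ * a τ) ≤ Wf (O τ) (s τ) (x τ) (a τ) (b τ) (c τ) ∧
    Wf (O τ) (s τ) (x τ) (a τ) (b τ) (c τ) ≤ 3*(a τ * b τ + b τ * c τ + c τ * a τ) := by
  have hv := h.v1
  have hO0 := h.O0 τ hτ
  have ha := h.a0 τ hτ
  have hb := h.b0 τ hτ
  have hc := h.c0 τ hτ
  obtain ⟨E1, F1, _⟩ := ZZ_bd (s := s τ) hb hc hO0 (by linarith) (x_le h hτ pk)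
  obtain ⟨E2, F2, _⟩ := ZZ_bd (s := s τ) hc ha hO0 (by linarith) (x_le h.rot hτ pk.rot)
  obtain ⟨E3, F3, _⟩ := ZZ_bd (s := s τ) ha hb hO0 (by linarith) (x_le h.rot2 hτ pk.rot2)
  have := h.P0 τ hτ
  have := pk.PV
  have := mul_pos ha hb
  have := mul_pos hb hc
  have := mul_pos hc ha
  unfold Wf
  constructor <;> linarith

lemma BS.step5a (h : BS v T O s x a b c) (hO : Tendsto O atBot (𝓝 0)) :
    ∃ T' ≤ T, ∃ L, 0 ≤ L ∧ ∃ W W' : ℝ → ℝ, (∀ τ ≤ T', HasDerivAt W (W' τ) τ) ∧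
      (∀ τ ≤ T', h5 v (O τ) (s τ) (x τ) (a τ) (b τ) (c τ) ≤ W' τ) ∧ Tendsto W atBot (𝓝 L) ∧
      (∀ τ ≤ T', L ≤ W τ) ∧
      (∀ τ ≤ T', 1/2*(a τ * b τ + b τ * c τ + c τ * a τ) ≤ W τ ∧
        W τ ≤ 3*(a τ * b τ + b τ * c τ + c τ * a τ)) := by
  obtain ⟨T1, hT1, hpk⟩ := h.pack (ε := 1/400) (by norm_num) (by norm_num)
  have hv := h.v0
  obtain ⟨T2, hT2⟩ := ev_Iic (hO.eventually (ge_mem_nhds (show (0:ℝ) < 2*v/27 by positivity)))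
  have hm1 : ∀ {τ}, τ ≤ min T1 T2 → τ ≤ T1 := fun hτ => hτ.trans (min_le_left _ _)
  have hm2 : ∀ {τ}, τ ≤ min T1 T2 → τ ≤ T2 := fun hτ => hτ.trans (min_le_right _ _)
  have hm0 : ∀ {τ}, τ ≤ min T1 T2 → τ ≤ T := fun hτ => (hm1 hτ).trans hT1
  have key : ∀ τ, ∃ W', τ ≤ min T1 T2 →
      HasDerivAt (fun τ => Wf (O τ) (s τ) (x τ) (a τ) (b τ) (c τ)) W' τ ∧
      h5 v (O τ) (s τ) (x τ) (a τ) (b τ) (c τ) ≤ W' := by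
    intro τ
    by_cases hτ : τ ≤ min T1 T2
    · obtain ⟨W', h1⟩ := h.dWf (hm0 hτ) (hT2 _ (hm2 hτ)) (hpk _ (hm1 hτ))
      exact ⟨W', fun _ => h1⟩
    · exact ⟨0, fun h => absurd h hτ⟩
  choose W' hW' using key
  have hbd := fun τ (hτ : τ ≤ min T1 T2) => h.Wf_bd (hm0 hτ) (hT2 _ (hm2 hτ)) (hpk _ (hm1 hτ))
  have hmono := mono_Iic (fun τ hτ => (hW' τ hτ).1) (fun τ hτ => (h5_nonneg hv (h.O0 τ (hm0 hτ))
    (h.a0 τ (hm0 hτ)) (h.b0 τ (hm0 hτ)) (h.c0 τ (hm0 hτ))).trans (hW' τ hτ).2)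
  obtain ⟨L, hL0, hL, hLW⟩ := mono_lim (m := 0) hmono (fun τ hτ => by
    have := (hbd τ hτ).1
    have ha := h.a0 τ (hm0 hτ)
    have hb := h.b0 τ (hm0 hτ)
    have hc := h.c0 τ (hm0 hτ)
    have : 0 ≤ a τ * b τ + b τ * c τ + c τ * a τ := by positivity
    linarith)
  exact ⟨min T1 T2, (min_le_left _ _).trans hT1, L, hL0, _, W', fun τ hτ => (hW' τ hτ).1,
    fun τ hτ => (hW' τ hτ).2, hL, hLW, hbd⟩

lemma r2_ineq {v O s x a S D : ℝ} (hv0 : 0 < v) (hv1 : v < 1/2) (hO : 0 ≤ O) (ha : 0 < a) (hS : 0 < S)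
    (hcon : O + s^2 + x^2 + 3/4 * (D^2 + a^2 - 2*a*S) = 1) :
    -2*(2 - qv v O s x)*x^2 + 3/2*(qv v O s x + 2*s)*D^2 + 3*√3*a*x*D ≤
      (2*(1 + s)^2 + 6*a*S + 2*O + 3*a)*(x^2 + 3/4*D^2) := by
  have haS := mul_pos ha hS
  have e1 : 2 - qv v O s x = 3/2*(D^2 + a^2 - 2*a*S) + (2 - 4*v)*O := by
    unfold qv; linear_combination (-2)*hcon
  have e2 : qv v O s x + 2*s = (1 + s)^2 + x^2 - 3/4*(D^2 + a^2 - 2*a*S) + (4*v - 1)*O := by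
    unfold qv; linear_combination hcon
  rw [e1, e2]
  have k1 : 3*√3*a*x*D ≤ 3*a*(x^2 + 3/4*D^2) := by
    have e : 3*a*(x^2 + 3/4*D^2) - 3*√3*a*x*D = 3*a*(x - √3/2*D)^2 := by
      linear_combination (-(3/4)*a*D^2)*r3
    have : 0 ≤ 3*a*(x - √3/2*D)^2 := by positivity
    linarith
  have x2 := sq_nonneg x
  have d2 := sq_nonneg D
  have a2 := sq_nonneg a
  have p1 := mul_nonneg a2 x2
  have p2 := mul_nonneg a2 d2
  have p3 := mul_nonneg d2 x2
  have p4 := mul_nonneg d2 d2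
  have p5 := mul_nonneg haS.le d2
  have p6 := mul_nonneg (mul_nonneg (by linarith : 0 ≤ 2 - 4*v) hO) x2
  have p7 := mul_nonneg (mul_nonneg (by linarith : 0 ≤ 2 - 4*v) hO) d2
  have p8 := mul_nonneg hO x2
  have p9 := mul_nonneg hO d2
  have p10 := mul_nonneg (sq_nonneg (1 + s)) x2
  linarith

lemma BS.dr2 (h : BS v T O s x a b c) (τ : ℝ) (hτ : τ ≤ T) :
    HasDerivAt (fun τ => (x τ)^2 + 3/4*(b τ - c τ)^2)
      (-2*(2 - qv v (O τ) (s τ) (x τ))*(x τ)^2 + 3/2*(qv v (O τ) (s τ) (x τ) + 2*s τ)*(b τ - c τ)^2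
        + 3*√3*a τ*x τ*(b τ - c τ)) τ := by
  refine (((h.dx τ hτ).pow 2).add ((((h.db τ hτ).sub (h.dc τ hτ)).pow 2).const_mul (3/4))).congr_deriv ?_
  simp only [Pi.sub_apply]
  norm_num
  ring

lemma BS.r2le (h : BS v T O s x a b c) (τ : ℝ) (hτ : τ ≤ T) :
    -2*(2 - qv v (O τ) (s τ) (x τ))*(x τ)^2 + 3/2*(qv v (O τ) (s τ) (x τ) + 2*s τ)*(b τ - c τ)^2
        + 3*√3*a τ*x τ*(b τ - c τ) ≤
      (2*(1 + s τ)^2 + 6*a τ*(b τ + c τ) + 2*O τ + 3*a τ)*((x τ)^2 + 3/4*(b τ - c τ)^2) :=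
  r2_ineq h.v0 h.v1 (h.O0 τ hτ) (h.a0 τ hτ) (by linarith [h.b0 τ hτ, h.c0 τ hτ])
    (by linear_combination h.con τ hτ)

/-- vanishing propagates forward -/
lemma BS.r2_fwd (h : BS v T O s x a b c) {T' : ℝ} (hT' : T' ≤ T)
    (h0 : (x T')^2 + 3/4*(b T' - c T')^2 = 0) (τ : ℝ) (h1 : T' ≤ τ) (h2 : τ ≤ T) :
    (x τ)^2 + 3/4*(b τ - c τ)^2 = 0 := by
  have hcont : ContinuousOn (fun τ => 2*(1 + s τ)^2 + 6*a τ*(b τ + c τ) + 2*O τ + 3*a τ) (Icc T' T) := by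
    intro t ht
    have c1 := (h.ds t ht.2).continuousAt
    have c2 := (h.da t ht.2).continuousAt
    have c3 := (h.db t ht.2).continuousAt
    have c4 := (h.dc t ht.2).continuousAt
    have c5 := (h.dO t ht.2).continuousAt
    apply ContinuousAt.continuousWithinAt
    fun_prop
  obtain ⟨M, hM⟩ := isCompact_Icc.exists_bound_of_continuousOn hcont
  have hd : ∀ t ∈ Icc T' T, HasDerivAt (fun t => ((x t)^2 + 3/4*(b t - c t)^2) * Real.exp (-M*t))
      ((-2*(2 - qv v (O t) (s t) (x t))*(x t)^2 + 3/2*(qv v (O t) (s t) (x t) + 2*s t)*(b t - c t)^2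
        + 3*√3*a t*x t*(b t - c t) - M*((x t)^2 + 3/4*(b t - c t)^2)) * Real.exp (-M*t)) t := by
    intro t ht
    refine ((h.dr2 t ht.2).mul (((hasDerivAt_id t).const_mul (-M)).exp)).congr_deriv ?_
    simp only [id]
    ring
  have anti : AntitoneOn (fun t => ((x t)^2 + 3/4*(b t - c t)^2) * Real.exp (-M*t)) (Icc T' T) := by
    apply antitoneOn_of_deriv_nonpos (convex_Icc _ _)
    · intro t ht; exact (hd t ht).continuousAt.continuousWithinAt
    · intro t ht; exact (hd t (interior_subset ht)).differentiableAt.differentiableWithinAt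
    · intro t ht
      have ht := interior_subset ht
      rw [(hd t ht).deriv]
      have h1 := h.r2le t ht.2
      have h2 := (le_abs_self _).trans (hM t ht)
      have h3 : 0 ≤ (x t)^2 + 3/4*(b t - c t)^2 := by positivity
      have h4 := mul_le_mul_of_nonneg_right h2 h3
      exact mul_nonpos_of_nonpos_of_nonneg (by linarith) (Real.exp_pos _).le
  have := anti (left_mem_Icc.2 hT') ⟨h1, h2⟩ h1
  simp only [h0, zero_mul] at this
  have h3 : 0 ≤ (x τ)^2 + 3/4*(b τ - c τ)^2 := by positivity
  nlinarith [Real.exp_pos (-M*τ)]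

lemma BS.taub (h : BS v T O s x a b c) {T' d c1 B : ℝ} (hT' : T' ≤ T) (hd : 0 < d) (hc1 : 0 < c1)
    (hbc : ∀ τ ≤ T', d ≤ b τ * c τ) (hB : ∀ τ ≤ T', b τ + c τ ≤ B) {W W' : ℝ → ℝ}
    (hW : ∀ τ ≤ T', HasDerivAt W (W' τ) τ) (hW0 : ∀ τ ≤ T', 0 ≤ W τ)
    (hW' : ∀ τ ≤ T', c1*((1 + s τ)^2 + O τ) ≤ W' τ) (hs : Tendsto s atBot (𝓝 (-1))) :
    ∀ τ ≤ T, x τ = 0 ∧ b τ = c τ := by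
  have hB0 : 0 < B := by linarith [h.b0 T' hT', h.c0 T' hT', hB T' le_rfl]
  have hat : Tendsto a atBot (𝓝 0) := by
    have := h.P_tendsto.mul_const (1/d)
    rw [zero_mul] at this
    refine tend_zero_of_le this (T' := T') (fun τ hτ => (h.a0 τ (hτ.trans hT')).le) (fun τ hτ => ?_)
    rw [mul_one_div, le_div_iff₀ hd]
    have := mul_le_mul_of_nonneg_left (hbc τ hτ) (h.a0 τ (hτ.trans hT')).le
    linarith
  have hr2 : Tendsto (fun τ => (x τ)^2 + 3/4*(b τ - c τ)^2) atBot (𝓝 0) := by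
    have : Tendsto (fun τ => 1 - (s τ)^2 + 3/2*B*a τ) atBot (𝓝 0) := by
      have := (((hs.pow 2).const_sub 1).add (hat.const_mul (3/2*B)))
      convert this using 2
      norm_num
    refine tend_zero_of_le this (T' := T') (fun τ hτ => by positivity) (fun τ hτ => ?_)
    have h1 := h.con τ (hτ.trans hT')
    have h2 := h.O0 τ (hτ.trans hT')
    have h3 := mul_le_mul_of_nonneg_right (hB τ hτ) (h.a0 τ (hτ.trans hT')).le
    linarith [sq_nonneg (a τ)]
  obtain ⟨T2, hT2⟩ := ev_Iic (hs.eventually (ge_mem_nhds (show (-1:ℝ) < -(1/2) by norm_num)))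
  set T3 := min T' T2 with hT3
  have m1 : ∀ {τ}, τ ≤ T3 → τ ≤ T' := fun hτ => hτ.trans (min_le_left _ _)
  have m2 : ∀ {τ}, τ ≤ T3 → τ ≤ T2 := fun hτ => hτ.trans (min_le_right _ _)
  have m0 : ∀ {τ}, τ ≤ T3 → τ ≤ T := fun hτ => (m1 hτ).trans hT'
  set C := 6*B + 3 with hC
  have hJ := anti_Iic (T := T3)
    (f := fun τ => ((x τ)^2 + 3/4*(b τ - c τ)^2) * Real.exp (-C*(W τ/c1 + a τ)))
    (fun τ hτ => (h.dr2 τ (m0 hτ)).mul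
      ((((hW τ (m1 hτ)).div_const c1).add (h.da τ (m0 hτ))).const_mul (-C)).exp)
    (fun τ hτ => by
      have h1 := h.r2le τ (m0 hτ)
      have ha := h.a0 τ (m0 hτ)
      have hO := h.O0 τ (m0 hτ)
      have h2 : (1 + s τ)^2 + O τ ≤ W' τ / c1 := by
        rw [le_div_iff₀ hc1]; linarith [hW' τ (m1 hτ)]
      have h3 : a τ ≤ (qv v (O τ) (s τ) (x τ) - 4 * s τ) * a τ := by
        have := mul_le_mul_of_nonneg_right (show 1 ≤ qv v (O τ) (s τ) (x τ) - 4 * s τ by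
          linarith [h.q0 τ (m0 hτ), hT2 τ (m2 hτ)]) ha.le
        linarith
      have h4 : 0 ≤ (x τ)^2 + 3/4*(b τ - c τ)^2 := by positivity
      have h5 : 2*(1 + s τ)^2 + 6*a τ*(b τ + c τ) + 2*O τ + 3*a τ ≤
          C*(W' τ/c1 + (qv v (O τ) (s τ) (x τ) - 4 * s τ) * a τ) := by
        have i1 := mul_le_mul_of_nonneg_left (add_le_add h2 h3) (show 0 ≤ C by linarith)
        have i2 := mul_le_mul_of_nonneg_right (hB τ (m1 hτ)) ha.le
        have i3 : 0 ≤ B*((1 + s τ)^2 + O τ) := by positivity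
        have i4 := sq_nonneg (1 + s τ)
        rw [hC] at i1 ⊢
        linarith
      have h6 := mul_le_mul_of_nonneg_right h5 h4
      have h7 := mul_le_mul_of_nonneg_right (h1.trans h6)
        (Real.exp_pos (-C*(W τ/c1 + a τ))).le
      simp only [Pi.add_apply]
      linarith)
  have z : ∀ τ ≤ T3, (x τ)^2 + 3/4*(b τ - c τ)^2 = 0 := by
    intro τ hτ
    have h4 : 0 ≤ (x τ)^2 + 3/4*(b τ - c τ)^2 := by positivity
    have : ((x τ)^2 + 3/4*(b τ - c τ)^2) * Real.exp (-C*(W τ/c1 + a τ)) ≤ 0 := by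
      refine ge_of_tendsto hr2 ?_
      filter_upwards [eventually_le_atBot τ] with t ht
      have h1 := hJ (ht.trans hτ : t ≤ T3) (hτ : τ ≤ T3) ht
      refine h1.trans ?_
      apply mul_le_of_le_one_right (by positivity)
      rw [Real.exp_le_one_iff]
      have ht3 := ht.trans hτ
      have := h.a0 t (m0 ht3)
      have := hW0 t (m1 ht3)
      have : 0 ≤ C*(W t/c1 + a t) := by positivity
      linarith
    nlinarith [Real.exp_pos (-C*(W τ/c1 + a τ))]
  intro τ hτ
  have hz : (x τ)^2 + 3/4*(b τ - c τ)^2 = 0 := by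
    rcases le_total τ T3 with h1 | h1
    · exact z τ h1
    · exact h.r2_fwd (m0 le_rfl) (z T3 le_rfl) τ h1 hτ
  have h1 : x τ = 0 := by
    apply pow_eq_zero_iff (two_ne_zero) |>.1
    linarith [sq_nonneg (x τ), sq_nonneg (b τ - c τ)]
  have h2 : b τ - c τ = 0 := by
    apply pow_eq_zero_iff (two_ne_zero) |>.1
    linarith [sq_nonneg (x τ), sq_nonneg (b τ - c τ)]
  exact ⟨h1, sub_eq_zero.1 h2⟩

lemma BS.taub' (h : BS v T O s x a b c) {T' d B : ℝ} (hT' : T' ≤ T) (hd : 0 < d)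
    (hbc : ∀ τ ≤ T', d ≤ b τ * c τ) (hB : ∀ τ ≤ T', b τ + c τ ≤ B) {W W' f : ℝ → ℝ}
    (hW : ∀ τ ≤ T', HasDerivAt W (W' τ) τ) (hW0 : ∀ τ ≤ T', 0 ≤ W τ)
    (hf : Tendsto f atBot (𝓝 0))
    (h1 : ∀ τ ≤ T', 1/2*(b τ*c τ*(1/4*(1 + s τ)^2 + 2*v*O τ)) ≤ f τ)
    (h2 : ∀ τ ≤ T', f τ ≤ W' τ) :
    ∀ τ ≤ T, x τ = 0 ∧ b τ = c τ := by
  have hv := h.v0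
  have hv1 := h.v1
  have low : ∀ τ ≤ T', 1/2*(d*(1/4*(1 + s τ)^2 + 2*v*O τ)) ≤ f τ := fun τ hτ => by
    have hO := h.O0 τ (hτ.trans hT')
    have := mul_le_mul_of_nonneg_right (hbc τ hτ) (by positivity : 0 ≤ 1/4*(1 + s τ)^2 + 2*v*O τ)
    linarith [h1 τ hτ]
  refine h.taub (c1 := d*v/4) hT' hd (by positivity) hbc hB hW hW0 (fun τ hτ => ?_) ?_
  · have hO := h.O0 τ (hτ.trans hT')
    have l := low τ hτ
    have i1 : v*(d*(1 + s τ)^2) ≤ 1/2*(d*(1 + s τ)^2) :=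
      mul_le_mul_of_nonneg_right hv1.le (by positivity)
    have i2 : 0 ≤ d*v*O τ := by positivity
    linarith [h2 τ hτ]
  · have hu : Tendsto (fun τ => 1 + s τ) atBot (𝓝 0) := by
      have := hf.const_mul (8/d)
      rw [mul_zero] at this
      refine tend_zero_of_sq this (T' := T') (fun τ hτ => ?_)
      have hO := h.O0 τ (hτ.trans hT')
      have l := low τ hτ
      have i2 : 0 ≤ d*v*O τ := by positivity
      rw [div_mul_eq_mul_div, le_div_iff₀ hd]
      linarith
    have := hu.sub_const 1
    simp only [zero_sub] at this
    refine this.congr (fun τ => by ring)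

lemma u_sep {s x : ℝ} (h : s^2 + x^2 ≤ 1 + 3/400) (hu : (1 + s)^2 ≤ 1/100) :
    1 + s ≤ 1/10 ∧ 1 ≤ 1 + (-s/2 - √3/2*x) ∧ 1 ≤ 1 + (-s/2 + √3/2*x) := by
  have h1 : |1 + s| ≤ 1/10 := abs_le_of_sq_le_sq (by norm_num; linarith) (by norm_num)
  have h2 := abs_le.1 h1
  have hx : (√3/2*x)^2 ≤ (4/10)^2 := by
    have e : (√3/2*x)^2 = 3/4*x^2 := by linear_combination (x^2/4)*r3
    rw [e]
    nlinarith
  have h3 := abs_le.1 (abs_le_of_sq_le_sq hx (by norm_num))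
  exact ⟨h2.2, by linarith [h3.1, h3.2], by linarith [h3.1, h3.2]⟩

lemma sel5 {p v O s x a b c d : ℝ} (hv : 0 < v) (hO : 0 ≤ O) (ha : 0 < a) (hb : 0 < b) (hc : 0 < c)
    (hsx : s^2 + x^2 ≤ 1 + 3/400) (hd : 0 < d) (hV : 3*d ≤ a*b + b*c + c*a)
    (h5s : h5 v O s x a b c ≤ d/800) :
    (d ≤ b*c ∧ 1 + s ≤ 1/10 ∧ 1 ≤ 1 + (-s/2 - √3/2*x) ∧ 1 ≤ 1 + (-s/2 + √3/2*x)) ∨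
    (d ≤ c*a ∧ 1 + (-s/2 - √3/2*x) ≤ 1/10 ∧ 1 ≤ 1 + s ∧ 1 ≤ 1 + (-s/2 + √3/2*x)) ∨
    (d ≤ a*b ∧ 1 + (-s/2 + √3/2*x) ≤ 1/10 ∧ 1 ≤ 1 + s ∧ 1 ≤ 1 + (-s/2 - √3/2*x)) := by
  have n1 : 0 ≤ b*c*(1/4*(1 + s)^2 + 2*v*O) := by positivity
  have n2 : 0 ≤ c*a*(1/4*(1 + (-s/2 - √3/2 * x))^2 + 2*v*O) := by positivity
  have n3 : 0 ≤ a*b*(1/4*(1 + (-s/2 + √3/2 * x))^2 + 2*v*O) := by positivity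
  have aux : ∀ {n u : ℝ}, d ≤ n → n*(1/4*u^2 + 2*v*O) ≤ d/400 → u^2 ≤ 1/100 := by
    intro n u h1 h2
    have hvO : 0 ≤ v*O := by positivity
    have h3 := mul_le_mul_of_nonneg_right h1 (by positivity : 0 ≤ 1/4*u^2 + 2*v*O)
    have h4 : d*u^2 ≤ d*(1/100) := by
      have := mul_nonneg hd.le hvO
      linarith
    exact le_of_mul_le_mul_left h4 hd
  unfold h5 at h5s
  have e2 : (-s/2 - √3/2*x)^2 + (√3/2*s - x/2)^2 = s^2 + x^2 := by
    linear_combination (1/4) * (s^2 + x^2) * r3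
  have e3 : (-s/2 + √3/2*x)^2 + (-(√3/2)*s - x/2)^2 = s^2 + x^2 := by
    linear_combination (1/4) * (s^2 + x^2) * r3
  by_cases c1 : d ≤ b*c
  · left
    exact ⟨c1, u_sep hsx (aux c1 (by linarith))⟩
  by_cases c2 : d ≤ c*a
  · right; left
    obtain ⟨i1, i2, i3⟩ := u_sep (e2.trans_le hsx) (aux c2 (by linarith))
    refine ⟨c2, i1, i3.trans_eq ?_, i2.trans_eq ?_⟩
    · linear_combination (1/4*s)*r3
    · linear_combination (-1/4*s)*r3
  by_cases c3 : d ≤ a*b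
  · right; right
    obtain ⟨i1, i2, i3⟩ := u_sep (e3.trans_le hsx) (aux c3 (by linarith))
    refine ⟨c3, i1, i2.trans_eq ?_, i3.trans_eq ?_⟩
    · linear_combination (1/4*s)*r3
    · linear_combination (-1/4*s)*r3
  exfalso; linarith

theorem BS.step5 (h : BS v T O s x a b c) (hO : Tendsto O atBot (𝓝 0)) :
    Tendsto (fun τ => a τ * b τ + b τ * c τ + c τ * a τ) atBot (𝓝 0) ∨
    (∀ τ ≤ T, x τ = 0 ∧ b τ = c τ) ∨
    (∀ τ ≤ T, √3/2 * s τ - x τ/2 = 0 ∧ c τ = a τ) ∨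
    (∀ τ ≤ T, -(√3/2) * s τ - x τ/2 = 0 ∧ a τ = b τ) := by
  obtain ⟨T1, hT1, L, hL0, W, W', hW, hW', hWL, hLW, hbd⟩ := h.step5a hO
  have hv := h.v0
  rcases hL0.eq_or_lt with rfl | hL
  · left
    have := hWL.const_mul 2
    rw [mul_zero] at this
    refine tend_zero_of_le this (T' := T1) (fun τ hτ => ?_) (fun τ hτ => by linarith [(hbd τ hτ).1])
    have ha := h.a0 τ (hτ.trans hT1)
    have hb := h.b0 τ (hτ.trans hT1)
    have hc := h.c0 τ (hτ.trans hT1)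
    positivity
  right
  obtain ⟨T2, hT2⟩ := ev_Iic (hWL.eventually (ge_mem_nhds (show L < L + 1 by linarith)))
  have bd : AllBD O s x a b c := h.allBD (T' := min T1 T2) (B := 2*(L + 1)) (fun τ hτ => by
    linarith [(hbd τ (hτ.trans (min_le_left _ _))).1, hT2 τ (hτ.trans (min_le_right _ _))])
  have hh5 : BD (fun τ => h5 v (O τ) (s τ) (x τ) (a τ) (b τ) (c τ)) := by
    unfold h5
    have e1 : BD (fun τ => -s τ/2 - √3/2 * x τ) := by
      have := ((BD.const (-1/2)).mul bd.s).sub ((BD.const (√3/2)).mul bd.x)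
      convert this using 2; ring
    have e2 : BD (fun τ => -s τ/2 + √3/2 * x τ) := by
      have := ((BD.const (-1/2)).mul bd.s).add ((BD.const (√3/2)).mul bd.x)
      convert this using 2; ring
    have eO := (BD.const (2*v)).mul bd.O
    exact (BD.const (1/2)).mul ((((bd.b.mul bd.c).mul
      (((BD.const (1/4)).mul (((BD.const 1).add bd.s).pow 2)).add eO)).add
      ((bd.c.mul bd.a).mul (((BD.const (1/4)).mul (((BD.const 1).add e1).pow 2)).add eO))).add
      ((bd.a.mul bd.b).mul (((BD.const (1/4)).mul (((BD.const 1).add e2).pow 2)).add eO)))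
  have hev := barbalatBD hWL hW hW' hh5
  have h50 : ∀ τ ≤ T, 0 ≤ h5 v (O τ) (s τ) (x τ) (a τ) (b τ) (c τ) := fun τ hτ =>
    h5_nonneg hv (h.O0 τ hτ) (h.a0 τ hτ) (h.b0 τ hτ) (h.c0 τ hτ)
  have hten : Tendsto (fun τ => h5 v (O τ) (s τ) (x τ) (a τ) (b τ) (c τ)) atBot (𝓝 0) := by
    rw [Metric.tendsto_nhds]
    intro ε hε
    filter_upwards [hev ε hε, eventually_le_atBot T] with τ h1 h2
    rw [Real.dist_eq, sub_zero, abs_of_nonneg (h50 τ h2)]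
    exact h1
  set d := L/9 with hd
  have hd0 : 0 < d := by positivity
  obtain ⟨T3, hT3⟩ := ev_Iic (hev (d/800) (by positivity))
  obtain ⟨T4, hT4, hpk⟩ := h.pack (ε := 1/400) (by norm_num) (by norm_num)
  obtain ⟨Ta, Ca, hCa⟩ := bd.a
  obtain ⟨Tb, Cb, hCb⟩ := bd.b
  obtain ⟨Tc, Cc, hCc⟩ := bd.c
  obtain ⟨T5, k1, k3, k4, ka, kb, kc⟩ : ∃ T5, T5 ≤ T1 ∧ T5 ≤ T3 ∧ T5 ≤ T4 ∧ T5 ≤ Ta ∧ T5 ≤ Tb ∧ T5 ≤ Tc :=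
    ⟨min T1 (min T3 (min T4 (min Ta (min Tb Tc)))), by simp, by simp, by simp, by simp, by simp, by simp⟩
  have k0 := k1.trans hT1
  have hsel : ∀ τ ≤ T5, _ := fun τ hτ => sel5 (p := 0) hv (h.O0 τ (hτ.trans k0)) (h.a0 τ (hτ.trans k0))
    (h.b0 τ (hτ.trans k0)) (h.c0 τ (hτ.trans k0))
    (by have := (hpk τ (hτ.trans k4)).sb; linarith [h.O0 τ (hτ.trans k0)]) hd0
    (by linarith [(hbd τ (hτ.trans k1)).2, hLW τ (hτ.trans k1)]) (hT3 τ (hτ.trans k3)).le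
  have hBa : ∀ τ ≤ T5, a τ ≤ Ca := fun τ hτ => (le_abs_self _).trans (hCa τ (hτ.trans ka)).1
  have hBb : ∀ τ ≤ T5, b τ ≤ Cb := fun τ hτ => (le_abs_self _).trans (hCb τ (hτ.trans kb)).1
  have hBc : ∀ τ ≤ T5, c τ ≤ Cc := fun τ hτ => (le_abs_self _).trans (hCc τ (hτ.trans kc)).1
  have hW5 : ∀ τ ≤ T5, HasDerivAt W (W' τ) τ := fun τ hτ => hW τ (hτ.trans k1)
  have hW05 : ∀ τ ≤ T5, 0 ≤ W τ := fun τ hτ => hL.le.trans (hLW τ (hτ.trans k1))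
  have hW'5 := fun τ (hτ : τ ≤ T5) => hW' τ (hτ.trans k1)
  have terms : ∀ τ ≤ T5,
      1/2*(b τ*c τ*(1/4*(1 + s τ)^2 + 2*v*O τ)) ≤ h5 v (O τ) (s τ) (x τ) (a τ) (b τ) (c τ) ∧
      1/2*(c τ*a τ*(1/4*(1 + (-s τ/2 - √3/2 * x τ))^2 + 2*v*O τ)) ≤
        h5 v (O τ) (s τ) (x τ) (a τ) (b τ) (c τ) ∧
      1/2*(a τ*b τ*(1/4*(1 + (-s τ/2 + √3/2 * x τ))^2 + 2*v*O τ)) ≤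
        h5 v (O τ) (s τ) (x τ) (a τ) (b τ) (c τ) := by
    intro τ hτ
    have hO := h.O0 τ (hτ.trans k0)
    have ha := h.a0 τ (hτ.trans k0)
    have hb := h.b0 τ (hτ.trans k0)
    have hc := h.c0 τ (hτ.trans k0)
    have n1 : 0 ≤ b τ*c τ*(1/4*(1 + s τ)^2 + 2*v*O τ) := by positivity
    have n2 : 0 ≤ c τ*a τ*(1/4*(1 + (-s τ/2 - √3/2 * x τ))^2 + 2*v*O τ) := by positivity
    have n3 : 0 ≤ a τ*b τ*(1/4*(1 + (-s τ/2 + √3/2 * x τ))^2 + 2*v*O τ) := by positivity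
    unfold h5
    exact ⟨by linarith, by linarith, by linarith⟩
  have cs : ∀ τ ≤ T5, ContinuousAt (fun τ => 1 + s τ) τ := fun τ hτ =>
    (h.ds τ (hτ.trans k0)).continuousAt.const_add 1
  have cs2 : ∀ τ ≤ T5, ContinuousAt (fun τ => 1 + (-s τ/2 - √3/2 * x τ)) τ := fun τ hτ =>
    (h.rot.ds τ (hτ.trans k0)).continuousAt.const_add 1
  rcases dichotomy (a := 1/10) (b := 1) cs (fun τ hτ => by
    rcases hsel τ hτ with h1 | h1 | h1
    · exact .inl h1.2.1
    · exact .inr h1.2.2.1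
    · exact .inr h1.2.2.1) (by norm_num) with d1 | d1
  · left
    refine h.taub' (B := Cb + Cc) k0 hd0 (fun τ hτ => ?_) (fun τ hτ => add_le_add (hBb τ hτ) (hBc τ hτ))
      hW5 hW05 hten (fun τ hτ => (terms τ hτ).1) hW'5
    have := d1 τ hτ
    rcases hsel τ hτ with h1 | h1 | h1
    · exact h1.1
    · linarith [h1.2.2.1]
    · linarith [h1.2.2.1]
  right
  rcases dichotomy (a := 1/10) (b := 1) cs2 (fun τ hτ => by
    rcases hsel τ hτ with h1 | h1 | h1
    · exact .inr h1.2.2.1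
    · exact .inl h1.2.1
    · exact .inr h1.2.2.2) (by norm_num) with d2 | d2
  · left
    refine h.rot.taub' (B := Cc + Ca) k0 hd0 (fun τ hτ => ?_) (fun τ hτ => add_le_add (hBc τ hτ) (hBa τ hτ))
      hW5 hW05 hten (fun τ hτ => (terms τ hτ).2.1) hW'5
    have := d2 τ hτ
    have := d1 τ hτ
    rcases hsel τ hτ with h1 | h1 | h1
    · linarith [h1.2.1]
    · exact h1.1
    · linarith [h1.2.2.2]
  · right
    refine h.rot2.taub' (B := Ca + Cb) k0 hd0 (fun τ hτ => ?_) (fun τ hτ => add_le_add (hBa τ hτ) (hBb τ hτ))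
      hW5 hW05 hten (fun τ hτ => (terms τ hτ).2.2) hW'5
    have := d2 τ hτ
    have := d1 τ hτ
    rcases hsel τ hτ with h1 | h1 | h1
    · linarith [h1.2.1]
    · linarith [h1.2.1]
    · exact h1.1

lemma BS.O_dich (h : BS v T O s x a b c) : (∀ τ ≤ T, 0 < O τ) ∨ Tendsto O atBot (𝓝 0) := by
  by_cases hO : ∀ τ ≤ T, 0 < O τ
  · exact .inl hO
  right
  push Not at hO
  obtain ⟨t0, ht0, hOt⟩ := hO
  have hz : O t0 = 0 := le_antisymm hOt (h.O0 t0 ht0)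
  have hm := mono_Iic (T := t0) (f := fun τ => O τ * Real.exp (4*τ))
    (f' := fun τ => (2 * qv v (O τ) (s τ) (x τ) - 8 * v + 4) * (O τ * Real.exp (4*τ)))
    (fun τ hτ => by
      refine ((h.dO τ (hτ.trans ht0)).mul (((hasDerivAt_id τ).const_mul 4).exp)).congr_deriv ?_
      simp only [id]; ring)
    (fun τ hτ => by
      have h1 := h.q0 τ (hτ.trans ht0)
      have h2 := h.O0 τ (hτ.trans ht0)
      have h3 := h.v1
      have : 0 ≤ O τ * Real.exp (4*τ) := by positivity
      exact mul_nonneg (by linarith) this)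
  have : ∀ τ ≤ t0, O τ = 0 := fun τ hτ => by
    have h1 := hm (hτ : τ ≤ t0) (le_refl t0 : t0 ≤ t0) hτ
    simp only [hz, zero_mul] at h1
    have h2 := h.O0 τ (hτ.trans ht0)
    exact le_antisymm (by nlinarith [Real.exp_pos (4*τ)]) h2
  refine tendsto_const_nhds.congr' ?_
  filter_upwards [eventually_le_atBot t0] with τ hτ
  exact (this τ hτ).symm

lemma SolOn.toBS {γ : ℝ} (hγ1 : 2/3 < γ) (hγ2 : γ < 2) {O Sp Sm n1 n2 n3 : ℝ → ℝ}
    (h : SolOn γ (Set.Iic 0) O Sp Sm n1 n2 n3)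
    (hIX : ∀ τ ∈ Set.Iic (0:ℝ), 0 < n1 τ ∧ 0 < n2 τ ∧ 0 < n3 τ) :
    BS ((3*γ - 2)/8) 0 O Sp Sm n1 n2 n3 where
  v0 := by linarith
  v1 := by linarith
  dO := fun τ hτ => (h.hO τ hτ).congr_deriv (by unfold qf qv; ring)
  ds := fun τ hτ => (h.hSp τ hτ).congr_deriv (by unfold qf qv SPf; ring)
  dx := fun τ hτ => (h.hSm τ hτ).congr_deriv (by unfold qf qv SMf; ring)
  da := fun τ hτ => (h.hn1 τ hτ).congr_deriv (by unfold qf qv; ring)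
  db := fun τ hτ => (h.hn2 τ hτ).congr_deriv (by unfold qf qv; ring)
  dc := fun τ hτ => (h.hn3 τ hτ).congr_deriv (by unfold qf qv; ring)
  O0 := fun τ hτ => h.hOnn τ hτ
  a0 := fun τ hτ => (hIX τ hτ).1
  b0 := fun τ hτ => (hIX τ hτ).2.1
  c0 := fun τ hτ => (hIX τ hτ).2.2
  con := fun τ hτ => h.hcon τ hτ

/-- left side of the constraint -/
def RegC (y : EuclideanSpace ℝ (Fin 6)) : ℝ := y 0 + (y 1)^2 + (y 2)^2 +
  (3/4) * ((y 3)^2 + (y 4)^2 + (y 5)^2 - 2*(y 3*y 4 + y 4*y 5 + y 5*y 3))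

/-- the region used in the compactness argument -/
def Reg : Set (EuclideanSpace ℝ (Fin 6)) :=
  {y | RegC y = 1 ∧ 0 ≤ y 0 ∧ 0 ≤ y 3 ∧ 0 ≤ y 4 ∧ 0 ≤ y 5}

lemma Reg_closed : IsClosed Reg := by
  unfold Reg RegC
  simp only [Set.setOf_and]
  exact (isClosed_eq (by fun_prop) (by fun_prop)).inter ((isClosed_le (by fun_prop) (by fun_prop)).inter
    ((isClosed_le (by fun_prop) (by fun_prop)).inter ((isClosed_le (by fun_prop) (by fun_prop)).inter
      (isClosed_le (by fun_prop) (by fun_prop)))))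

lemma BS.infDist_tendsto (h : BS v T O s x a b c)
    (hg : Tendsto (fun τ => O τ + a τ * b τ + b τ * c τ + c τ * a τ) atBot (𝓝 0)) :
    Tendsto (fun τ => Metric.infDist (stateVec O s x a b c τ) attractor) atBot (𝓝 0) := by
  rw [Metric.tendsto_nhds]
  intro ε hε
  simp only [Real.dist_eq, sub_zero, abs_of_nonneg Metric.infDist_nonneg]
  set K : Set (EuclideanSpace ℝ (Fin 6)) :=
    (Metric.closedBall 0 4 ∩ Reg) ∩ {y | ε ≤ Metric.infDist y attractor} with hK
  have hKc : IsCompact K := ((isCompact_closedBall 0 4).inter_right Reg_closed).inter_right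
    (isClosed_le continuous_const (Metric.continuous_infDist_pt _))
  set g : EuclideanSpace ℝ (Fin 6) → ℝ := fun y => y 0 + y 3 * y 4 + y 4 * y 5 + y 5 * y 3 with hgd
  have hgc : Continuous g := by rw [hgd]; fun_prop
  have hm : ∃ m > 0, ∀ y ∈ K, m ≤ g y := by
    rcases K.eq_empty_or_nonempty with h0 | h0
    · exact ⟨1, one_pos, by simp [h0]⟩
    obtain ⟨p, hp, hpm⟩ := hKc.exists_isMinOn h0 hgc.continuousOn
    refine ⟨g p, ?_, fun y hy => hpm hy⟩
    obtain ⟨⟨_, hc, h0, h3, h4, h5⟩, hd⟩ := hp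
    by_contra hneg
    push Not at hneg
    have q1 := mul_nonneg h3 h4
    have q2 := mul_nonneg h4 h5
    have q3 := mul_nonneg h5 h3
    simp only [hgd] at hneg
    have : p ∈ attractor := ⟨hc, by linarith, by linarith, by linarith, by linarith⟩
    have hd' : ε ≤ Metric.infDist p attractor := hd
    rw [Metric.infDist_zero_of_mem this] at hd'
    linarith
  obtain ⟨m, hm0, hm⟩ := hm
  filter_upwards [hg.eventually (gt_mem_nhds (lt_min hm0 one_pos)), eventually_le_atBot T] with τ h1 hτ
  by_contra hneg
  push Not at hneg
  have ho := h.O0 τ hτ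
  have ha := h.a0 τ hτ
  have hb := h.b0 τ hτ
  have hc := h.c0 τ hτ
  have p1 := mul_pos ha hb
  have p2 := mul_pos hb hc
  have p3 := mul_pos hc ha
  have hcon := h.con τ hτ
  have hg1 := h1.trans_le (min_le_left _ _)
  have hg2 := h1.trans_le (min_le_right _ _)
  have hin : stateVec O s x a b c τ ∈ K := by
    refine ⟨⟨?_, ?_⟩, hneg⟩
    · rw [mem_closedBall_zero_iff, EuclideanSpace.norm_eq, Real.sqrt_le_left (by norm_num)]
      simp only [Fin.sum_univ_six, Real.norm_eq_abs, sq_abs]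
      show (O τ)^2 + (s τ)^2 + (x τ)^2 + (a τ)^2 + (b τ)^2 + (c τ)^2 ≤ 4^2
      have e1 : O τ ≤ 5/2 := by
        linarith [sq_nonneg (s τ), sq_nonneg (x τ), sq_nonneg (a τ), sq_nonneg (b τ), sq_nonneg (c τ)]
      have e2 : (O τ)^2 ≤ (5/2)^2 := pow_le_pow_left₀ ho e1 2
      linarith [sq_nonneg (s τ), sq_nonneg (x τ), sq_nonneg (a τ), sq_nonneg (b τ), sq_nonneg (c τ)]
    · exact ⟨hcon, ho, ha.le, hb.le, hc.le⟩
  have h2 : m ≤ O τ + a τ * b τ + b τ * c τ + c τ * a τ := hm _ hin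
  linarith

end Proof

/-- a generic Bianchi IX solution with `2/3 < γ < 2` converges to the
Bianchi attractor `𝒜` as `τ → -∞`. -/
theorem bianchiIX_generic_convergence_to_attractor
    (γ : ℝ) (hγ1 : 2/3 < γ) (hγ2 : γ < 2)
    (O Sp Sm n1 n2 n3 : ℝ → ℝ)
    (hsol : SolOn γ (Set.Iic 0) O Sp Sm n1 n2 n3)
    (hIX : ∀ τ ∈ Set.Iic (0:ℝ), 0 < n1 τ ∧ 0 < n2 τ ∧ 0 < n3 τ)
    (hgen : Generic γ (Set.Iic 0) O Sp Sm n1 n2 n3) :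
    Tendsto (fun τ => O τ + n1 τ * n2 τ + n2 τ * n3 τ + n3 τ * n1 τ) atBot (𝓝 0) ∧
    Tendsto (fun τ => Metric.infDist (stateVec O Sp Sm n1 n2 n3 τ) attractor)
      atBot (𝓝 0) := by
  have h := hsol.toBS hγ1 hγ2 hIX
  obtain ⟨gT, gF, g1, g2, g3⟩ := hgen
  have hO : Tendsto O atBot (𝓝 0) := by
    rcases h.O_dich with hpos | h0
    · rcases h.step4 hpos with ⟨t1, t2, t3, t4, t5, t6⟩ | ⟨t1, t2, t3, t4, t5, t6⟩ |
        ⟨t1, t2, t3, t4, t5, t6⟩ | tf | t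
      · refine absurd ⟨?_, t2, t3, t4, t5, t6⟩ g1
        convert t1 using 2; ring
      · refine absurd ⟨?_, ?_, ?_, t6, t4, t5⟩ g2
        · convert t1 using 2; ring
        · have := (t2.const_mul (-(1/2))).add (t3.const_mul (√3/2))
          convert this using 2
          · linear_combination (-(1/4) * Sp _) * r3
          · ring
        · have := (t2.const_mul (-(√3/2))).add (t3.const_mul (-(1/2)))
          convert this using 2
          · linear_combination (-(1/4) * Sm _) * r3
          · ring
      · refine absurd ⟨?_, ?_, ?_, t5, t6, t4⟩ g3
        · convert t1 using 2; ring
        · have := (t2.const_mul (-(1/2))).add (t3.const_mul (-(√3/2)))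
          convert this using 2
          · linear_combination (-(1/4) * Sp _) * r3
          · ring
        · have := (t2.const_mul (√3/2)).add (t3.const_mul (-(1/2)))
          convert this using 2
          · linear_combination (-(1/4) * Sm _) * r3
          · ring
      · exact absurd tf gF
      · exact t
    · exact h0
  have hV : Tendsto (fun τ => n1 τ * n2 τ + n2 τ * n3 τ + n3 τ * n1 τ) atBot (𝓝 0) := by
    rcases h.step5 hO with hV | h1 | h1 | h1
    · exact hV
    · exact absurd (.inl fun τ hτ => h1 τ hτ) gT
    · refine absurd (.inr (.inr fun τ hτ => ⟨?_, (h1 τ hτ).2⟩)) gT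
      linarith [(h1 τ hτ).1]
    · refine absurd (.inr (.inl fun τ hτ => ⟨?_, (h1 τ hτ).2⟩)) gT
      linarith [(h1 τ hτ).1]
  have hfin : Tendsto (fun τ => O τ + n1 τ * n2 τ + n2 τ * n3 τ + n3 τ * n1 τ) atBot (𝓝 0) := by
    have := hO.add hV
    rw [add_zero] at this
    exact this.congr (fun τ => by ring)
  exact ⟨hfin, h.infDist_tendsto hfin⟩

end WainwrightHsu
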